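/- Let u be a bounded weak solution of the Navier–Stokes equations in ℝ²×(−∞,0). Then there exists a bounded measurable function b : (−∞,0) → ℝ² such that u(x,t) = b(t) for almost every (x,t) ∈ ℝ²×(−∞,0). -/

import Mathlib

open MeasureTheory Real Filter Topology

noncomputable section

/-- Euclidean space ℝⁿ. -/
abbrev Euc (n : ℕ) := EuclideanSpace ℝ (Fin n)

/-- The heat kernel Γ(x,t) = (4πt)^{-n/2} exp(-|x|²/(4t)). -/
noncomputable def heatKer (n : ℕ) (x : Euc n) (t : ℝ) : ℝ :=
  (4 * π * t) ^ (-(n : ℝ) / 2) * Real.exp (-‖x‖ ^ 2 / (4 * t))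

/-- The fundamental solution G of the Laplacian on ℝⁿ (n ≥ 2). -/
noncomputable def lapFund (n : ℕ) (x : Euc n) : ℝ :=
  if n = 2 then (2 * π)⁻¹ * Real.log ‖x‖
  else -((((n : ℝ) - 2) * (2 * π ^ ((n : ℝ) / 2) / Real.Gamma ((n : ℝ) / 2)))⁻¹) *
      ‖x‖ ^ (2 - (n : ℝ))

/-- The generating function Φ(x,t) = ∫_{ℝⁿ} G(y) Γ(x-y,t) dy. -/
noncomputable def genPhi (n : ℕ) (x : Euc n) (t : ℝ) : ℝ :=
  ∫ y : Euc n, lapFund n y * heatKer n (x - y) t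

/-- Spatial partial derivative ∂f/∂x_i of a scalar function on ℝⁿ. -/
noncomputable def pd (n : ℕ) (i : Fin n) (f : Euc n → ℝ) (x : Euc n) : ℝ :=
  fderiv ℝ f x (EuclideanSpace.single i 1)

/-- The Laplacian of a scalar function on ℝⁿ. -/
noncomputable def lap (n : ℕ) (f : Euc n → ℝ) (x : Euc n) : ℝ :=
  ∑ i : Fin n, pd n i (pd n i f) x

/-- The Oseen kernel K_{ij} = (-δ_{ij}Δ + ∂²/∂x_i∂x_j)Φ. -/
noncomputable def Kmat (n : ℕ) (i j : Fin n) (x : Euc n) (t : ℝ) : ℝ :=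
  (if i = j then -(lap n (fun y => genPhi n y t) x) else 0)
    + pd n i (pd n j (fun y => genPhi n y t)) x

/-- The kernel K_{ijk} = ∂K_{ij}/∂x_k. -/
noncomputable def Kten (n : ℕ) (i j k : Fin n) (x : Euc n) (t : ℝ) : ℝ :=
  pd n k (fun y => Kmat n i j y t) x

/-- Mild solution of the Navier–Stokes equations on ℝⁿ × (t₀,t₁) with initial datum u₀:
u_i(x,t) = ∫ Γ(x-y,t-t₀) u₀ᵢ(y) dy - ∫_{t₀}^t ∫ K_{ijk}(x-y,t-s) u_k u_j dy ds. -/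
def IsMildNS (n : ℕ) (t₀ t₁ : ℝ) (u₀ : Euc n → Euc n) (u : Euc n → ℝ → Euc n) : Prop :=
  ∀ x : Euc n, ∀ t : ℝ, t ∈ Set.Ioo t₀ t₁ → ∀ i : Fin n,
    u x t i = (∫ y : Euc n, heatKer n (x - y) (t - t₀) * u₀ y i)
      - ∫ s in Set.Ioo t₀ t, ∫ y : Euc n,
          ∑ j : Fin n, ∑ k : Fin n, Kten n i j k (x - y) (t - s) * u y s k * u y s j

/-- Spatial partial derivative for functions on space-time ℝⁿ × ℝ. -/
noncomputable def pdx (n : ℕ) (i : Fin n) (g : Euc n × ℝ → ℝ) (p : Euc n × ℝ) : ℝ :=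
  fderiv ℝ g p (EuclideanSpace.single i 1, 0)

/-- Time derivative for functions on space-time ℝⁿ × ℝ. -/
noncomputable def pdt (n : ℕ) (g : Euc n × ℝ → ℝ) (p : Euc n × ℝ) : ℝ :=
  fderiv ℝ g p (0, 1)

/-- Spatial Laplacian for functions on space-time ℝⁿ × ℝ. -/
noncomputable def lapx (n : ℕ) (g : Euc n × ℝ → ℝ) (p : Euc n × ℝ) : ℝ :=
  ∑ i : Fin n, pdx n i (pdx n i g) p

/-- Weak solution of the Navier–Stokes equations on ℝⁿ × S (S ⊆ ℝ a time interval):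
div u = 0 in the sense of distributions, and
∫∫ u·(∂_tφ + Δφ) dx dt = -∫∫ u_k u·∂_kφ dx dt for every smooth compactly supported
divergence-free test field φ supported in ℝⁿ × S. -/
def IsWeakNS (n : ℕ) (S : Set ℝ) (u : Euc n → ℝ → Euc n) : Prop :=
  (∀ ψ : Euc n × ℝ → ℝ, ContDiff ℝ (⊤ : ℕ∞) ψ → HasCompactSupport ψ →
      tsupport ψ ⊆ Set.univ ×ˢ S →
      (∫ p in (Set.univ ×ˢ S : Set (Euc n × ℝ)),
        ∑ i : Fin n, u p.1 p.2 i * pdx n i ψ p) = 0) ∧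
  (∀ φ : Euc n × ℝ → Euc n, ContDiff ℝ (⊤ : ℕ∞) φ → HasCompactSupport φ →
      tsupport φ ⊆ Set.univ ×ˢ S →
      (∀ p : Euc n × ℝ, (∑ i : Fin n, pdx n i (fun q => φ q i) p) = 0) →
      (∫ p in (Set.univ ×ˢ S : Set (Euc n × ℝ)),
          ∑ i : Fin n, u p.1 p.2 i *
            (pdt n (fun q => φ q i) p + lapx n (fun q => φ q i) p))
        = -(∫ p in (Set.univ ×ˢ S : Set (Euc n × ℝ)),
            ∑ i : Fin n, ∑ k : Fin n,
              u p.1 p.2 k * u p.1 p.2 i * pdx n k (fun q => φ q i) p))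

/-- The two-dimensional heat kernel. -/
def gk (s : ℝ) (z : Euc 2) : ℝ := (4 * π * s)⁻¹ * Real.exp (-‖z‖ ^ 2 / (4 * s))

/-- First spatial derivatives of the heat kernel. -/
def gkD (i : Fin 2) (s : ℝ) (z : Euc 2) : ℝ := -(z i / (2 * s)) * gk s z

/-- Second spatial derivatives of the heat kernel. -/
def gkDD (i j : Fin 2) (s : ℝ) (z : Euc 2) : ℝ :=
  (z i * z j / (4 * s ^ 2) - if i = j then 1 / (2 * s) else 0) * gk s z

/-- The Laplacian (equivalently, the time derivative) of the heat kernel. -/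
def gkL (s : ℝ) (z : Euc 2) : ℝ := (‖z‖ ^ 2 / (4 * s ^ 2) - 1 / s) * gk s z

/-- First spatial derivatives of the Laplacian of the heat kernel. -/
def gkLD (i : Fin 2) (s : ℝ) (z : Euc 2) : ℝ :=
  z i * (1 / s ^ 2 - ‖z‖ ^ 2 / (8 * s ^ 3)) * gk s z

lemma gk_nonneg {s : ℝ} (hs : 0 < s) (z : Euc 2) : 0 ≤ gk s z := by
  unfold gk; positivity

lemma sq_coord_le (z : Euc 2) (i : Fin 2) : |z i| ≤ ‖z‖ := by
  simpa using PiLp.norm_apply_le z i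

lemma norm_sq_eq_coords (z : Euc 2) : ‖z‖ ^ 2 = z 0 ^ 2 + z 1 ^ 2 := by
  simp [EuclideanSpace.norm_sq_eq]

lemma integral_gk {s : ℝ} (hs : 0 < s) : ∫ z, gk s z = 1 := by
  have h := GaussianFourier.integral_rexp_neg_mul_sq_norm (V := Euc 2) (b := (4 * s)⁻¹)
    (by positivity)
  have e : ∀ z : Euc 2, -‖z‖ ^ 2 / (4 * s) = -(4 * s)⁻¹ * ‖z‖ ^ 2 := fun z => by
    field_simp
  simp only [gk, e, integral_const_mul, h]
  simp
  field_simp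

lemma integrable_gk {s : ℝ} (hs : 0 < s) : Integrable (gk s) := by
  apply Integrable.of_integral_ne_zero
  rw [integral_gk hs]; norm_num

lemma continuous_gk (s : ℝ) : Continuous (gk s) := by
  unfold gk; fun_prop

lemma continuous_gkD (i : Fin 2) (s : ℝ) : Continuous (gkD i s) := by
  have := continuous_gk s
  unfold gkD; fun_prop

lemma continuous_gkDD (i j : Fin 2) (s : ℝ) : Continuous (gkDD i j s) := by
  have := continuous_gk s
  unfold gkDD; fun_prop

lemma continuous_gkL (s : ℝ) : Continuous (gkL s) := by
  have := continuous_gk s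
  unfold gkL; fun_prop

lemma continuous_gkLD (i : Fin 2) (s : ℝ) : Continuous (gkLD i s) := by
  have := continuous_gk s
  unfold gkLD; fun_prop

/-- Powers of `‖z‖²/(8s)` are absorbed by doubling the time in the heat kernel. -/
lemma pow_mul_gk_le {s : ℝ} (hs : 0 < s) (z : Euc 2) (n : ℕ) :
    (‖z‖ ^ 2 / (8 * s)) ^ n * gk s z ≤ 2 * n.factorial * gk (2 * s) z := by
  have hw : 0 ≤ ‖z‖ ^ 2 / (8 * s) := by positivity
  have h := Real.pow_div_factorial_le_exp _ hw n
  have hn : (0 : ℝ) < n.factorial := by exact_mod_cast n.factorial_pos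
  rw [div_le_iff₀ hn] at h
  have e1 : gk s z = (4 * π * s)⁻¹ * (Real.exp (-(‖z‖ ^ 2 / (8 * s))) *
      Real.exp (-(‖z‖ ^ 2 / (8 * s)))) := by
    rw [← Real.exp_add, gk]; congr 2; field_simp; ring
  have e2 : gk (2 * s) z = (4 * π * s)⁻¹ / 2 * Real.exp (-(‖z‖ ^ 2 / (8 * s))) := by
    rw [gk]
    have : -‖z‖ ^ 2 / (4 * (2 * s)) = -(‖z‖ ^ 2 / (8 * s)) := by field_simp; ring
    rw [this]; congr 1; field_simp
  rw [e1, e2]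
  set w := ‖z‖ ^ 2 / (8 * s)
  have h2 : w ^ n * Real.exp (-w) ≤ n.factorial := by
    rw [Real.exp_neg, ← div_eq_mul_inv, div_le_iff₀ (Real.exp_pos _)]; linarith
  have h3 : 0 ≤ (4 * π * s)⁻¹ * Real.exp (-w) := by positivity
  nlinarith [mul_le_mul_of_nonneg_left h2 h3]

lemma norm_le_sqrt_mul {s : ℝ} (hs : 0 < s) (z : Euc 2) :
    ‖z‖ ≤ √s * ((1 + 8 * (‖z‖ ^ 2 / (8 * s))) / 2) := by
  have h1 : 0 < √s := Real.sqrt_pos.2 hs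
  have h2 : √s ^ 2 = s := Real.sq_sqrt hs.le
  have e : √s * ((1 + 8 * (‖z‖ ^ 2 / (8 * s))) / 2) = (√s ^ 2 + ‖z‖ ^ 2) / (2 * √s) := by
    nth_rewrite 2 [← h2]
    field_simp
  rw [e, le_div_iff₀ (by positivity)]
  nlinarith [sq_nonneg (√s - ‖z‖)]

lemma abs_gkD_le {s : ℝ} (hs : 0 < s) (i : Fin 2) (z : Euc 2) :
    |gkD i s z| ≤ 5 / √s * gk (2 * s) z := by
  have h1 : 0 < √s := Real.sqrt_pos.2 hs
  have h2 : √s ^ 2 = s := Real.sq_sqrt hs.le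
  have hz := (sq_coord_le z i).trans (norm_le_sqrt_mul hs z)
  have hg := gk_nonneg hs z
  have p0 := pow_mul_gk_le hs z 0
  have p1 := pow_mul_gk_le hs z 1
  set w := ‖z‖ ^ 2 / (8 * s)
  have e : |gkD i s z| = |z i| / (2 * s) * gk s z := by
    rw [gkD, abs_mul, abs_neg, abs_div, abs_of_nonneg hg, abs_of_pos (by positivity : 0 < 2 * s)]
  have e2 : √s * ((1 + 8 * w) / 2) / (2 * s) = 1 / √s * ((1 + 8 * w) / 4) := by
    nth_rewrite 2 [← h2]; field_simp; ring
  rw [e]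
  calc |z i| / (2 * s) * gk s z ≤ √s * ((1 + 8 * w) / 2) / (2 * s) * gk s z := by gcongr
    _ = 1 / √s * ((1 + 8 * w) / 4 * gk s z) := by rw [e2]; ring
    _ ≤ 1 / √s * (5 * gk (2 * s) z) := by
        refine mul_le_mul_of_nonneg_left ?_ (by positivity)
        simp at p0 p1
        have := gk_nonneg (by positivity : 0 < 2 * s) z
        nlinarith
    _ = _ := by ring

lemma abs_gkDD_le {s : ℝ} (hs : 0 < s) (i j : Fin 2) (z : Euc 2) :
    |gkDD i j s z| ≤ 5 / s * gk (2 * s) z := by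
  have hg := gk_nonneg hs z
  have p0 := pow_mul_gk_le hs z 0
  have p1 := pow_mul_gk_le hs z 1
  have hw : ‖z‖ ^ 2 / (4 * s ^ 2) = 2 * (‖z‖ ^ 2 / (8 * s)) / s := by field_simp; ring
  set w := ‖z‖ ^ 2 / (8 * s)
  have hij : |z i * z j| ≤ ‖z‖ ^ 2 := by
    rw [abs_mul, sq]
    exact mul_le_mul (sq_coord_le z i) (sq_coord_le z j) (abs_nonneg _) (norm_nonneg _)
  have h1 : |z i * z j / (4 * s ^ 2) - if i = j then 1 / (2 * s) else 0| ≤ (2 * w + 1 / 2) / s := by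
    refine (abs_sub _ _).trans ?_
    have : |(if i = j then 1 / (2 * s) else 0 : ℝ)| ≤ (1 / 2) / s := by
      split_ifs
      · rw [abs_of_pos (by positivity)]; apply le_of_eq; field_simp
      · simp; positivity
    have h3 : |z i * z j / (4 * s ^ 2)| ≤ 2 * w / s := by
      rw [← hw, abs_div, abs_of_pos (by positivity : 0 < 4 * s ^ 2)]; gcongr
    calc _ ≤ 2 * w / s + (1 / 2) / s := add_le_add h3 this
      _ = _ := by ring
  rw [gkDD, abs_mul, abs_of_nonneg hg]
  calc _ ≤ (2 * w + 1 / 2) / s * gk s z := by gcongr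
    _ = 1 / s * ((2 * w + 1 / 2) * gk s z) := by ring
    _ ≤ 1 / s * (5 * gk (2 * s) z) := by
        refine mul_le_mul_of_nonneg_left ?_ (by positivity)
        simp at p0 p1
        nlinarith
    _ = _ := by ring

lemma gkL_eq (s : ℝ) (z : Euc 2) : gkL s z = gkDD 0 0 s z + gkDD 1 1 s z := by
  simp only [gkL, gkDD, norm_sq_eq_coords, if_true]
  rcases eq_or_ne s 0 with rfl | h
  · simp
  · field_simp; ring

lemma abs_gkL_le {s : ℝ} (hs : 0 < s) (z : Euc 2) : |gkL s z| ≤ 10 / s * gk (2 * s) z := by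
  rw [gkL_eq]
  calc _ ≤ |gkDD 0 0 s z| + |gkDD 1 1 s z| := abs_add_le _ _
    _ ≤ 5 / s * gk (2 * s) z + 5 / s * gk (2 * s) z :=
        add_le_add (abs_gkDD_le hs 0 0 z) (abs_gkDD_le hs 1 1 z)
    _ = _ := by ring

lemma abs_gkLD_le {s : ℝ} (hs : 0 < s) (i : Fin 2) (z : Euc 2) :
    |gkLD i s z| ≤ 26 * √s / s ^ 2 * gk (2 * s) z := by
  have h1 : 0 < √s := Real.sqrt_pos.2 hs
  have hz := (sq_coord_le z i).trans (norm_le_sqrt_mul hs z)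
  have hg := gk_nonneg hs z
  have p0 := pow_mul_gk_le hs z 0
  have p1 := pow_mul_gk_le hs z 1
  have p2 := pow_mul_gk_le hs z 2
  have hw : ‖z‖ ^ 2 / (8 * s ^ 3) = (‖z‖ ^ 2 / (8 * s)) / s ^ 2 := by field_simp
  have hw0 : 0 ≤ ‖z‖ ^ 2 / (8 * s) := by positivity
  rw [gkLD, hw]
  set w := ‖z‖ ^ 2 / (8 * s)
  rw [abs_mul, abs_mul, abs_of_nonneg hg]
  have h2 : |1 / s ^ 2 - w / s ^ 2| ≤ (1 + w) / s ^ 2 := by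
    rw [← sub_div, abs_div, abs_of_pos (by positivity : 0 < s ^ 2)]
    gcongr
    rw [abs_le]; constructor <;> linarith
  calc _ ≤ √s * ((1 + 8 * w) / 2) * ((1 + w) / s ^ 2) * gk s z := by gcongr
    _ = √s / s ^ 2 * ((1 + 8 * w) * (1 + w) / 2 * gk s z) := by ring
    _ ≤ √s / s ^ 2 * (26 * gk (2 * s) z) := by
        refine mul_le_mul_of_nonneg_left ?_ (by positivity)
        simp [Nat.factorial] at p0 p1 p2
        nlinarith
    _ = _ := by ring

/-- Standard basis vectors of the plane. -/
abbrev bv (i : Fin 2) : Euc 2 := EuclideanSpace.single i 1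

lemma hasLineDerivAt_mul {f g : Euc 2 → ℝ} {f' g' : ℝ} {x v : Euc 2}
    (hf : HasLineDerivAt ℝ f f' x v) (hg : HasLineDerivAt ℝ g g' x v) :
    HasLineDerivAt ℝ (fun y => f y * g y) (f' * g x + f x * g') x v := by
  have h := HasDerivAt.mul hf hg
  simp only [zero_smul, add_zero] at h
  exact h

lemma hasLineDerivAt_coord (i j : Fin 2) (z : Euc 2) :
    HasLineDerivAt ℝ (fun z : Euc 2 => z j) (if i = j then 1 else 0) z (bv i) := by
  unfold HasLineDerivAt
  have : HasDerivAt (fun t : ℝ => z j + t * (if i = j then 1 else 0)) (1 * (if i = j then 1 else 0))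
      0 := ((hasDerivAt_id (0 : ℝ)).mul_const _).const_add _
  simpa [eq_comm (a := i)] using this

lemma hasLineDerivAt_radial {q : ℝ → ℝ} {q' : ℝ} (i : Fin 2) (z : Euc 2)
    (h : HasDerivAt q q' (‖z‖ ^ 2)) :
    HasLineDerivAt ℝ (fun z : Euc 2 => q (‖z‖ ^ 2)) (2 * z i * q') z (bv i) := by
  have h1 := (h.comp_hasFDerivAt z (hasStrictFDerivAt_norm_sq z).hasFDerivAt).hasLineDerivAt (bv i)
  exact (h1 : HasDerivAt _ _ _).congr_deriv (by simp [EuclideanSpace.inner_single_right]; ring)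

lemma hasLineDerivAt_gk (s : ℝ) (i : Fin 2) (z : Euc 2) :
    HasLineDerivAt ℝ (gk s) (gkD i s z) z (bv i) := by
  have h : HasDerivAt (fun r : ℝ => (4 * π * s)⁻¹ * Real.exp (-r / (4 * s)))
      ((4 * π * s)⁻¹ * (Real.exp (-‖z‖ ^ 2 / (4 * s)) * (-1 / (4 * s)))) (‖z‖ ^ 2) := by
    exact (((hasDerivAt_id (‖z‖ ^ 2)).neg.div_const (4 * s)).exp).const_mul _
  exact (hasLineDerivAt_radial i z h : HasDerivAt _ _ _).congr_deriv (by unfold gkD gk; ring)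

lemma hasLineDerivAt_gkD (s : ℝ) (i j : Fin 2) (z : Euc 2) :
    HasLineDerivAt ℝ (gkD j s) (gkDD i j s z) z (bv i) := by
  have h0 : HasLineDerivAt ℝ (fun z => -(1 / (2 * s)) * gk s z) (-(1 / (2 * s)) * gkD i s z) z
      (bv i) := (hasLineDerivAt_gk s i z : HasDerivAt _ _ _).const_mul _
  have h := hasLineDerivAt_mul (hasLineDerivAt_coord i j z) h0
  have e : gkD j s = fun z => z j * (-(1 / (2 * s)) * gk s z) := by
    ext y; unfold gkD; ring
  rw [e]
  exact (h : HasDerivAt _ _ _).congr_deriv (by unfold gkDD gkD; split_ifs <;> ring)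

lemma hasDerivAt_gk {s : ℝ} (hs : 0 < s) (z : Euc 2) :
    HasDerivAt (fun s => gk s z) (gkL s z) s := by
  have h1 : HasDerivAt (fun s : ℝ => 4 * π * s) (4 * π * 1) s := (hasDerivAt_id s).const_mul _
  have h2 : HasDerivAt (fun s : ℝ => -‖z‖ ^ 2 / (4 * s)) _ s :=
    (hasDerivAt_const s (-‖z‖ ^ 2)).div ((hasDerivAt_id s).const_mul 4) (by simpa using hs.ne')
  have := (h1.inv (by positivity)).mul h2.exp
  refine HasDerivAt.congr_deriv (f := fun s => gk s z) this ?_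
  unfold gkL gk
  simp
  field_simp
  ring

lemma hasDerivAt_gkD {s : ℝ} (hs : 0 < s) (i : Fin 2) (z : Euc 2) :
    HasDerivAt (fun s => gkD i s z) (gkLD i s z) s := by
  have h2 : HasDerivAt (fun s : ℝ => -(z i / (2 * s))) _ s :=
    ((hasDerivAt_const s (z i)).div ((hasDerivAt_id s).const_mul 2) (by simpa using hs.ne')).neg
  have := h2.mul (hasDerivAt_gk hs z)
  refine HasDerivAt.congr_deriv (f := fun s => gkD i s z) this ?_
  unfold gkLD gkL
  simp
  field_simp
  ring

/-- A function dominated by a heat kernel. -/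
def GaussBdd (k : Euc 2 → ℝ) : Prop :=
  Continuous k ∧ ∃ C s : ℝ, 0 ≤ C ∧ 0 < s ∧ ∀ z, |k z| ≤ C * gk s z

lemma gaussBdd_gk {s : ℝ} (hs : 0 < s) : GaussBdd (gk s) :=
  ⟨continuous_gk s, 1, s, zero_le_one, hs, fun z => by rw [abs_of_nonneg (gk_nonneg hs z), one_mul]⟩

lemma gaussBdd_gkD {s : ℝ} (hs : 0 < s) (i : Fin 2) : GaussBdd (gkD i s) :=
  ⟨continuous_gkD i s, _, 2 * s, by positivity, by positivity, abs_gkD_le hs i⟩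

lemma gaussBdd_gkDD {s : ℝ} (hs : 0 < s) (i j : Fin 2) : GaussBdd (gkDD i j s) :=
  ⟨continuous_gkDD i j s, _, 2 * s, by positivity, by positivity, abs_gkDD_le hs i j⟩

lemma gaussBdd_gkL {s : ℝ} (hs : 0 < s) : GaussBdd (gkL s) :=
  ⟨continuous_gkL s, _, 2 * s, by positivity, by positivity, abs_gkL_le hs⟩

lemma GaussBdd.integrable {k : Euc 2 → ℝ} (hk : GaussBdd k) : Integrable k := by
  obtain ⟨hc, C, s, hC, hs, h⟩ := hk
  exact ((integrable_gk hs).const_mul C).mono' hc.aestronglyMeasurable (ae_of_all _ h)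

lemma gk_shift_le {s : ℝ} (hs : 0 < s) (z w : Euc 2) (hw : ‖w‖ ≤ 1) :
    gk s (z + w) ≤ 2 * Real.exp (1 / (4 * s)) * gk (2 * s) z := by
  have h1 : ‖z‖ ≤ ‖z + w‖ + ‖w‖ := by
    simpa using norm_sub_le (z + w) w
  have h2 : ‖z‖ ^ 2 ≤ 2 * ‖z + w‖ ^ 2 + 2 := by
    have := norm_nonneg z
    nlinarith [norm_nonneg (z + w), norm_nonneg w, sq_nonneg (‖z + w‖ - 1)]
  have e : 2 * Real.exp (1 / (4 * s)) * gk (2 * s) z =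
      (4 * π * s)⁻¹ * Real.exp (1 / (4 * s) + -‖z‖ ^ 2 / (4 * (2 * s))) := by
    rw [gk, Real.exp_add]; field_simp
  rw [e, gk]
  gcongr
  rw [show 1 / (4 * s) + -‖z‖ ^ 2 / (4 * (2 * s)) = (1 - ‖z‖ ^ 2 / 2) / (4 * s) by field_simp; ring]
  gcongr
  linarith

lemma gk_time_le {a b s : ℝ} (ha : 0 < a) (h1 : a ≤ s) (h2 : s ≤ b) (z : Euc 2) :
    gk s z ≤ b / a * gk b z := by
  have hs : 0 < s := ha.trans_le h1
  have hb : 0 < b := hs.trans_le h2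
  have e : b / a * gk b z = (4 * π * a)⁻¹ * Real.exp (-‖z‖ ^ 2 / (4 * b)) := by
    rw [gk]; field_simp
  rw [e, gk]
  gcongr ?_ * Real.exp ?_
  · gcongr
  · rw [neg_div, neg_div]; gcongr

/-- Convolution of a kernel with a bounded function on the plane. -/
def cv (k b : Euc 2 → ℝ) (x : Euc 2) : ℝ := ∫ y, k (x - y) * b y

lemma cv_eq (k b : Euc 2 → ℝ) (x : Euc 2) : cv k b x = ∫ z, k z * b (x - z) := by
  have := integral_sub_left_eq_self (fun z => k z * b (x - z)) volume x
  simpa [cv] using this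

/-- Bounded measurable functions on the plane. -/
def BddMeas (B : ℝ) (b : Euc 2 → ℝ) : Prop := Measurable b ∧ ∀ y, |b y| ≤ B

lemma BddMeas.nonneg {B : ℝ} {b : Euc 2 → ℝ} (hb : BddMeas B b) : 0 ≤ B :=
  (abs_nonneg _).trans (hb.2 0)

lemma GaussBdd.comp_sub {k : Euc 2 → ℝ} (hk : GaussBdd k) (x : Euc 2) :
    Integrable (fun y => k (x - y)) := by
  simpa using hk.integrable.comp_sub_left x

lemma cv_integrable {k b : Euc 2 → ℝ} {B : ℝ} (hk : Integrable k) (hb : BddMeas B b)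
    (x : Euc 2) : Integrable (fun y => k (x - y) * b y) :=
  (hk.comp_sub_left x).mul_bdd hb.1.aestronglyMeasurable (ae_of_all _ hb.2)

lemma cv_integrable' {k b : Euc 2 → ℝ} {B : ℝ} (hk : Integrable k) (hb : BddMeas B b)
    (x : Euc 2) : Integrable (fun z => k z * b (x - z)) :=
  hk.mul_bdd (hb.1.comp (measurable_const.sub measurable_id)).aestronglyMeasurable
    (ae_of_all _ fun _ => hb.2 _)

lemma abs_cv_le {k b : Euc 2 → ℝ} {B C s : ℝ} (hs : 0 < s) (hk : ∀ z, |k z| ≤ C * gk s z)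
    (hb : ∀ y, |b y| ≤ B) (x : Euc 2) : |cv k b x| ≤ C * B := by
  rw [cv_eq]
  have h : ∀ z, ‖k z * b (x - z)‖ ≤ C * B * gk s z := fun z => by
    rw [Real.norm_eq_abs, abs_mul]
    calc _ ≤ (C * gk s z) * B := by
          gcongr
          · exact (abs_nonneg _).trans (hk z)
          · exact hk z
          · exact hb _
      _ = _ := by ring
  have := norm_integral_le_of_norm_le ((integrable_gk hs).const_mul (C * B)) (ae_of_all _ h)
  rwa [integral_const_mul, integral_gk hs, mul_one] at this

lemma cv_measurable {k b : Euc 2 → ℝ} (hk : Continuous k) (hb : Measurable b) :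
    Measurable (cv k b) := by
  have : StronglyMeasurable (Function.uncurry fun x y : Euc 2 => k (x - y) * b y) := by
    apply Measurable.stronglyMeasurable
    unfold Function.uncurry
    have := hk.measurable
    fun_prop
  exact this.integral_prod_right.measurable

lemma cv_bddMeas {k b : Euc 2 → ℝ} {B C s : ℝ} (hs : 0 < s) (hc : Continuous k)
    (hk : ∀ z, |k z| ≤ C * gk s z) (hb : BddMeas B b) : BddMeas (C * B) (cv k b) :=
  ⟨cv_measurable hc hb.1, abs_cv_le hs hk hb.2⟩

/-- Differentiation of a convolution falls on the kernel. -/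
lemma cv_lineDeriv_kernel {k k' b : Euc 2 → ℝ} {B : ℝ} {v : Euc 2} (hv : ‖v‖ ≤ 1)
    (hk : GaussBdd k) (hk' : GaussBdd k') (hd : ∀ z, HasLineDerivAt ℝ k (k' z) z v)
    (hb : BddMeas B b) (x : Euc 2) : HasLineDerivAt ℝ (cv k b) (cv k' b x) x v := by
  obtain ⟨hc', C, s, hC, hs, hkb⟩ := hk'
  have hB := hb.nonneg
  have key := hasDerivAt_integral_of_dominated_loc_of_deriv_le (μ := (volume : Measure (Euc 2)))
    (F := fun (t : ℝ) y => k (x + t • v - y) * b y)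
    (F' := fun t y => k' (x + t • v - y) * b y) (x₀ := (0 : ℝ)) (s := Metric.ball 0 1)
    (bound := fun y => C * (2 * Real.exp (1 / (4 * s)) * gk (2 * s) (x - y)) * B)
    (Metric.ball_mem_nhds _ one_pos) ?_ ?_ ?_ ?_ ?_ ?_
  · simpa [HasLineDerivAt, cv] using key.2
  · refine Eventually.of_forall fun t => ?_
    exact (cv_integrable hk.integrable hb _).aestronglyMeasurable
  · exact cv_integrable hk.integrable hb _
  · exact (cv_integrable (GaussBdd.integrable ⟨hc', C, s, hC, hs, hkb⟩) hb _).aestronglyMeasurable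
  · refine ae_of_all _ fun y t ht => ?_
    rw [Real.norm_eq_abs, abs_mul]
    have e : x + t • v - y = (x - y) + t • v := by abel
    have ht' : ‖t • v‖ ≤ 1 := by
      rw [norm_smul]
      have : ‖t‖ ≤ 1 := by simpa using (Metric.mem_ball.1 ht).le
      exact mul_le_one₀ this (norm_nonneg _) hv
    gcongr
    · exact mul_nonneg hC (mul_nonneg (by positivity) (gk_nonneg (by positivity) _))
    · rw [e]
      exact (hkb _).trans (mul_le_mul_of_nonneg_left (gk_shift_le hs _ _ ht') hC)
    · exact hb.2 y
  · exact ((((integrable_gk (by positivity : 0 < 2 * s)).comp_sub_left x).const_mul _).const_mul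
      _).mul_const _
  · refine ae_of_all _ fun y t _ => ?_
    have h := hd (x + t • v - y)
    unfold HasLineDerivAt at h
    have h2 : HasDerivAt (fun τ : ℝ => k (x + τ • v - y)) (k' (x + t • v - y)) t := by
      have h3 : HasDerivAt (fun τ : ℝ => k (x + t • v - y + τ • v)) (k' (x + t • v - y)) (t - t) := by
        simpa using h
      have := h3.comp_sub_const t t
      refine this.congr_of_eventuallyEq (Eventually.of_forall fun τ => ?_)
      simp only [sub_smul]; congr 1; abel
    exact h2.mul_const _

/-- Differentiation of a convolution falls on the bounded function. -/
lemma cv_lineDeriv_fun {k b b' : Euc 2 → ℝ} {B B' : ℝ} {v : Euc 2}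
    (hk : Integrable k) (hb : BddMeas B b) (hb' : BddMeas B' b')
    (hd : ∀ z, HasLineDerivAt ℝ b (b' z) z v) (x : Euc 2) :
    HasLineDerivAt ℝ (cv k b) (cv k b' x) x v := by
  have key := hasDerivAt_integral_of_dominated_loc_of_deriv_le (μ := (volume : Measure (Euc 2)))
    (F := fun (t : ℝ) z => k z * b (x + t • v - z))
    (F' := fun t z => k z * b' (x + t • v - z)) (x₀ := (0 : ℝ)) (s := Metric.ball 0 1)
    (bound := fun z => |k z| * B')
    (Metric.ball_mem_nhds _ one_pos) ?_ ?_ ?_ ?_ ?_ ?_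
  · unfold HasLineDerivAt
    simp only [cv_eq]
    simpa using key.2
  · exact Eventually.of_forall fun t => (cv_integrable' hk hb _).aestronglyMeasurable
  · exact cv_integrable' hk hb _
  · exact (cv_integrable' hk hb' _).aestronglyMeasurable
  · refine ae_of_all _ fun z t _ => ?_
    rw [Real.norm_eq_abs, abs_mul]
    gcongr
    exact hb'.2 _
  · exact hk.abs.mul_const _
  · refine ae_of_all _ fun y t _ => ?_
    have h := hd (x + t • v - y)
    unfold HasLineDerivAt at h
    have h2 : HasDerivAt (fun τ : ℝ => b (x + τ • v - y)) (b' (x + t • v - y)) t := by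
      have h3 : HasDerivAt (fun τ : ℝ => b (x + t • v - y + τ • v)) (b' (x + t • v - y)) (t - t) := by
        simpa using h
      have := h3.comp_sub_const t t
      refine this.congr_of_eventuallyEq (Eventually.of_forall fun τ => ?_)
      simp only [sub_smul]; congr 1; abel
    exact h2.const_mul _

/-- Differentiation of a convolution with respect to a parameter of the kernel. -/
lemma cv_hasDerivAt_param {k k' : ℝ → Euc 2 → ℝ} {b : Euc 2 → ℝ} {B : ℝ} {D : ℝ → ℝ}
    (hk : ∀ s, 0 < s → GaussBdd (k s)) (hk' : ∀ s, 0 < s → Continuous (k' s))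
    (hD : ContinuousOn D (Set.Ioi 0)) (hkb : ∀ s, 0 < s → ∀ z, |k' s z| ≤ D s * gk (2 * s) z)
    (hd : ∀ s, 0 < s → ∀ z, HasDerivAt (fun s => k s z) (k' s z) s)
    (hb : BddMeas B b) (x : Euc 2) {s : ℝ} (hs : 0 < s) :
    HasDerivAt (fun s => cv (k s) b x) (cv (k' s) b x) s := by
  obtain ⟨C, hC⟩ := (isCompact_Icc (a := s / 2) (b := 2 * s)).exists_bound_of_continuousOn
    (hD.mono fun y hy => Set.mem_Ioi.2 ((half_pos hs).trans_le hy.1))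
  have hC0 : 0 ≤ C := (norm_nonneg _).trans (hC s ⟨by linarith, by linarith⟩)
  have hB := hb.nonneg
  have key := hasDerivAt_integral_of_dominated_loc_of_deriv_le (μ := (volume : Measure (Euc 2)))
    (F := fun (t : ℝ) y => k t (x - y) * b y)
    (F' := fun t y => k' t (x - y) * b y) (x₀ := s) (s := Set.Ioo (s / 2) (2 * s))
    (bound := fun y => C * ((4 * s) / s * gk (4 * s) (x - y)) * B)
    (Ioo_mem_nhds (by linarith) (by linarith)) ?_ ?_ ?_ ?_ ?_ ?_
  · exact key.2
  · filter_upwards [lt_mem_nhds hs] with t ht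
    exact (cv_integrable (hk t ht).integrable hb _).aestronglyMeasurable
  · exact cv_integrable (hk s hs).integrable hb _
  · have := (hk' s hs).measurable
    have := hb.1
    apply Measurable.aestronglyMeasurable
    fun_prop
  · refine ae_of_all _ fun y t ht => ?_
    have ht0 : 0 < t := (half_pos hs).trans ht.1
    rw [Real.norm_eq_abs, abs_mul]
    gcongr
    · exact mul_nonneg hC0 (mul_nonneg (by positivity) (gk_nonneg (by positivity) _))
    · refine (hkb t ht0 _).trans ?_
      have h1 := hC t ⟨ht.1.le, ht.2.le⟩
      rw [Real.norm_eq_abs] at h1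
      have h2 := gk_time_le (a := s) (b := 4 * s) (s := 2 * t) hs (by linarith [ht.1])
        (by linarith [ht.2]) (x - y)
      exact mul_le_mul ((le_abs_self _).trans h1) h2 (gk_nonneg (by positivity) _) hC0
    · exact hb.2 y
  · exact ((((integrable_gk (by positivity : 0 < 4 * s)).comp_sub_left x).const_mul _).const_mul
      _).mul_const _
  · refine ae_of_all _ fun y t ht => ?_
    exact (hd t ((half_pos hs).trans ht.1) _).mul_const _

lemma cv_continuousAt_param {k : ℝ → Euc 2 → ℝ} {b : Euc 2 → ℝ} {B : ℝ} {D : ℝ → ℝ}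
    (hk : ∀ s, 0 < s → Continuous (k s))
    (hD : ContinuousOn D (Set.Ioi 0)) (hkb : ∀ s, 0 < s → ∀ z, |k s z| ≤ D s * gk (2 * s) z)
    (hd : ∀ s, 0 < s → ∀ z, ContinuousAt (fun s => k s z) s)
    (hb : BddMeas B b) (x : Euc 2) {s : ℝ} (hs : 0 < s) :
    ContinuousAt (fun s => cv (k s) b x) s := by
  obtain ⟨C, hC⟩ := (isCompact_Icc (a := s / 2) (b := 2 * s)).exists_bound_of_continuousOn
    (hD.mono fun y hy => Set.mem_Ioi.2 ((half_pos hs).trans_le hy.1))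
  have hC0 : 0 ≤ C := (norm_nonneg _).trans (hC s ⟨by linarith, by linarith⟩)
  have hB := hb.nonneg
  refine continuousAt_of_dominated (bound := fun y => C * ((4 * s) / s * gk (4 * s) (x - y)) * B)
    ?_ ?_ ?_ ?_
  · filter_upwards [lt_mem_nhds hs] with t ht
    have := (hk t ht).measurable
    have := hb.1
    apply Measurable.aestronglyMeasurable
    fun_prop
  · filter_upwards [Ioo_mem_nhds (by linarith : s / 2 < s) (by linarith : s < 2 * s)] with t ht
    refine ae_of_all _ fun y => ?_
    have ht0 : 0 < t := (half_pos hs).trans ht.1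
    rw [Real.norm_eq_abs, abs_mul]
    gcongr
    · exact mul_nonneg hC0 (mul_nonneg (by positivity) (gk_nonneg (by positivity) _))
    · refine (hkb t ht0 _).trans ?_
      have h1 := hC t ⟨ht.1.le, ht.2.le⟩
      rw [Real.norm_eq_abs] at h1
      have h2 := gk_time_le (a := s) (b := 4 * s) (s := 2 * t) hs (by linarith [ht.1])
        (by linarith [ht.2]) (x - y)
      exact mul_le_mul ((le_abs_self _).trans h1) h2 (gk_nonneg (by positivity) _) hC0
    · exact hb.2 y
  · exact ((((integrable_gk (by positivity : 0 < 4 * s)).comp_sub_left x).const_mul _).const_mul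
      _).mul_const _
  · refine ae_of_all _ fun y => ?_
    exact (hd s hs _).mul continuousAt_const

lemma cv_assoc {k l b : Euc 2 → ℝ} {B : ℝ} (hk : GaussBdd k) (hl : GaussBdd l)
    (hb : BddMeas B b) (x : Euc 2) : cv k (cv l b) x = cv (cv k l) b x := by
  have h1 : ∀ w, cv k l (x - w) = ∫ y, k (x - y) * l (y - w) := fun w => by
    rw [cv, ← integral_sub_right_eq_self _ w]
    congr 1; ext y; congr 2; abel
  have hl' : Integrable (fun z => l (-z)) := hl.integrable.comp_neg
  have h_int : Integrable (Function.uncurry fun w y => k (x - y) * l (y - w) * b w)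
      ((volume : Measure (Euc 2)).prod volume) := by
    have := (hk.comp_sub x).convolution_integrand (ContinuousLinearMap.mul ℝ ℝ) hl'
    have h2 := this.mul_bdd (g := fun p : Euc 2 × Euc 2 => b p.1)
      (hb.1.comp measurable_fst).aestronglyMeasurable (ae_of_all _ fun p => hb.2 p.1)
    refine h2.congr (ae_of_all _ fun p => ?_)
    simp [Function.uncurry]
  calc cv k (cv l b) x = ∫ y, ∫ w, k (x - y) * l (y - w) * b w := by
        unfold cv; congr 1; ext y; rw [← integral_const_mul]; congr 1; ext w; ring
    _ = ∫ w, ∫ y, k (x - y) * l (y - w) * b w := (integral_integral_swap h_int).symm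
    _ = ∫ w, cv k l (x - w) * b w := by
        congr 1; ext w; rw [integral_mul_const, h1]

lemma cv_gk_gk {s r : ℝ} (hs : 0 < s) (hr : 0 < r) : cv (gk s) (gk r) = gk (s + r) := by
  ext x
  have hsr : 0 < s * r / (s + r) := by positivity
  have h : ∀ y, gk s (x - y) * gk r y =
      gk (s + r) x * gk (s * r / (s + r)) (y - (r / (s + r)) • x) := fun y => by
    unfold gk
    rw [mul_mul_mul_comm, mul_mul_mul_comm _ (Real.exp _), ← Real.exp_add, ← Real.exp_add]
    congr 1
    · field_simp
    · congr 1
      rw [@norm_sub_sq_real _ _ _ x y, @norm_sub_sq_real _ _ _ y, norm_smul, real_inner_smul_right,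
        real_inner_comm x y, mul_pow, Real.norm_eq_abs, sq_abs]
      field_simp
      ring
  unfold cv
  simp_rw [h]
  rw [integral_const_mul, integral_sub_right_eq_self (gk _), integral_gk hsr, mul_one]

section Semigroup
variable {b : Euc 2 → ℝ} {B s r : ℝ}

lemma norm_bv (i : Fin 2) : ‖bv i‖ ≤ 1 := by simp

lemma gkDD_comm (i j : Fin 2) (s : ℝ) : gkDD i j s = gkDD j i s := by
  ext z; unfold gkDD; simp only [eq_comm (a := i), mul_comm (z i)]

lemma bddMeas_cv_gk (hs : 0 < s) (hb : BddMeas B b) : BddMeas B (cv (gk s) b) := by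
  have h := cv_bddMeas hs (continuous_gk s)
    (fun z => (by rw [abs_of_nonneg (gk_nonneg hs z), one_mul] : |gk s z| ≤ 1 * gk s z)) hb
  rwa [one_mul] at h

lemma bddMeas_cv_gkD (hs : 0 < s) (i : Fin 2) (hb : BddMeas B b) :
    BddMeas (5 / √s * B) (cv (gkD i s) b) :=
  cv_bddMeas (by positivity) (continuous_gkD i s) (abs_gkD_le hs i) hb

lemma bddMeas_cv_gkDD (hs : 0 < s) (i j : Fin 2) (hb : BddMeas B b) :
    BddMeas (5 / s * B) (cv (gkDD i j s) b) :=
  cv_bddMeas (by positivity) (continuous_gkDD i j s) (abs_gkDD_le hs i j) hb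

lemma lineDeriv_cv_gk (hs : 0 < s) (i : Fin 2) (hb : BddMeas B b) (x : Euc 2) :
    HasLineDerivAt ℝ (cv (gk s) b) (cv (gkD i s) b x) x (bv i) :=
  cv_lineDeriv_kernel (norm_bv i) (gaussBdd_gk hs) (gaussBdd_gkD hs i)
    (hasLineDerivAt_gk s i) hb x

lemma lineDeriv_cv_gkD (hs : 0 < s) (i j : Fin 2) (hb : BddMeas B b) (x : Euc 2) :
    HasLineDerivAt ℝ (cv (gkD j s) b) (cv (gkDD i j s) b x) x (bv i) :=
  cv_lineDeriv_kernel (norm_bv i) (gaussBdd_gkD hs j) (gaussBdd_gkDD hs i j)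
    (hasLineDerivAt_gkD s i j) hb x

lemma hasLineDerivAt_unique {f : Euc 2 → ℝ} {a b : ℝ} {x v : Euc 2}
    (h1 : HasLineDerivAt ℝ f a x v) (h2 : HasLineDerivAt ℝ f b x v) : a = b :=
  HasDerivAt.unique h1 h2

lemma cv_gk_cv_gk (hs : 0 < s) (hr : 0 < r) (hb : BddMeas B b) :
    cv (gk s) (cv (gk r) b) = cv (gk (s + r)) b := by
  ext x; rw [cv_assoc (gaussBdd_gk hs) (gaussBdd_gk hr) hb, cv_gk_gk hs hr]

lemma cv_gk_cv_gkD (hs : 0 < s) (hr : 0 < r) (i : Fin 2) (hb : BddMeas B b) :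
    cv (gk s) (cv (gkD i r) b) = cv (gkD i (s + r)) b := by
  ext x
  have h1 := cv_lineDeriv_fun (gaussBdd_gk hs).integrable (bddMeas_cv_gk hr hb)
    (bddMeas_cv_gkD hr i hb) (lineDeriv_cv_gk hr i hb) x
  rw [cv_gk_cv_gk hs hr hb] at h1
  exact hasLineDerivAt_unique h1 (lineDeriv_cv_gk (by positivity) i hb x)

/-- Integration by parts against a derivative of a heat kernel. -/
lemma cv_gkDD_eq {b' : Euc 2 → ℝ} {B' : ℝ} (hs : 0 < s) (i j : Fin 2) (hb : BddMeas B b)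
    (hb' : BddMeas B' b') (hd : ∀ z, HasLineDerivAt ℝ b (b' z) z (bv i)) :
    cv (gkDD i j s) b = cv (gkD j s) b' := by
  ext x
  exact hasLineDerivAt_unique (lineDeriv_cv_gkD hs i j hb x)
    (cv_lineDeriv_fun (gaussBdd_gkD hs j).integrable hb hb' hd x)

lemma hasDerivAt_cv_gk (hs : 0 < s) (hb : BddMeas B b) (x : Euc 2) :
    HasDerivAt (fun s => cv (gk s) b x) (cv (gkL s) b x) s :=
  cv_hasDerivAt_param (D := fun s => 10 / s) (fun _ => gaussBdd_gk) (fun s _ => continuous_gkL s)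
    (continuousOn_const.div continuousOn_id fun _ h => (Set.mem_Ioi.1 h).ne')
    (fun _ => abs_gkL_le) (fun _ => hasDerivAt_gk) hb x hs

lemma hasDerivAt_cv_gkD (hs : 0 < s) (i : Fin 2) (hb : BddMeas B b) (x : Euc 2) :
    HasDerivAt (fun s => cv (gkD i s) b x) (cv (gkLD i s) b x) s :=
  cv_hasDerivAt_param (D := fun s => 26 * √s / s ^ 2) (fun _ h => gaussBdd_gkD h i)
    (fun s _ => continuous_gkLD i s)
    (by
      refine ContinuousOn.div (by fun_prop) (by fun_prop) fun s hs => ?_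
      have := (Set.mem_Ioi.1 hs).ne'
      positivity)
    (fun _ h => abs_gkLD_le h i) (fun _ h => hasDerivAt_gkD h i) hb x hs

lemma cv_gkL_cv_gkD (hs : 0 < s) (hr : 0 < r) (i : Fin 2) (hb : BddMeas B b) :
    cv (gkL s) (cv (gkD i r) b) = cv (gkLD i (s + r)) b := by
  ext x
  have h1 := hasDerivAt_cv_gk hs (bddMeas_cv_gkD hr i hb) x
  have h2 := (hasDerivAt_cv_gkD (by positivity : 0 < s + r) i hb x).comp_add_const s r
  refine h1.unique (h2.congr_of_eventuallyEq ?_)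
  filter_upwards [lt_mem_nhds hs] with t ht
  rw [cv_gk_cv_gkD ht hr i hb]

lemma continuousAt_cv_gkLD (hs : 0 < s) (i : Fin 2) (hb : BddMeas B b) (x : Euc 2) :
    ContinuousAt (fun s => cv (gkLD i s) b x) s :=
  cv_continuousAt_param (D := fun s => 26 * √s / s ^ 2) (fun s _ => continuous_gkLD i s)
    (by
      refine ContinuousOn.div (by fun_prop) (by fun_prop) fun s hs => ?_
      have := (Set.mem_Ioi.1 hs).ne'
      positivity)
    (fun _ h => abs_gkLD_le h i)
    (fun s hs z => by
      unfold gkLD gk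
      have : s ≠ 0 := hs.ne'
      have : 4 * π * s ≠ 0 := by positivity
      fun_prop (disch := first | assumption | positivity)) hb x hs

end Semigroup

/-- The mollified vorticity of a planar field. -/
def Wf (U : Fin 2 → Euc 2 → ℝ) (s : ℝ) (x : Euc 2) : ℝ :=
  cv (gkD 0 s) (U 1) x - cv (gkD 1 s) (U 0) x

/-- The derivative of the mollified vorticity in the mollification parameter. -/
def Wd (U : Fin 2 → Euc 2 → ℝ) (s : ℝ) (x : Euc 2) : ℝ :=
  cv (gkLD 0 s) (U 1) x - cv (gkLD 1 s) (U 0) x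

/-- Spatial derivatives of the mollified vorticity. -/
def Wx (i : Fin 2) (U : Fin 2 → Euc 2 → ℝ) (s : ℝ) (x : Euc 2) : ℝ :=
  cv (gkDD i 0 s) (U 1) x - cv (gkDD i 1 s) (U 0) x

/-- The mollified divergence of a planar field. -/
def Dv (U : Fin 2 → Euc 2 → ℝ) (s : ℝ) (x : Euc 2) : ℝ :=
  cv (gkD 0 s) (U 0) x + cv (gkD 1 s) (U 1) x

/-- The mollified curl of the divergence of `U ⊗ U`. -/
def Ff (U : Fin 2 → Euc 2 → ℝ) (s : ℝ) (x : Euc 2) : ℝ :=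
  ∑ k : Fin 2, (cv (gkDD k 0 s) (fun y => U k y * U 1 y) x
    - cv (gkDD k 1 s) (fun y => U k y * U 0 y) x)

/-- The mollification of a planar field. -/
def Ug (U : Fin 2 → Euc 2 → ℝ) (r : ℝ) (i : Fin 2) : Euc 2 → ℝ := cv (gk r) (U i)

/-- A bounded measurable planar field. -/
def SlB (M : ℝ) (U : Fin 2 → Euc 2 → ℝ) : Prop := ∀ i, BddMeas M (U i)

/-- A planar field with vanishing mollified divergence. -/
def SlDF (U : Fin 2 → Euc 2 → ℝ) : Prop := ∀ s, 0 < s → ∀ x, Dv U s x = 0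

lemma BddMeas.mul {B C : ℝ} {b c : Euc 2 → ℝ} (hb : BddMeas B b) (hc : BddMeas C c) :
    BddMeas (B * C) (fun y => b y * c y) :=
  ⟨hb.1.mul hc.1, fun y => by
    rw [abs_mul]; exact mul_le_mul (hb.2 y) (hc.2 y) (abs_nonneg _) hb.nonneg⟩

lemma BddMeas.add {B C : ℝ} {b c : Euc 2 → ℝ} (hb : BddMeas B b) (hc : BddMeas C c) :
    BddMeas (B + C) (fun y => b y + c y) :=
  ⟨hb.1.add hc.1, fun y => (abs_add_le _ _).trans (add_le_add (hb.2 y) (hc.2 y))⟩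

lemma BddMeas.sub {B C : ℝ} {b c : Euc 2 → ℝ} (hb : BddMeas B b) (hc : BddMeas C c) :
    BddMeas (B + C) (fun y => b y - c y) :=
  ⟨hb.1.sub hc.1, fun y => (abs_sub _ _).trans (add_le_add (hb.2 y) (hc.2 y))⟩

lemma BddMeas.const_mul {B : ℝ} {b : Euc 2 → ℝ} (c : ℝ) (hb : BddMeas B b) :
    BddMeas (|c| * B) (fun y => c * b y) :=
  ⟨hb.1.const_mul c, fun y => by rw [abs_mul]; gcongr; exact hb.2 y⟩

lemma cv_add {k b c : Euc 2 → ℝ} {B C : ℝ} (hk : Integrable k) (hb : BddMeas B b)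
    (hc : BddMeas C c) (x : Euc 2) : cv k (fun y => b y + c y) x = cv k b x + cv k c x := by
  unfold cv
  rw [← integral_add (cv_integrable hk hb x) (cv_integrable hk hc x)]
  simp only [mul_add]

lemma cv_sub {k b c : Euc 2 → ℝ} {B C : ℝ} (hk : Integrable k) (hb : BddMeas B b)
    (hc : BddMeas C c) (x : Euc 2) : cv k (fun y => b y - c y) x = cv k b x - cv k c x := by
  unfold cv
  rw [← integral_sub (cv_integrable hk hb x) (cv_integrable hk hc x)]
  simp only [mul_sub]

lemma cv_const_mul (k b : Euc 2 → ℝ) (c : ℝ) (x : Euc 2) :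
    cv k (fun y => c * b y) x = c * cv k b x := by
  unfold cv
  rw [← integral_const_mul]
  congr 1; ext y; ring

section Slice
variable {U : Fin 2 → Euc 2 → ℝ} {M s r A : ℝ}

lemma Wf_bddMeas (hU : SlB M U) (hs : 0 < s) : BddMeas (5 / √s * M + 5 / √s * M) (Wf U s) :=
  (bddMeas_cv_gkD hs 0 (hU 1)).sub (bddMeas_cv_gkD hs 1 (hU 0))

lemma abs_Ff_le (hU : SlB M U) (hs : 0 < s) (x : Euc 2) : |Ff U s x| ≤ 20 / s * M ^ 2 := by
  have h : ∀ k i j, |cv (gkDD k i s) (fun y => U k y * U j y) x| ≤ 5 / s * (M * M) :=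
    fun k i j => (bddMeas_cv_gkDD hs k i ((hU k).mul (hU j))).2 x
  unfold Ff
  rw [Fin.sum_univ_two]
  have h1 := abs_le.1 (h 0 0 1)
  have h2 := abs_le.1 (h 0 1 0)
  have h3 := abs_le.1 (h 1 0 1)
  have h4 := abs_le.1 (h 1 1 0)
  have e : 20 / s * M ^ 2 = 4 * (5 / s * (M * M)) := by ring
  rw [e, abs_le]
  constructor <;> linarith

lemma hasDerivAt_Wf (hU : SlB M U) (hs : 0 < s) (x : Euc 2) :
    HasDerivAt (fun s => Wf U s x) (Wd U s x) s :=
  (hasDerivAt_cv_gkD hs 0 (hU 1) x).sub (hasDerivAt_cv_gkD hs 1 (hU 0) x)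

lemma continuousAt_Wd (hU : SlB M U) (hs : 0 < s) (x : Euc 2) :
    ContinuousAt (fun s => Wd U s x) s :=
  (continuousAt_cv_gkLD hs 0 (hU 1) x).sub (continuousAt_cv_gkLD hs 1 (hU 0) x)

lemma lineDeriv_Wf (hU : SlB M U) (hs : 0 < s) (i : Fin 2) (x : Euc 2) :
    HasLineDerivAt ℝ (Wf U s) (Wx i U s x) x (bv i) :=
  HasDerivAt.sub (lineDeriv_cv_gkD hs i 0 (hU 1) x) (lineDeriv_cv_gkD hs i 1 (hU 0) x)

lemma Ug_slB (hU : SlB M U) (hr : 0 < r) : SlB M (Ug U r) := fun i => bddMeas_cv_gk hr (hU i)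

lemma cv_gk_Wf (hU : SlB M U) (hs : 0 < s) (hr : 0 < r) : cv (gk s) (Wf U r) = Wf U (s + r) := by
  ext x
  unfold Wf
  rw [cv_sub (gaussBdd_gk hs).integrable (bddMeas_cv_gkD hr 0 (hU 1))
    (bddMeas_cv_gkD hr 1 (hU 0)), cv_gk_cv_gkD hs hr 0 (hU 1), cv_gk_cv_gkD hs hr 1 (hU 0)]

lemma cv_gkL_Wf (hU : SlB M U) (hs : 0 < s) (hr : 0 < r) : cv (gkL s) (Wf U r) = Wd U (s + r) := by
  ext x
  unfold Wf Wd
  rw [cv_sub (gaussBdd_gkL hs).integrable (bddMeas_cv_gkD hr 0 (hU 1))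
    (bddMeas_cv_gkD hr 1 (hU 0)), cv_gkL_cv_gkD hs hr 0 (hU 1), cv_gkL_cv_gkD hs hr 1 (hU 0)]

lemma abs_Wx_le (hU : SlB M U) (hs : 0 < s) (i : Fin 2) (hA : ∀ x, |Wf U (s / 2) x| ≤ A)
    (x : Euc 2) : |Wx i U s x| ≤ 5 / √(s / 2) * A := by
  have h1 := lineDeriv_cv_gk (half_pos hs) i (Wf_bddMeas hU (half_pos hs)) x
  rw [cv_gk_Wf hU (half_pos hs) (half_pos hs), add_halves] at h1
  rw [← hasLineDerivAt_unique h1 (lineDeriv_Wf hU hs i x)]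
  exact (bddMeas_cv_gkD (half_pos hs) i ⟨(Wf_bddMeas hU (half_pos hs)).1, hA⟩).2 x

lemma Dx_eq_zero (hU : SlB M U) (hD : SlDF U) (hs : 0 < s) (i : Fin 2) (x : Euc 2) :
    cv (gkDD i 0 s) (U 0) x + cv (gkDD i 1 s) (U 1) x = 0 := by
  have h1 : HasLineDerivAt ℝ (Dv U s) _ x (bv i) :=
    HasDerivAt.add (lineDeriv_cv_gkD hs i 0 (hU 0) x) (lineDeriv_cv_gkD hs i 1 (hU 1) x)
  have h2 : Dv U s = fun _ => 0 := funext (hD s hs)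
  rw [h2] at h1
  exact HasDerivAt.unique h1 (hasDerivAt_const _ _)

lemma cv_gkL_eq {b : Euc 2 → ℝ} {B : ℝ} (hb : BddMeas B b) (hs : 0 < s) (x : Euc 2) :
    cv (gkL s) b x = cv (gkDD 0 0 s) b x + cv (gkDD 1 1 s) b x := by
  unfold cv
  rw [← integral_add (cv_integrable (gaussBdd_gkDD hs 0 0).integrable hb x)
    (cv_integrable (gaussBdd_gkDD hs 1 1).integrable hb x)]
  simp only [gkL_eq, add_mul]

lemma cv_gkL_zero (hU : SlB M U) (hD : SlDF U) (hs : 0 < s) (x : Euc 2) :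
    cv (gkL s) (U 0) x = -Wx 1 U s x := by
  have h := Dx_eq_zero hU hD hs 0 x
  rw [cv_gkL_eq (hU 0) hs, Wx, gkDD_comm 1 0]
  linarith

lemma cv_gkL_one (hU : SlB M U) (hD : SlDF U) (hs : 0 < s) (x : Euc 2) :
    cv (gkL s) (U 1) x = Wx 0 U s x := by
  have h := Dx_eq_zero hU hD hs 1 x
  rw [cv_gkL_eq (hU 1) hs, Wx, gkDD_comm 0 1]
  linarith

lemma hasDerivAt_Ug (hU : SlB M U) (hs : 0 < s) (i : Fin 2) (x : Euc 2) :
    HasDerivAt (fun r => Ug U r i x) (cv (gkL s) (U i) x) s :=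
  hasDerivAt_cv_gk hs (hU i) x

lemma abs_dUg_le (hU : SlB M U) (hD : SlDF U) (hs : 0 < s) (i : Fin 2)
    (hA : ∀ x, |Wf U (s / 2) x| ≤ A) (x : Euc 2) :
    |cv (gkL s) (U i) x| ≤ 5 / √(s / 2) * A := by
  fin_cases i
  · simp only [Fin.zero_eta, cv_gkL_zero hU hD hs, abs_neg]
    exact abs_Wx_le hU hs 1 hA x
  · simp only [Fin.mk_one, cv_gkL_one hU hD hs]
    exact abs_Wx_le hU hs 0 hA x

/-- The nonlinearity of a mollified divergence-free field in vorticity form. -/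
lemma Ff_Ug (hU : SlB M U) (hD : SlDF U) (hr : 0 < r) (hs : 0 < s) (x : Euc 2) :
    Ff (Ug U r) s x = ∑ k : Fin 2, cv (gkD k s) (fun y => Ug U r k y * Wf U r y) x := by
  have hV := Ug_slB hU hr
  set V := Ug U r with hVdef
  let G : Fin 2 → Fin 2 → Euc 2 → ℝ := fun j i => cv (gkD j r) (U i)
  have hG : ∀ j i, BddMeas (5 / √r * M) (G j i) := fun j i => bddMeas_cv_gkD hr j (hU i)
  have hd : ∀ j i z, HasLineDerivAt ℝ (V i) (G j i z) z (bv j) := fun j i z =>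
    lineDeriv_cv_gk hr j (hU i) z
  have hdiv : ∀ z, G 0 0 z + G 1 1 z = 0 := fun z => hD r hr z
  have hI : ∀ k j i, cv (gkDD k j s) (fun y => V k y * V i y) =
      cv (gkD k s) (fun y => G j k y * V i y + V k y * G j i y) := fun k j i =>
    gkDD_comm j k s ▸ cv_gkDD_eq hs j k ((hV k).mul (hV i)) (((hG j k).mul (hV i)).add ((hV k).mul (hG j i)))
      fun z => hasLineDerivAt_mul (hd j k z) (hd j i z)
  have hq : ∀ j k, cv (gkDD j k s) (fun y => V 0 y * V 0 y + V 1 y * V 1 y) =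
      cv (gkD k s) (fun y => (G j 0 y * V 0 y + V 0 y * G j 0 y) +
        (G j 1 y * V 1 y + V 1 y * G j 1 y)) := fun j k =>
    cv_gkDD_eq hs j k (((hV 0).mul (hV 0)).add ((hV 1).mul (hV 1)))
      ((((hG j 0).mul (hV 0)).add ((hV 0).mul (hG j 0))).add
        (((hG j 1).mul (hV 1)).add ((hV 1).mul (hG j 1))))
      fun z => HasDerivAt.add (hasLineDerivAt_mul (hd j 0 z) (hd j 0 z))
        (hasLineDerivAt_mul (hd j 1 z) (hd j 1 z))
  have hq2 : cv (gkDD 0 1 s) (fun y => V 0 y * V 0 y + V 1 y * V 1 y) x =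
      cv (gkDD 1 0 s) (fun y => V 0 y * V 0 y + V 1 y * V 1 y) x := by rw [gkDD_comm]
  rw [hq, hq] at hq2
  have hgi : ∀ k, Integrable (gkD k s) := fun k => (gaussBdd_gkD hs k).integrable
  have e0 : ∀ y, (G 0 0 y * V 1 y + V 0 y * G 0 1 y) - (G 1 0 y * V 0 y + V 0 y * G 1 0 y)
      = V 0 y * Wf U r y - (1 / 2) * ((G 1 0 y * V 0 y + V 0 y * G 1 0 y) +
        (G 1 1 y * V 1 y + V 1 y * G 1 1 y)) := fun y => by
    have : Wf U r y = G 0 1 y - G 1 0 y := rfl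
    rw [this, show G 0 0 y = -G 1 1 y by linarith [hdiv y]]; ring
  have e1 : ∀ y, (G 0 1 y * V 1 y + V 1 y * G 0 1 y) - (G 1 1 y * V 0 y + V 1 y * G 1 0 y)
      = V 1 y * Wf U r y + (1 / 2) * ((G 0 0 y * V 0 y + V 0 y * G 0 0 y) +
        (G 0 1 y * V 1 y + V 1 y * G 0 1 y)) := fun y => by
    have : Wf U r y = G 0 1 y - G 1 0 y := rfl
    rw [this, show G 1 1 y = -G 0 0 y by linarith [hdiv y]]; ring
  have hp : ∀ j k i, BddMeas _ (fun y => G j k y * V i y + V k y * G j i y) := fun j k i =>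
    ((hG j k).mul (hV i)).add ((hV k).mul (hG j i))
  have hw : ∀ k, BddMeas _ (fun y => V k y * Wf U r y) := fun k => (hV k).mul (Wf_bddMeas hU hr)
  have hqb : ∀ j, BddMeas _ (fun y => (G j 0 y * V 0 y + V 0 y * G j 0 y) +
        (G j 1 y * V 1 y + V 1 y * G j 1 y)) := fun j => (hp j 0 0).add (hp j 1 1)
  unfold Ff
  simp only [Fin.sum_univ_two]
  rw [hI 0 0 1, hI 0 1 0, hI 1 0 1, hI 1 1 0]
  rw [← cv_sub (hgi 0) (hp 0 0 1) (hp 1 0 0), ← cv_sub (hgi 1) (hp 0 1 1) (hp 1 1 0)]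
  simp only [e0, e1]
  rw [cv_sub (hgi 0) (hw 0) ((hqb 1).const_mul _), cv_add (hgi 1) (hw 1) ((hqb 0).const_mul _),
    cv_const_mul, cv_const_mul, hq2]
  ring

end Slice

/-- Comparison of increments from comparison of derivatives. -/
lemma abs_sub_le_of_abs_deriv_le {f f' g g' : ℝ → ℝ} {a b : ℝ} (hab : a ≤ b)
    (hf : ∀ s ∈ Set.Icc a b, HasDerivAt f (f' s) s) (hg : ∀ s ∈ Set.Icc a b, HasDerivAt g (g' s) s)
    (h : ∀ s ∈ Set.Icc a b, |f' s| ≤ g' s) : |f b - f a| ≤ g b - g a := by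
  have key : ∀ σ : ℝ, |σ| = 1 → σ * (f b - f a) ≤ g b - g a := fun σ hσ => by
    have hd : ∀ s ∈ Set.Icc a b, HasDerivAt (fun s => g s - σ * f s) (g' s - σ * f' s) s :=
      fun s hs => (hg s hs).sub ((hf s hs).const_mul σ)
    have hm : MonotoneOn (fun s => g s - σ * f s) (Set.Icc a b) := by
      refine monotoneOn_of_deriv_nonneg (convex_Icc a b)
        (fun s hs => (hd s hs).continuousAt.continuousWithinAt)
        (fun s hs => (hd s (interior_subset hs)).differentiableAt.differentiableWithinAt)
        fun s hs => ?_
      rw [(hd s (interior_subset hs)).deriv]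
      have h1 := h s (interior_subset hs)
      have h2 : σ * f' s ≤ |f' s| := (le_abs_self _).trans (by rw [abs_mul, hσ, one_mul])
      linarith
    have := hm (Set.left_mem_Icc.2 hab) (Set.right_mem_Icc.2 hab) hab
    simp only at this
    linarith
  rw [abs_le]
  have h1 := key 1 (by simp)
  have h2 := key (-1) (by simp)
  constructor <;> linarith

lemma cv_gk_scale (k : Euc 2 → ℝ) (x : Euc 2) {r : ℝ} (hr : 0 < r) :
    cv (gk r) k x = ∫ w, gk 1 w * k (x - √r • w) := by
  have h := Measure.integral_comp_smul (volume : Measure (Euc 2)) (fun z => gk r z * k (x - z)) (√r)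
  have e : ∀ w, gk r (√r • w) = r⁻¹ * gk 1 w := fun w => by
    unfold gk
    rw [norm_smul, mul_pow, Real.norm_eq_abs, sq_abs, Real.sq_sqrt hr.le,
      show -(r * ‖w‖ ^ 2) / (4 * r) = -‖w‖ ^ 2 / (4 * 1) by field_simp]
    field_simp
  simp only [e, finrank_euclideanSpace, Fintype.card_fin, Real.sq_sqrt hr.le, smul_eq_mul,
    mul_assoc, integral_const_mul, abs_inv, abs_of_pos hr] at h
  rw [cv_eq]
  exact (mul_left_cancel₀ (inv_ne_zero hr.ne') h).symm

lemma GaussBdd.bounded {k : Euc 2 → ℝ} (hk : GaussBdd k) : ∃ C, ∀ z, |k z| ≤ C := by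
  obtain ⟨_, C, s, hC, hs, h⟩ := hk
  refine ⟨C * (4 * π * s)⁻¹, fun z => (h z).trans ?_⟩
  unfold gk
  gcongr
  refine mul_le_of_le_one_right (by positivity) (Real.exp_le_one_iff.2 ?_)
  rw [neg_div]
  exact neg_nonpos.2 (by positivity)

lemma tendsto_cv_gk {k : Euc 2 → ℝ} (hk : GaussBdd k) (x : Euc 2) :
    Tendsto (fun r => cv (gk r) k x) (𝓝[>] 0) (𝓝 (k x)) := by
  obtain ⟨C, hC⟩ := hk.bounded
  have hc := hk.1
  have h : Tendsto (fun r : ℝ => ∫ w, gk 1 w * k (x - √r • w)) (𝓝[>] 0)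
      (𝓝 (∫ w, gk 1 w * k x)) := by
    refine tendsto_integral_filter_of_dominated_convergence (fun w => gk 1 w * C) ?_ ?_ ?_ ?_
    · have := continuous_gk 1
      exact Eventually.of_forall fun r => Continuous.aestronglyMeasurable (by fun_prop)
    · refine Eventually.of_forall fun r => ae_of_all _ fun w => ?_
      rw [Real.norm_eq_abs, abs_mul, abs_of_nonneg (gk_nonneg one_pos w)]
      exact mul_le_mul_of_nonneg_left (hC _) (gk_nonneg one_pos w)
    · exact (integrable_gk one_pos).mul_const C
    · refine ae_of_all _ fun w => ?_
      have h1 : Continuous fun r : ℝ => gk 1 w * k (x - √r • w) := by fun_prop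
      have := (h1.tendsto 0).mono_left (nhdsWithin_le_nhds (s := Set.Ioi 0))
      simpa using this
  rw [integral_mul_const, integral_gk one_pos, one_mul] at h
  refine h.congr' ?_
  filter_upwards [self_mem_nhdsWithin] with r hr
  exact (cv_gk_scale k x hr).symm

/-- Mollifications converge weakly. -/
lemma tendsto_cv_cv_gk {k b : Euc 2 → ℝ} {B : ℝ} (hk : GaussBdd k) (hb : BddMeas B b) :
    Tendsto (fun r => cv k (cv (gk r) b) 0) (𝓝[>] 0) (𝓝 (cv k b 0)) := by
  have hk' := hk
  obtain ⟨hc, C, s, hC, hs, h⟩ := hk'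
  have hB := hb.nonneg
  have key : Tendsto (fun r => cv (cv (gk r) k) b 0) (𝓝[>] 0) (𝓝 (cv k b 0)) := by
    refine tendsto_integral_filter_of_dominated_convergence
      (fun y => C * ((s + 1) / s * gk (s + 1) (0 - y)) * B) ?_ ?_ ?_ ?_
    · filter_upwards [self_mem_nhdsWithin] with r hr
      have h1 := cv_measurable (continuous_gk r) hc.measurable
      have h2 := hb.1
      exact Measurable.aestronglyMeasurable (by fun_prop)
    · filter_upwards [Ioo_mem_nhdsGT (one_pos : (0 : ℝ) < 1)] with r hr
      refine ae_of_all _ fun y => ?_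
      rw [Real.norm_eq_abs, abs_mul]
      have h1 : |cv (gk r) k (0 - y)| ≤ C * cv (gk r) (gk s) (0 - y) := by
        rw [← cv_const_mul]
        change ‖∫ w, gk r (0 - y - w) * k w‖ ≤ ∫ w, gk r (0 - y - w) * (C * gk s w)
        refine norm_integral_le_of_norm_le (cv_integrable (B := C * (4 * π * s)⁻¹)
          (integrable_gk hr.1) ⟨(continuous_gk s).measurable.const_mul C, fun z => ?_⟩ _)
          (ae_of_all _ fun z => ?_)
        · have h3 := gk_nonneg hs z
          rw [abs_mul, abs_of_nonneg hC, abs_of_nonneg h3]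
          unfold gk
          gcongr
          refine mul_le_of_le_one_right (by positivity) (Real.exp_le_one_iff.2 ?_)
          rw [neg_div]
          exact neg_nonpos.2 (by positivity)
        · rw [Real.norm_eq_abs, abs_mul, abs_of_nonneg (gk_nonneg hr.1 _)]
          exact mul_le_mul_of_nonneg_left (h z) (gk_nonneg hr.1 _)
      rw [cv_gk_gk hr.1 hs] at h1
      refine mul_le_mul (h1.trans (mul_le_mul_of_nonneg_left ?_ hC)) (hb.2 y) (abs_nonneg _)
        (mul_nonneg hC (mul_nonneg (by positivity) (gk_nonneg (by positivity) _)))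
      exact gk_time_le hs (by linarith [hr.1]) (by linarith [hr.2]) _
    · exact ((((integrable_gk (by positivity : 0 < s + 1)).comp_sub_left 0).const_mul _).const_mul
        _).mul_const _
    · exact ae_of_all _ fun y => (tendsto_cv_gk hk _).mul_const _
  refine key.congr' ?_
  filter_upwards [self_mem_nhdsWithin] with r hr
  rw [cv_assoc hk (gaussBdd_gk hr) hb]
  congr 1
  ext z
  rw [cv, cv_eq]
  congr 1; ext y; ring

lemma gaussBdd_of_hasCompactSupport {f : Euc 2 → ℝ} (hf : Continuous f)
    (hs : HasCompactSupport f) : GaussBdd f := by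
  have hg : Continuous fun z => f z * (gk 1 z)⁻¹ :=
    hf.mul ((continuous_gk 1).inv₀ fun z => by unfold gk; positivity)
  obtain ⟨C, hC⟩ := hg.bounded_above_of_compact_support hs.mul_right
  refine ⟨hf, C, 1, (norm_nonneg _).trans (hC 0), one_pos, fun z => ?_⟩
  have h1 := hC z
  have h2 : 0 < gk 1 z := by unfold gk; positivity
  rwa [Real.norm_eq_abs, abs_mul, abs_inv, abs_of_pos h2, ← div_eq_mul_inv, div_le_iff₀ h2] at h1

/-- A uniform rate of convergence of mollifications. -/
lemma ae_abs_sub_cv_gk_le {b : Euc 2 → ℝ} {B : ℝ} {ρ : ℝ → ℝ} (hb : BddMeas B b)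
    (hρ : Tendsto ρ (𝓝[>] 0) (𝓝 0))
    (h : ∀ r r', 0 < r' → r' ≤ r → r ≤ 1 → ∀ x, |cv (gk r) b x - cv (gk r') b x| ≤ ρ r) :
    ∀ᵐ y, ∀ r, 0 < r → r ≤ 1 → |cv (gk r) b y - b y| ≤ ρ r := by
  let R : ℕ → ℝ := fun n => 1 / ((n : ℝ) + 1)
  have hR0 : ∀ n, 0 < R n := fun n => by positivity
  have hR1 : ∀ n, R n ≤ 1 := fun n => by
    rw [div_le_one (by positivity)]; linarith [n.cast_nonneg (α := ℝ)]
  have hRm : ∀ n m, n ≤ m → R m ≤ R n := fun n m hnm => by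
    unfold R; gcongr
  have hRt : Tendsto R atTop (𝓝 0) := tendsto_one_div_add_atTop_nhds_zero_nat
  have hRt' : Tendsto R atTop (𝓝[>] 0) :=
    tendsto_nhdsWithin_iff.2 ⟨hRt, Eventually.of_forall hR0⟩
  have hc : ∀ y, ∃ l, Tendsto (fun n => cv (gk (R n)) b y) atTop (𝓝 l) := fun y => by
    refine cauchySeq_tendsto_of_complete
      (cauchySeq_of_le_tendsto_0' (fun n => ρ (R n)) (fun n m hnm => ?_) (hρ.comp hRt'))
    rw [Real.dist_eq]
    exact h _ _ (hR0 m) (hRm n m hnm) (hR1 n) y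
  choose l hl using hc
  have hlm : Measurable l := measurable_of_tendsto_metrizable
    (fun n => cv_measurable (continuous_gk (R n)) hb.1) (tendsto_pi_nhds.2 hl)
  have hlB : BddMeas B l := ⟨hlm, fun y => le_of_tendsto (hl y).abs
    (Eventually.of_forall fun n => (bddMeas_cv_gk (hR0 n) hb).2 y)⟩
  have h_int : ∀ {b : Euc 2 → ℝ}, BddMeas B b → LocallyIntegrable b := fun {b} hb =>
    (memLp_top_of_bound hb.1.aestronglyMeasurable B (ae_of_all _ hb.2)).locallyIntegrable le_top
  have hae : b =ᵐ[volume] l := by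
    refine ae_eq_of_integral_contDiff_smul_eq (h_int hb) (h_int hlB) fun g hg hgs => ?_
    have hgn : Continuous fun z => g (-z) := hg.continuous.comp continuous_neg
    have hG : GaussBdd (fun z => g (-z)) := gaussBdd_of_hasCompactSupport hgn
      (hgs.comp_homeomorph (Homeomorph.neg _))
    have e : ∀ b : Euc 2 → ℝ, cv (fun z => g (-z)) b 0 = ∫ y, g y • b y := fun b => by
      simp [cv]
    have h1 := (tendsto_cv_cv_gk hG hb).comp hRt'
    have h2 : Tendsto (fun n => cv (fun z => g (-z)) (cv (gk (R n)) b) 0) atTop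
        (𝓝 (cv (fun z => g (-z)) l 0)) := by
      refine tendsto_integral_of_dominated_convergence (fun y => |g (-(0 - y))| * B) ?_ ?_ ?_ ?_
      · exact fun n => (cv_integrable hG.integrable (bddMeas_cv_gk (hR0 n) hb) 0).1
      · exact (hG.comp_sub 0).abs.mul_const B
      · refine fun n => ae_of_all _ fun y => ?_
        rw [Real.norm_eq_abs, abs_mul]
        gcongr
        exact (bddMeas_cv_gk (hR0 n) hb).2 y
      · exact ae_of_all _ fun y => (hl y).const_mul _
    rw [← e, ← e]
    exact tendsto_nhds_unique h1 h2
  filter_upwards [hae] with y hy r hr hr1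
  rw [hy]
  refine le_of_tendsto ((tendsto_const_nhds.sub (hl y)).abs) ?_
  filter_upwards [hRt.eventually (Iio_mem_nhds hr)] with n hn
  exact h r _ (hR0 n) (le_of_lt hn) hr1 y

lemma abs_cv_sub_le {k b c : Euc 2 → ℝ} {B C' C s δ : ℝ} (hs : 0 < s) (hC : 0 ≤ C)
    (hk : Continuous k) (hkb : ∀ z, |k z| ≤ C * gk s z) (hb : BddMeas B b) (hc : BddMeas C' c)
    (h : ∀ᵐ y, |b y - c y| ≤ δ) (x : Euc 2) : |cv k b x - cv k c x| ≤ C * δ := by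
  rw [← cv_sub (GaussBdd.integrable ⟨hk, C, s, hC, hs, hkb⟩) hb hc]
  have h1 : ∀ᵐ y, ‖k (x - y) * (b y - c y)‖ ≤ C * δ * gk s (x - y) := by
    filter_upwards [h] with y hy
    rw [Real.norm_eq_abs, abs_mul]
    calc _ ≤ (C * gk s (x - y)) * δ :=
          mul_le_mul (hkb _) hy (abs_nonneg _) (mul_nonneg hC (gk_nonneg hs _))
      _ = _ := by ring
  have := norm_integral_le_of_norm_le (((integrable_gk hs).comp_sub_left x).const_mul (C * δ)) h1
  rwa [integral_const_mul, integral_sub_left_eq_self (gk s), integral_gk hs, mul_one] at this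

section Slice
variable {U V : Fin 2 → Euc 2 → ℝ} {M A : ℝ}

lemma abs_Ff_sub_le {s δ : ℝ} (hU : SlB M U) (hV : SlB M V) (hs : 0 < s)
    (h : ∀ᵐ y, ∀ i, |V i y - U i y| ≤ δ) (x : Euc 2) :
    |Ff V s x - Ff U s x| ≤ 40 / s * M * δ := by
  have hM : 0 ≤ M := (hU 0).nonneg
  have h1 : ∀ k i j, |cv (gkDD k i s) (fun y => V k y * V j y) x -
      cv (gkDD k i s) (fun y => U k y * U j y) x| ≤ 5 / s * (2 * M * δ) := fun k i j => by
    refine abs_cv_sub_le (by positivity) (by positivity) (continuous_gkDD k i s)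
      (abs_gkDD_le hs k i) ((hV k).mul (hV j)) ((hU k).mul (hU j)) ?_ x
    filter_upwards [h] with y hy
    rw [show V k y * V j y - U k y * U j y = (V k y - U k y) * V j y + U k y * (V j y - U j y) by
      ring]
    refine (abs_add_le _ _).trans ?_
    rw [abs_mul, abs_mul]
    have e1 : |V k y - U k y| * |V j y| ≤ δ * M :=
      mul_le_mul (hy k) ((hV j).2 y) (abs_nonneg _) ((abs_nonneg _).trans (hy k))
    have e2 : |U k y| * |V j y - U j y| ≤ M * δ :=
      mul_le_mul ((hU k).2 y) (hy j) (abs_nonneg _) hM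
    linarith
  unfold Ff
  rw [Fin.sum_univ_two, Fin.sum_univ_two]
  have h1' := abs_le.1 (h1 0 0 1)
  have h2' := abs_le.1 (h1 0 1 0)
  have h3' := abs_le.1 (h1 1 0 1)
  have h4' := abs_le.1 (h1 1 1 0)
  have e : 40 / s * M * δ = 4 * (5 / s * (2 * M * δ)) := by ring
  rw [e, abs_le]
  constructor <;> linarith

lemma rpow_half_bound {s : ℝ} (hs : 0 < s) :
    5 / √(s / 2) * (s / 2) ^ (-(1 / 4) : ℝ) ≤ 10 * s ^ (-(3 / 4) : ℝ) := by
  have h2 : 0 < s / 2 := half_pos hs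
  have e : 5 / √(s / 2) * (s / 2) ^ (-(1 / 4) : ℝ) = 5 * (s / 2) ^ (-(3 / 4) : ℝ) := by
    rw [Real.sqrt_eq_rpow, div_eq_mul_inv, ← Real.rpow_neg h2.le, mul_assoc, ← Real.rpow_add h2]
    norm_num
  rw [e, Real.div_rpow hs.le zero_le_two, Real.rpow_neg zero_le_two (3 / 4), div_inv_eq_mul]
  have h3 : (2 : ℝ) ^ (3 / 4 : ℝ) ≤ 2 := by
    calc (2 : ℝ) ^ (3 / 4 : ℝ) ≤ 2 ^ (1 : ℝ) :=
          Real.rpow_le_rpow_of_exponent_le (by norm_num) (by norm_num)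
      _ = 2 := Real.rpow_one _
  have h4 := Real.rpow_nonneg hs.le (-(3 / 4) : ℝ)
  nlinarith

lemma abs_Ug_sub_le (hU : SlB M U) (hD : SlDF U)
    (hW : ∀ s, 0 < s → s ≤ 1 → ∀ x, |Wf U s x| ≤ A * s ^ (-(1 / 4) : ℝ)) (i : Fin 2)
    {r r' : ℝ} (hr' : 0 < r') (hrr : r' ≤ r) (hr : r ≤ 1) (x : Euc 2) :
    |Ug U r i x - Ug U r' i x| ≤ 40 * A * r ^ (1 / 4 : ℝ) := by
  have hA : 0 ≤ A := by simpa using (abs_nonneg _).trans (hW 1 one_pos le_rfl 0)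
  have h := abs_sub_le_of_abs_deriv_le (f := fun r => Ug U r i x)
    (f' := fun s => cv (gkL s) (U i) x) (g := fun s => 40 * A * s ^ (1 / 4 : ℝ))
    (g' := fun s => 40 * A * ((1 / 4) * s ^ (1 / 4 - 1 : ℝ))) hrr
    (fun s hs => hasDerivAt_Ug hU (hr'.trans_le hs.1) i x)
    (fun s hs => (Real.hasDerivAt_rpow_const (Or.inl (hr'.trans_le hs.1).ne')).const_mul _)
    (fun s hs => by
      have hs0 : 0 < s := hr'.trans_le hs.1
      have h1 := abs_dUg_le hU hD hs0 i
        (hW (s / 2) (half_pos hs0) (by linarith [hs.2])) x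
      have h2 := mul_le_mul_of_nonneg_left (rpow_half_bound hs0) hA
      norm_num at h1 h2 ⊢
      linarith)
  have h2 : 0 ≤ 40 * A * r' ^ (1 / 4 : ℝ) := by positivity
  linarith

lemma ae_abs_Ug_sub_le (hU : SlB M U) (hD : SlDF U)
    (hW : ∀ s, 0 < s → s ≤ 1 → ∀ x, |Wf U s x| ≤ A * s ^ (-(1 / 4) : ℝ)) :
    ∀ᵐ y, ∀ i r, 0 < r → r ≤ 1 → |Ug U r i y - U i y| ≤ 40 * A * r ^ (1 / 4 : ℝ) := by
  rw [ae_all_iff]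
  intro i
  refine ae_abs_sub_cv_gk_le (hU i) ?_ fun r r' h1 h2 h3 x => abs_Ug_sub_le hU hD hW i h1 h2 h3 x
  have hc : ContinuousAt (fun r : ℝ => 40 * A * r ^ (1 / 4 : ℝ)) 0 :=
    (Real.continuousAt_rpow_const 0 (1 / 4) (Or.inr (by norm_num))).const_mul _
  have := hc.tendsto.mono_left (nhdsWithin_le_nhds (s := Set.Ioi 0))
  simpa [Real.zero_rpow] using this

lemma abs_Ff_Ug_sub_le (hU : SlB M U) (hD : SlDF U)
    (hW : ∀ s, 0 < s → s ≤ 1 → ∀ x, |Wf U s x| ≤ A * s ^ (-(1 / 4) : ℝ)) {r s : ℝ} (hs : 0 < s)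
    (hr : 0 < r) (hr1 : r ≤ 1) (x : Euc 2) :
    |Ff (Ug U r) s x - Ff U s x| ≤ 40 / s * M * (40 * A * r ^ (1 / 4 : ℝ)) := by
  refine abs_Ff_sub_le hU (Ug_slB hU hr) hs ?_ x
  filter_upwards [ae_abs_Ug_sub_le hU hD hW] with y hy i using hy i r hr hr1

/-- Improved bound of the nonlinearity when the mollified vorticity is not too singular. -/
lemma abs_Ff_le_rpow (hU : SlB M U) (hD : SlDF U)
    (hW : ∀ s, 0 < s → s ≤ 1 → ∀ x, |Wf U s x| ≤ A * s ^ (-(1 / 4) : ℝ)) {s : ℝ} (hs : 0 < s)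
    (hs1 : s ≤ 1) (x : Euc 2) : |Ff U s x| ≤ 1610 * M * A * s ^ (-(3 / 4) : ℝ) := by
  have hM : 0 ≤ M := (hU 0).nonneg
  have h1 := abs_Ff_Ug_sub_le hU hD hW hs hs hs1 x
  have h2 : ∀ k, |cv (gkD k s) (fun y => Ug U s k y * Wf U s y) x| ≤
      5 / √s * (M * (A * s ^ (-(1 / 4) : ℝ))) := fun k =>
    (bddMeas_cv_gkD hs k ((Ug_slB hU hs k).mul ⟨(Wf_bddMeas hU hs).1, hW s hs hs1⟩)).2 x
  have h3 := Ff_Ug hU hD hs hs x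
  rw [Fin.sum_univ_two] at h3
  have e1 : 5 / √s * (M * (A * s ^ (-(1 / 4) : ℝ))) = 5 * M * A * s ^ (-(3 / 4) : ℝ) := by
    rw [Real.sqrt_eq_rpow, div_eq_mul_inv, ← Real.rpow_neg hs.le,
      show (-(3 / 4) : ℝ) = -(1 / 2) + -(1 / 4) by norm_num, Real.rpow_add hs]
    ring
  have e2 : 40 / s * M * (40 * A * s ^ (1 / 4 : ℝ)) = 1600 * M * A * s ^ (-(3 / 4) : ℝ) := by
    rw [show (-(3 / 4) : ℝ) = -1 + 1 / 4 by norm_num, Real.rpow_add hs, Real.rpow_neg_one]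
    ring
  rw [e1] at h2
  rw [e2] at h1
  have h20 := abs_le.1 (h2 0)
  have h21 := abs_le.1 (h2 1)
  have h1' := abs_le.1 h1
  rw [abs_le]
  constructor <;> linarith

lemma integral_gkL {s : ℝ} (hs : 0 < s) (x : Euc 2) : cv (gkL s) (fun _ => 1) x = 0 := by
  have h1 := hasDerivAt_cv_gk hs (b := fun _ => (1 : ℝ)) (B := 1)
    ⟨measurable_const, fun _ => by simp⟩ x
  refine h1.unique ((hasDerivAt_const s (1 : ℝ)).congr_of_eventuallyEq ?_)
  filter_upwards [lt_mem_nhds hs] with t ht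
  simp [cv_eq, integral_gk ht]

lemma cv_gk_one {s : ℝ} (hs : 0 < s) (x : Euc 2) : cv (gk s) (fun _ => 1) x = 1 := by
  simp [cv_eq, integral_gk hs]

lemma Dv_Ug (hU : SlB M U) (hD : SlDF U) {r s : ℝ} (hr : 0 < r) (hs : 0 < s) (x : Euc 2) :
    Dv (Ug U r) s x = 0 := by
  have h : ∀ i j, cv (gkD i s) (cv (gk r) (U j)) = cv (gkD i (s + r)) (U j) := fun i j => by
    ext x
    have h1 := lineDeriv_cv_gk hs i (bddMeas_cv_gk hr (hU j)) x
    rw [cv_gk_cv_gk hs hr (hU j)] at h1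
    exact hasLineDerivAt_unique h1 (lineDeriv_cv_gk (by positivity) i (hU j) x)
  have := hD (s + r) (by positivity) x
  unfold Dv Ug at *
  rwa [h, h]

/-- The pointwise inequality behind the barrier argument. -/
lemma barrier_kernel_le (hV : SlB M U) {s l : ℝ} (hs : 0 < s) (hl : 0 < l) (z y : Euc 2) :
    (1 + l) * (gkD 0 s z * U 0 y + gkD 1 s z * U 1 y) ≤
      l * gkL s z + (l / s + (1 + l) ^ 2 * M ^ 2 / l) * gk s z := by
  have hM : 0 ≤ M := (hV 0).nonneg
  have hg := gk_nonneg hs z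
  have h : ∀ i, -(z i / (2 * s)) * U i y ≤ ‖z‖ / (2 * s) * M := fun i => by
    refine (le_abs_self _).trans ?_
    rw [abs_mul, abs_neg, abs_div, abs_of_pos (by positivity : 0 < 2 * s)]
    have := sq_coord_le z i
    have := (hV i).2 y
    gcongr
  have h1 : (1 + l) * (‖z‖ / s * M) ≤
      l * (‖z‖ ^ 2 / (4 * s ^ 2) - 1 / s) + (l / s + (1 + l) ^ 2 * M ^ 2 / l) := by
    have h2 : 0 ≤ (l * ‖z‖ / (2 * s) - (1 + l) * M) ^ 2 / l := by positivity
    have e : l * (‖z‖ ^ 2 / (4 * s ^ 2) - 1 / s) + (l / s + (1 + l) ^ 2 * M ^ 2 / l) -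
      (1 + l) * (‖z‖ / s * M) = (l * ‖z‖ / (2 * s) - (1 + l) * M) ^ 2 / l := by
      field_simp; ring
    linarith
  have h3 : (1 + l) * (-(z 0 / (2 * s)) * U 0 y + -(z 1 / (2 * s)) * U 1 y) ≤
      (1 + l) * (‖z‖ / s * M) := by
    have e : ‖z‖ / s * M = ‖z‖ / (2 * s) * M + ‖z‖ / (2 * s) * M := by field_simp; ring
    rw [e]
    have := h 0
    have := h 1
    gcongr
  have h4 := mul_le_mul_of_nonneg_right (h3.trans h1) hg
  unfold gkD gkL
  linarith

/-- The barrier inequality on a time slice. -/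
lemma barrier_slice (hU : SlB M U) (hD : SlDF U) {C A σ s l : ℝ}
    (hW : ∀ s, 0 < s → s ≤ 1 → ∀ x, |Wf U s x| ≤ C * s ^ (-(1 / 4) : ℝ))
    (hA : ∀ s, 0 < s → ∀ x, σ * Wf U s x ≤ A) (hs : 0 < s) (hl : 0 < l) (x : Euc 2) :
    (1 + l) * (-(σ * Ff U s x)) ≤ -(l * (σ * Wd U s x)) +
      (l / s + (1 + l) ^ 2 * M ^ 2 / l) * (A - σ * Wf U s x) := by
  set K := l / s + (1 + l) ^ 2 * M ^ 2 / l with hK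
  have key : ∀ r, 0 < r → (1 + l) * (-(σ * Ff (Ug U r) s x)) ≤ -(l * (σ * Wd U (s + r) x)) +
      K * (A - σ * Wf U (s + r) x) := fun r hr => by
    have hV := Ug_slB hU hr
    set V := Ug U r with hVd
    have hWm := Wf_bddMeas hU hr
    have hone : BddMeas |A| (fun _ => A) := ⟨measurable_const, fun _ => le_rfl⟩
    have hg := hone.sub (hWm.const_mul σ)
    have hgi : ∀ k, Integrable (gkD k s) := fun k => (gaussBdd_gkD hs k).integrable
    have hgL := (gaussBdd_gkL hs).integrable
    have hgk := (gaussBdd_gk hs).integrable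
    have hconst : ∀ k : Euc 2 → ℝ, cv k (fun _ => A) x = A * cv k (fun _ => 1) x := fun k => by
      rw [← cv_const_mul]; simp
    have h1 : ∀ k, cv (gkD k s) (fun y => V k y * (A - σ * Wf U r y)) x =
        A * cv (gkD k s) (V k) x - σ * cv (gkD k s) (fun y => V k y * Wf U r y) x := fun k => by
      rw [← cv_const_mul, ← cv_const_mul,
        ← cv_sub (hgi k) ((hV k).const_mul A) (((hV k).mul hWm).const_mul σ)]
      congr 1; ext y; ring
    have h2 : cv (gkL s) (fun y => A - σ * Wf U r y) x = -(σ * Wd U (s + r) x) := by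
      rw [cv_sub hgL hone (hWm.const_mul σ), cv_const_mul, cv_gkL_Wf hU hs hr, hconst,
        integral_gkL hs]
      ring
    have h3 : cv (gk s) (fun y => A - σ * Wf U r y) x = A - σ * Wf U (s + r) x := by
      rw [cv_sub hgk hone (hWm.const_mul σ), cv_const_mul, cv_gk_Wf hU hs hr, hconst,
        cv_gk_one hs]
      ring
    have h4 : Dv V s x = 0 := Dv_Ug hU hD hr hs x
    have h5 : -(σ * Ff V s x) = cv (gkD 0 s) (fun y => V 0 y * (A - σ * Wf U r y)) x +
        cv (gkD 1 s) (fun y => V 1 y * (A - σ * Wf U r y)) x := by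
      rw [h1, h1, Ff_Ug hU hD hr hs, Fin.sum_univ_two]
      unfold Dv at h4
      linear_combination (-A) * h4
    rw [h5]
    have e : -(l * (σ * Wd U (s + r) x)) + K * (A - σ * Wf U (s + r) x) =
        l * cv (gkL s) (fun y => A - σ * Wf U r y) x +
          K * cv (gk s) (fun y => A - σ * Wf U r y) x := by rw [h2, h3]; ring
    rw [e]
    unfold cv
    have i0 := cv_integrable (hgi 0) ((hV 0).mul hg) x
    have i1 := cv_integrable (hgi 1) ((hV 1).mul hg) x
    have iL := cv_integrable hgL hg x
    have ik := cv_integrable hgk hg x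
    rw [← integral_add i0 i1, ← integral_const_mul, ← integral_const_mul, ← integral_const_mul,
      ← integral_add (iL.const_mul _) (ik.const_mul _)]
    refine integral_mono ((i0.add i1).const_mul _) ((iL.const_mul _).add (ik.const_mul _))
      fun y => ?_
    have h6 := mul_le_mul_of_nonneg_right (barrier_kernel_le hV hs hl (x - y) y)
      (sub_nonneg.2 (hA r hr y))
    simp only
    linarith
  have hsr : Tendsto (fun r : ℝ => s + r) (𝓝[>] 0) (𝓝 s) := by
    have : Continuous fun r : ℝ => s + r := by fun_prop
    simpa using (this.tendsto 0).mono_left (nhdsWithin_le_nhds (s := Set.Ioi 0))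
  have t1 : Tendsto (fun r => Wd U (s + r) x) (𝓝[>] 0) (𝓝 (Wd U s x)) :=
    (continuousAt_Wd hU hs x).tendsto.comp hsr
  have t2 : Tendsto (fun r => Wf U (s + r) x) (𝓝[>] 0) (𝓝 (Wf U s x)) :=
    (hasDerivAt_Wf hU hs x).continuousAt.tendsto.comp hsr
  have t3 : Tendsto (fun r => Ff (Ug U r) s x) (𝓝[>] 0) (𝓝 (Ff U s x)) := by
    rw [tendsto_iff_dist_tendsto_zero]
    have hc : ContinuousAt (fun r : ℝ => 40 / s * M * (40 * C * r ^ (1 / 4 : ℝ))) 0 :=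
      ((Real.continuousAt_rpow_const 0 (1 / 4) (Or.inr (by norm_num))).const_mul _).const_mul _
    have hc' := hc.tendsto.mono_left (nhdsWithin_le_nhds (s := Set.Ioi 0))
    rw [Real.zero_rpow (by norm_num), mul_zero, mul_zero] at hc'
    refine squeeze_zero' (Eventually.of_forall fun _ => dist_nonneg) ?_ hc'
    filter_upwards [Ioc_mem_nhdsGT (one_pos : (0 : ℝ) < 1)] with r hr
    exact abs_Ff_Ug_sub_le hU hD hW hs hr.1 hr.2 x
  refine le_of_tendsto_of_tendsto ((t3.const_mul σ).neg.const_mul (1 + l))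
    (((t1.const_mul σ).const_mul l).neg.add (((t2.const_mul σ).const_sub A).const_mul K)) ?_
  filter_upwards [self_mem_nhdsWithin] with r hr using key r hr

lemma eq_of_hasLineDerivAt_zero {f : Euc 2 → ℝ}
    (h : ∀ i x, HasLineDerivAt ℝ f 0 x (bv i)) (x : Euc 2) : f x = f 0 := by
  have h1 : ∀ i x (t : ℝ), f (x + t • bv i) = f x := fun i x t => by
    have hd : ∀ t, HasDerivAt (fun t : ℝ => f (x + t • bv i)) 0 t := fun t => by
      have h2 : HasDerivAt (fun τ : ℝ => f (x + t • bv i + τ • bv i)) 0 (t - t) := by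
        rw [sub_self]; exact h i (x + t • bv i)
      refine (h2.comp_sub_const t t).congr_of_eventuallyEq (Eventually.of_forall fun τ => ?_)
      simp only [sub_smul]; congr 1; abel
    have := is_const_of_deriv_eq_zero (fun t => (hd t).differentiableAt) (fun t => (hd t).deriv) t 0
    simpa using this
  have e : x = 0 + x 0 • bv 0 + x 1 • bv 1 := by
    ext i; fin_cases i <;> simp
  rw [e, h1, h1]

/-- Bounded divergence-free irrotational planar fields are constant. -/
lemma ae_eq_const_of_Wf_eq_zero (hU : SlB M U) (hD : SlDF U)
    (hW : ∀ s, 0 < s → ∀ x, Wf U s x = 0) : ∀ᵐ y, ∀ i, U i y = Ug U 1 i 0 := by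
  have hr : ∀ i x r, 0 < r → r ≤ 1 → Ug U r i x = Ug U 1 i x := fun i x r hr hr1 => by
    have := abs_Ug_sub_le (A := 0) hU hD (fun s hs _ x => by simp [hW s hs x]) i hr hr1 le_rfl x
    have h2 : |Ug U 1 i x - Ug U r i x| ≤ 0 := by simpa using this
    linarith [abs_nonpos_iff.1 h2]
  have hr' : ∀ i r, 1 ≤ r → Ug U r i = Ug U 1 i := fun i r hr1 => by
    ext x
    have h := abs_sub_le_of_abs_deriv_le (f := fun r => Ug U r i x)
      (f' := fun s => cv (gkL s) (U i) x) (g := fun s => 0) (g' := fun s => 0) hr1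
      (fun s hs => hasDerivAt_Ug hU (one_pos.trans_le hs.1) i x)
      (fun s _ => hasDerivAt_const _ _)
      (fun s hs => by
        have hs0 : 0 < s := one_pos.trans_le hs.1
        simpa using abs_dUg_le hU hD hs0 i (A := 0)
          (fun x => by rw [hW _ (half_pos hs0)]; simp) x)
    rw [sub_zero] at h
    linarith [abs_nonpos_iff.1 h]
  have hx : ∀ i x, Ug U 1 i x = Ug U 1 i 0 := fun i x => by
    refine eq_of_hasLineDerivAt_zero (fun j x => ?_) x
    have h1 := lineDeriv_cv_gk one_pos j (hU i) x
    have h2 : ∀ r, 1 ≤ r → |cv (gkD j 1) (U i) x| ≤ 5 / √r * M := fun r hr1 => by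
      have hr0 : 0 < r := one_pos.trans_le hr1
      have h3 : HasLineDerivAt ℝ (Ug U r i) _ x (bv j) := lineDeriv_cv_gk hr0 j (hU i) x
      rw [hr' i r hr1] at h3
      rw [hasLineDerivAt_unique h1 h3]
      exact (bddMeas_cv_gkD hr0 j (hU i)).2 x
    have h4 : Tendsto (fun r : ℝ => 5 / √r * M) atTop (𝓝 (0 * M)) :=
      (tendsto_const_nhds.div_atTop Real.tendsto_sqrt_atTop).mul_const M
    have h5 : |cv (gkD j 1) (U i) x| ≤ 0 * M :=
      ge_of_tendsto h4 ((eventually_ge_atTop 1).mono h2)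
    rw [zero_mul] at h5
    rw [abs_nonpos_iff.1 h5] at h1
    exact h1
  filter_upwards [ae_abs_Ug_sub_le (A := 0) hU hD fun s hs _ x => by simp [hW s hs x]] with y hy i
  have h1 : |Ug U 1 i y - U i y| ≤ 0 := by simpa using hy i 1 one_pos le_rfl
  rw [← hx i y]
  linarith [abs_nonpos_iff.1 h1]

end Slice

/-- Smooth test functions on the negative half line. -/
def Tst (χ : ℝ → ℝ) : Prop :=
  ContDiff ℝ (⊤ : ℕ∞) χ ∧ HasCompactSupport χ ∧ tsupport χ ⊆ Set.Iio 0

lemma Tst.neg_of_ne {χ : ℝ → ℝ} (h : Tst χ) {t : ℝ} (ht : χ t ≠ 0) : t < 0 :=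
  h.2.2 (subset_tsupport _ ht)

lemma Tst.integrable {χ : ℝ → ℝ} (h : Tst χ) : Integrable χ :=
  h.1.continuous.integrable_of_hasCompactSupport h.2.1

lemma Tst.translate {χ : ℝ → ℝ} (h : Tst χ) {a : ℝ} (ha : 0 ≤ a) : Tst (fun t => χ (t + a)) := by
  refine ⟨h.1.comp (contDiff_id.add contDiff_const),
    h.2.1.comp_homeomorph (Homeomorph.addRight a), ?_⟩
  have h1 : tsupport (fun t => χ (t + a)) ⊆ (Homeomorph.addRight a) ⁻¹' tsupport χ := by
    exact tsupport_comp_subset_preimage χ (Homeomorph.addRight a).continuous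
  intro t ht
  have := h.2.2 (h1 ht)
  simp only [Homeomorph.coe_addRight, Set.mem_Iio] at this ⊢
  linarith

/-- An average bound tested against all nonnegative test functions holds almost everywhere. -/
lemma ae_le_of_test {b : ℝ → ℝ} {B C : ℝ} (hb : Measurable b) (hB : ∀ t, |b t| ≤ B)
    (h : ∀ χ, Tst χ → (∀ t, 0 ≤ χ t) → ∫ t, χ t * b t ≤ C * ∫ t, χ t) :
    ∀ᵐ t, t < 0 → b t ≤ C := by
  let φ : ℕ → ContDiffBump (0 : ℝ) := fun n =>
    ⟨1 / ((n : ℝ) + 1), 2 * (1 / ((n : ℝ) + 1)), by positivity, by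
      have : 0 < 1 / ((n : ℝ) + 1) := by positivity
      linarith⟩
  have hR : Tendsto (fun n => (φ n).rOut) atTop (𝓝 0) := by
    have := (tendsto_one_div_add_atTop_nhds_zero_nat (𝕜 := ℝ)).const_mul 2
    simpa [φ] using this
  have hloc : LocallyIntegrable b :=
    (memLp_top_of_bound hb.aestronglyMeasurable B (ae_of_all _ hB)).locallyIntegrable le_top
  filter_upwards [ContDiffBump.ae_convolution_tendsto_right_of_locallyIntegrable (K := 2) hR
    (Eventually.of_forall fun n => le_rfl) hloc] with t ht ht0
  refine le_of_tendsto ht ?_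
  filter_upwards [hR.eventually (Iio_mem_nhds (by linarith : 0 < -t))] with n hn
  rw [convolution_eq_swap]
  have hsup : tsupport (fun τ => (φ n).normed volume (t - τ)) ⊆
      (Homeomorph.subLeft t) ⁻¹' tsupport ((φ n).normed volume) := by
    exact tsupport_comp_subset_preimage ((φ n).normed volume) (Homeomorph.subLeft t).continuous
  have hT : Tst (fun τ => (φ n).normed volume (t - τ)) := by
    refine ⟨(φ n).contDiff_normed.comp (contDiff_const.sub contDiff_id),
      (φ n).hasCompactSupport_normed.comp_homeomorph (Homeomorph.subLeft t), fun τ hτ => ?_⟩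
    have h1 := hsup hτ
    rw [ContDiffBump.tsupport_normed_eq] at h1
    simp only [Set.mem_preimage, Metric.mem_closedBall, dist_zero_right, Real.norm_eq_abs,
      Homeomorph.coe_subLeft] at h1
    have := (abs_le.1 h1).1
    have : (φ n).rOut < -t := hn
    simp only [Set.mem_Iio]
    linarith
  have := h _ hT fun τ => (φ n).nonneg_normed _
  rw [integral_sub_left_eq_self (fun τ => (φ n).normed volume τ), (φ n).integral_normed,
    mul_one] at this
  simpa using this

lemma continuous_cv {k b : Euc 2 → ℝ} {B : ℝ} (hk : GaussBdd k) (hb : BddMeas B b) :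
    Continuous (cv k b) := by
  rw [continuous_iff_continuousAt]
  intro x
  obtain ⟨hc, C, s, hC, hs, hkb⟩ := hk
  refine continuousAt_of_dominated
    (bound := fun y => C * (2 * Real.exp (1 / (4 * s)) * gk (2 * s) (x - y)) * B) ?_ ?_ ?_ ?_
  · exact Eventually.of_forall fun z =>
      (cv_integrable (GaussBdd.integrable ⟨hc, C, s, hC, hs, hkb⟩) hb z).1
  · filter_upwards [Metric.closedBall_mem_nhds x one_pos] with z hz
    refine ae_of_all _ fun y => ?_
    rw [Real.norm_eq_abs, abs_mul]
    refine mul_le_mul ?_ (hb.2 y) (abs_nonneg _)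
      (mul_nonneg hC (mul_nonneg (by positivity) (gk_nonneg (by positivity) _)))
    rw [show z - y = (x - y) + (z - x) by abel]
    exact (hkb _).trans (mul_le_mul_of_nonneg_left
      (gk_shift_le hs _ _ (by simpa [dist_eq_norm] using hz)) hC)
  · exact ((((integrable_gk (by positivity : 0 < 2 * s)).comp_sub_left x).const_mul _).const_mul
      _).mul_const _
  · exact ae_of_all _ fun y => by fun_prop

lemma measurable_cv_time {k : Euc 2 → ℝ} {b : ℝ → Euc 2 → ℝ} (hk : Continuous k)
    (hb : Measurable fun p : Euc 2 × ℝ => b p.2 p.1) (x : Euc 2) :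
    Measurable fun t => cv k (b t) x := by
  have : StronglyMeasurable (Function.uncurry fun (y : Euc 2) (t : ℝ) => k (x - y) * b t y) := by
    apply Measurable.stronglyMeasurable
    have hk' := hk.measurable
    exact (hk'.comp (measurable_const.sub measurable_fst)).mul hb
  exact this.integral_prod_left.measurable

/-- An almost everywhere bound at each point of a separately continuous family. -/
lemma ae_forall_le {g : ℝ → ℝ → Euc 2 → ℝ} {h : ℝ → ℝ}
    (hs : ∀ t s x, 0 < s → ContinuousAt (fun s => g t s x) s)
    (hx : ∀ t s, 0 < s → Continuous (g t s))
    (hh : ContinuousOn h (Set.Ioi 0))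
    (H : ∀ s x, 0 < s → ∀ᵐ t, g t s x ≤ h s) : ∀ᵐ t, ∀ s x, 0 < s → g t s x ≤ h s := by
  obtain ⟨D, hDc, hDd⟩ := TopologicalSpace.exists_countable_dense (Euc 2)
  have h1 : ∀ᵐ t, ∀ q : ℚ, ∀ x ∈ D, 0 < (q : ℝ) → g t q x ≤ h q := by
    rw [ae_all_iff]; intro q
    rw [ae_ball_iff hDc]; intro x _
    rcases lt_or_ge 0 (q : ℝ) with hq | hq
    · filter_upwards [H q x hq] with t ht _ using ht
    · exact ae_of_all _ fun t hq' => absurd hq' (not_lt.2 hq)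
  filter_upwards [h1] with t ht s x hs0
  have h2 : ∀ q : ℚ, 0 < (q : ℝ) → ∀ x, g t q x ≤ h q := fun q hq x => by
    by_contra! hlt
    obtain ⟨y, hyo, hyD⟩ := hDd.inter_open_nonempty _
      (isOpen_lt continuous_const (hx t q hq) : IsOpen {y | h q < g t q y}) ⟨x, hlt⟩
    exact absurd (ht q y hyD hq) (not_le.2 hyo)
  by_contra! hlt
  have h3 : ∀ᶠ s' in 𝓝 s, h s' < g t s' x :=
    (hh.continuousAt (Ioi_mem_nhds hs0)).eventually_lt (hs t s x hs0) hlt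
  obtain ⟨u, hu, huo, hus⟩ := eventually_nhds_iff.1 (h3.and (lt_mem_nhds hs0))
  obtain ⟨_, hqu, q, rfl⟩ := Rat.denseRange_cast (𝕜 := ℝ) |>.inter_open_nonempty u huo ⟨s, hus⟩
  exact absurd (h2 q (hu _ hqu).2 x) (not_le.2 (hu _ hqu).1)

/-- Differentiation of a moving time average. -/
lemma hasDerivAt_moving_average {χ : ℝ → ℝ} {τ τ' : ℝ → ℝ} {w wd : ℝ → ℝ → ℝ} {B₁ B₂ : ℝ → ℝ}
    (hχ : Tst χ) (hτ : ∀ s, 0 < s → HasDerivAt τ (τ' s) s) (hτ' : ContinuousOn τ' (Set.Ioi 0))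
    (hw : ∀ t s, 0 < s → HasDerivAt (w t) (wd t s) s)
    (hwm : ∀ s, Measurable fun t => w t s) (hwdm : ∀ s, Measurable fun t => wd t s)
    (hB₁ : ContinuousOn B₁ (Set.Ioi 0)) (hB₂ : ContinuousOn B₂ (Set.Ioi 0))
    (h₁ : ∀ t s, 0 < s → |w t s| ≤ B₁ s) (h₂ : ∀ t s, 0 < s → |wd t s| ≤ B₂ s)
    {s : ℝ} (hs : 0 < s) :
    HasDerivAt (fun s => ∫ t, χ (t + τ s) * w t s)
      (∫ t, (deriv χ (t + τ s) * τ' s * w t s + χ (t + τ s) * wd t s)) s := by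
  have hχ1 : ContDiff ℝ 1 χ := hχ.1.of_le (by exact_mod_cast le_top)
  have hcd : Continuous (deriv χ) := hχ1.continuous_deriv le_rfl
  obtain ⟨C₀, hC₀⟩ := hχ.1.continuous.bounded_above_of_compact_support hχ.2.1
  obtain ⟨C₁, hC₁⟩ := hcd.bounded_above_of_compact_support hχ.2.1.deriv
  obtain ⟨R, hR⟩ := hχ.2.1.isBounded.subset_closedBall 0
  have hsupp : ∀ t, R < |t| → χ t = 0 ∧ deriv χ t = 0 := fun t ht => by
    have : t ∉ tsupport χ := fun hmem => by
      have := hR hmem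
      rw [Metric.mem_closedBall, dist_zero_right, Real.norm_eq_abs] at this
      linarith
    exact ⟨image_eq_zero_of_notMem_tsupport this, image_eq_zero_of_notMem_tsupport fun h =>
      this (tsupport_deriv_subset h)⟩
  have hmem : Set.Ioi (0 : ℝ) ∈ 𝓝 s := Ioi_mem_nhds hs
  let N : Set ℝ := {r | 0 < r ∧ |τ r - τ s| < 1 ∧ |τ' r| < |τ' s| + 1 ∧ |B₁ r| < |B₁ s| + 1 ∧
    |B₂ r| < |B₂ s| + 1}
  have hN : N ∈ 𝓝 s := by
    have c1 : ContinuousAt (fun r => |τ r - τ s|) s :=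
      ((hτ s hs).continuousAt.sub continuousAt_const).abs
    have e1 := c1.eventually_lt (continuousAt_const (y := (1 : ℝ))) (by simp)
    have e2 := (hτ'.continuousAt hmem).abs.eventually_lt
      (continuousAt_const (y := |τ' s| + 1)) (by simp)
    have e3 := (hB₁.continuousAt hmem).abs.eventually_lt
      (continuousAt_const (y := |B₁ s| + 1)) (by simp)
    have e4 := (hB₂.continuousAt hmem).abs.eventually_lt
      (continuousAt_const (y := |B₂ s| + 1)) (by simp)
    filter_upwards [lt_mem_nhds hs, e1, e2, e3, e4] with r r0 r1 r2 r3 r4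
    exact ⟨r0, r1, r2, r3, r4⟩
  have hmeas : ∀ r, Measurable fun t => χ (t + τ r) := fun r =>
    (hχ.1.continuous.comp (by fun_prop : Continuous fun t => t + τ r)).measurable
  have hmeas' : ∀ r, Measurable fun t => deriv χ (t + τ r) := fun r =>
    (hcd.comp (by fun_prop : Continuous fun t => t + τ r)).measurable
  refine (hasDerivAt_integral_of_dominated_loc_of_deriv_le
    (F := fun s t => χ (t + τ s) * w t s)
    (F' := fun s t => deriv χ (t + τ s) * τ' s * w t s + χ (t + τ s) * wd t s)
    (bound := (Set.Icc (-(R + |τ s| + 1)) (R + |τ s| + 1)).indicator fun _ =>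
      C₁ * (|τ' s| + 1) * (|B₁ s| + 1) + C₀ * (|B₂ s| + 1)) hN ?_ ?_ ?_ ?_ ?_ ?_).2
  · exact Eventually.of_forall fun r => ((hmeas r).mul (hwm r)).aestronglyMeasurable
  · exact ((hχ.integrable.comp_add_right (τ s))).mul_bdd (hwm s).aestronglyMeasurable
      (ae_of_all _ fun t => h₁ t s hs)
  · exact ((((hmeas' s).mul_const _).mul (hwm s)).add
      ((hmeas s).mul (hwdm s))).aestronglyMeasurable
  · refine ae_of_all _ fun t r ⟨r0, r1, r2, r3, r4⟩ => ?_
    by_cases ht : t ∈ Set.Icc (-(R + |τ s| + 1)) (R + |τ s| + 1)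
    · rw [Set.indicator_of_mem ht]
      refine (norm_add_le _ _).trans ?_
      simp only [norm_mul, Real.norm_eq_abs]
      have i1 := hC₀ (t + τ r)
      have i2 := hC₁ (t + τ r)
      rw [Real.norm_eq_abs] at i1 i2
      have i3 := (h₁ t r r0).trans ((le_abs_self _).trans r3.le)
      have i4 := (h₂ t r r0).trans ((le_abs_self _).trans r4.le)
      have i5 := (abs_nonneg _).trans i1
      have i6 := (abs_nonneg _).trans i2
      gcongr
    · rw [Set.indicator_of_notMem ht]
      have : R < |t + τ r| := by
        by_contra! hle
        apply ht
        have j1 := abs_le.1 hle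
        have j2 := abs_lt.1 r1
        have j3 := neg_abs_le (τ s)
        have j4 := le_abs_self (τ s)
        constructor <;> linarith
      obtain ⟨z1, z2⟩ := hsupp _ this
      simp [z1, z2]
  · exact (integrable_indicator_iff measurableSet_Icc).2
      (integrableOn_const (by simp) (by simp))
  · refine ae_of_all _ fun t r ⟨r0, _⟩ => ?_
    have d1 : HasDerivAt χ (deriv χ (t + τ r)) (t + τ r) :=
      (hχ1.differentiable one_ne_zero).differentiableAt.hasDerivAt
    exact ((d1.comp r ((hτ r r0).const_add t))).mul (hw t r r0)

/-- A bounded planar field on space-time, vanishing for nonnegative times, which satisfies the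
mollified divergence and vorticity equations in the sense of distributions in time. -/
structure IsSol (M : ℝ) (V : ℝ → Fin 2 → Euc 2 → ℝ) : Prop where
  meas : ∀ i, Measurable fun p : Euc 2 × ℝ => V p.2 i p.1
  bdd : ∀ t i x, |V t i x| ≤ M
  zero : ∀ t, 0 ≤ t → ∀ i x, V t i x = 0
  div : ∀ χ, Tst χ → ∀ s x, 0 < s → ∫ t, χ t * Dv (V t) s x = 0
  vort : ∀ χ, Tst χ → ∀ s x, 0 < s →
    ∫ t, deriv χ t * Wf (V t) s x = -∫ t, χ t * (Wd (V t) s x - Ff (V t) s x)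

section IsSol

variable {M : ℝ} {V : ℝ → Fin 2 → Euc 2 → ℝ}

lemma IsSol.slice (h : IsSol M V) (t : ℝ) : SlB M (V t) := fun i =>
  ⟨(h.meas i).comp measurable_prodMk_right, h.bdd t i⟩

lemma IsSol.nonneg (h : IsSol M V) : 0 ≤ M := (abs_nonneg _).trans (h.bdd 0 0 0)

lemma IsSol.measurable_Wf (h : IsSol M V) (s : ℝ) (x : Euc 2) :
    Measurable fun t => Wf (V t) s x :=
  (measurable_cv_time (continuous_gkD 0 s) (h.meas 1) x).sub
    (measurable_cv_time (continuous_gkD 1 s) (h.meas 0) x)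

lemma IsSol.measurable_Wd (h : IsSol M V) (s : ℝ) (x : Euc 2) :
    Measurable fun t => Wd (V t) s x :=
  (measurable_cv_time (continuous_gkLD 0 s) (h.meas 1) x).sub
    (measurable_cv_time (continuous_gkLD 1 s) (h.meas 0) x)

lemma IsSol.measurable_Dv (h : IsSol M V) (s : ℝ) (x : Euc 2) :
    Measurable fun t => Dv (V t) s x :=
  (measurable_cv_time (continuous_gkD 0 s) (h.meas 0) x).add
    (measurable_cv_time (continuous_gkD 1 s) (h.meas 1) x)

lemma IsSol.measurable_Ff (h : IsSol M V) (s : ℝ) (x : Euc 2) :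
    Measurable fun t => Ff (V t) s x :=
  Finset.measurable_sum _ fun k _ =>
    (measurable_cv_time (continuous_gkDD k 0 s) ((h.meas k).mul (h.meas 1)) x).sub
      (measurable_cv_time (continuous_gkDD k 1 s) ((h.meas k).mul (h.meas 0)) x)

lemma cv_zero_right (k : Euc 2 → ℝ) (x : Euc 2) : cv k (fun _ => 0) x = 0 := by simp [cv]

lemma IsSol.Wf_zero (h : IsSol M V) {t : ℝ} (ht : 0 ≤ t) (s : ℝ) (x : Euc 2) :
    Wf (V t) s x = 0 := by
  have : ∀ i, V t i = fun _ => 0 := fun i => funext (h.zero t ht i)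
  simp [Wf, this, cv_zero_right]

lemma IsSol.Dv_zero (h : IsSol M V) {t : ℝ} (ht : 0 ≤ t) (s : ℝ) (x : Euc 2) :
    Dv (V t) s x = 0 := by
  have : ∀ i, V t i = fun _ => 0 := fun i => funext (h.zero t ht i)
  simp [Dv, this, cv_zero_right]

lemma IsSol.abs_Wf_le (h : IsSol M V) {s : ℝ} (hs : 0 < s) (t : ℝ) (x : Euc 2) :
    |Wf (V t) s x| ≤ 10 * M / √s :=
  ((Wf_bddMeas (h.slice t) hs).2 x).trans_eq (by ring)

lemma IsSol.abs_Dv_le (h : IsSol M V) {s : ℝ} (hs : 0 < s) (t : ℝ) (x : Euc 2) :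
    |Dv (V t) s x| ≤ 10 * M / √s :=
  (((bddMeas_cv_gkD hs 0 (h.slice t 0)).add (bddMeas_cv_gkD hs 1 (h.slice t 1))).2 x).trans_eq
    (by ring)

lemma IsSol.abs_Wd_le (h : IsSol M V) {s : ℝ} (hs : 0 < s) (t : ℝ) (x : Euc 2) :
    |Wd (V t) s x| ≤ 52 * M * (√s / s ^ 2) :=
  (((cv_bddMeas (by positivity) (continuous_gkLD 0 s) (abs_gkLD_le hs 0) (h.slice t 1)).sub
    (cv_bddMeas (by positivity) (continuous_gkLD 1 s) (abs_gkLD_le hs 1)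
      (h.slice t 0))).2 x).trans_eq (by ring)

/-- One-sided almost everywhere bounds from test functions in time. -/
lemma ae_forall_le_of_test {g : ℝ → ℝ → Euc 2 → ℝ} {h B : ℝ → ℝ}
    (hs : ∀ t s x, 0 < s → ContinuousAt (fun s => g t s x) s)
    (hx : ∀ t s, 0 < s → Continuous (g t s)) (hh : ContinuousOn h (Set.Ioi 0))
    (hh0 : ∀ s, 0 < s → 0 ≤ h s) (hm : ∀ s x, Measurable fun t => g t s x)
    (hB : ∀ s, 0 < s → ∀ t x, |g t s x| ≤ B s) (h0 : ∀ t, 0 ≤ t → ∀ s x, g t s x = 0)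
    (H : ∀ χ, Tst χ → (∀ t, 0 ≤ χ t) → ∀ s x, 0 < s → ∫ t, χ t * g t s x ≤ h s * ∫ t, χ t) :
    ∀ᵐ t, ∀ s x, 0 < s → g t s x ≤ h s := by
  refine ae_forall_le hs hx hh fun s x hs0 => ?_
  filter_upwards [ae_le_of_test (hm s x) (fun t => hB s hs0 t x)
    (fun χ hχ hχ0 => H χ hχ hχ0 s x hs0)] with t ht
  rcases lt_or_ge t 0 with h1 | h1
  · exact ht h1
  · rw [h0 t h1]; exact hh0 s hs0

lemma IsSol.ae_Wf_le (h : IsSol M V) {σ : ℝ} (hσ : |σ| = 1) {b : ℝ → ℝ}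
    (hb : ContinuousOn b (Set.Ioi 0)) (hb0 : ∀ s, 0 < s → 0 ≤ b s)
    (H : ∀ χ, Tst χ → (∀ t, 0 ≤ χ t) → ∀ s x, 0 < s →
      ∫ t, χ t * (σ * Wf (V t) s x) ≤ b s * ∫ t, χ t) :
    ∀ᵐ t, ∀ s x, 0 < s → σ * Wf (V t) s x ≤ b s := by
  refine ae_forall_le_of_test (B := fun s => 10 * M / √s) (fun t s x hs => ?_) (fun t s hs => ?_) hb
    hb0 (fun s x => (h.measurable_Wf s x).const_mul σ) (fun s hs t x => ?_) (fun t ht s x => ?_) H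
  · exact (hasDerivAt_Wf (h.slice t) hs x).continuousAt.const_mul σ
  · exact ((continuous_cv (gaussBdd_gkD hs 0) (h.slice t 1)).sub
      (continuous_cv (gaussBdd_gkD hs 1) (h.slice t 0))).const_mul σ
  · rw [abs_mul, hσ, one_mul]; exact h.abs_Wf_le hs t x
  · rw [h.Wf_zero ht, mul_zero]

lemma IsSol.ae_abs_Wf_le (h : IsSol M V) {b : ℝ → ℝ}
    (hb : ContinuousOn b (Set.Ioi 0)) (hb0 : ∀ s, 0 < s → 0 ≤ b s)
    (H : ∀ χ, Tst χ → (∀ t, 0 ≤ χ t) → ∀ s x, 0 < s →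
      |∫ t, χ t * Wf (V t) s x| ≤ b s * ∫ t, χ t) :
    ∀ᵐ t, ∀ s x, 0 < s → |Wf (V t) s x| ≤ b s := by
  have key : ∀ σ : ℝ, |σ| = 1 → ∀ᵐ t, ∀ s x, 0 < s → σ * Wf (V t) s x ≤ b s := fun σ hσ => by
    refine h.ae_Wf_le hσ hb hb0 fun χ hχ hχ0 s x hs => ?_
    have h1 : ∀ t, χ t * (σ * Wf (V t) s x) = σ * (χ t * Wf (V t) s x) := fun t => by ring
    simp only [h1]
    rw [integral_const_mul]
    refine (le_abs_self _).trans ?_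
    rw [abs_mul, hσ, one_mul]
    exact H χ hχ hχ0 s x hs
  filter_upwards [key 1 (by simp), key (-1) (by simp)] with t h1 h2 s x hs
  exact abs_le.2 ⟨by linarith [h2 s x hs], by linarith [h1 s x hs]⟩

lemma IsSol.ae_divFree (h : IsSol M V) : ∀ᵐ t, SlDF (V t) := by
  have key : ∀ σ : ℝ, |σ| = 1 → ∀ᵐ t, ∀ s x, 0 < s → σ * Dv (V t) s x ≤ 0 := fun σ hσ => by
    refine ae_forall_le_of_test (h := fun _ => 0) (B := fun s => 10 * M / √s)
      (fun t s x hs => ?_) (fun t s hs => ?_) continuousOn_const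
      (fun _ _ => le_rfl) (fun s x => (h.measurable_Dv s x).const_mul σ) (fun s hs t x => ?_)
      (fun t ht s x => ?_) (fun χ hχ hχ0 s x hs => ?_)
    · exact ((hasDerivAt_cv_gkD hs 0 (h.slice t 0) x).continuousAt.add
        (hasDerivAt_cv_gkD hs 1 (h.slice t 1) x).continuousAt).const_mul σ
    · exact ((continuous_cv (gaussBdd_gkD hs 0) (h.slice t 0)).add
        (continuous_cv (gaussBdd_gkD hs 1) (h.slice t 1))).const_mul σ
    · rw [abs_mul, hσ, one_mul]; exact h.abs_Dv_le hs t x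
    · rw [h.Dv_zero ht, mul_zero]
    · have h1 : ∀ t, χ t * (σ * Dv (V t) s x) = σ * (χ t * Dv (V t) s x) := fun t => by ring
      simp only [h1]
      rw [integral_const_mul, h.div χ hχ s x hs]
      simp
  filter_upwards [key 1 (by simp), key (-1) (by simp)] with t h1 h2 s hs x
  linarith [h1 s x hs, h2 s x hs]

/-- Evolution of the mollified vorticity along a moving time average. -/
lemma IsSol.hasDerivAt_average (h : IsSol M V) {χ τ τ' : ℝ → ℝ} (hχ : Tst χ)
    (hτ : ∀ s, 0 < s → HasDerivAt τ (τ' s) s) (hτ' : ContinuousOn τ' (Set.Ioi 0)) (x : Euc 2)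
    {s : ℝ} (hs : 0 < s) (hτ0 : 0 ≤ τ s) :
    HasDerivAt (fun s => ∫ t, χ (t + τ s) * Wf (V t) s x)
      (∫ t, χ (t + τ s) * ((1 - τ' s) * Wd (V t) s x + τ' s * Ff (V t) s x)) s := by
  have hsq : ContinuousOn (fun s : ℝ => 10 * M / √s) (Set.Ioi 0) :=
    continuousOn_const.div (by fun_prop) fun s hs => (Real.sqrt_pos.2 hs).ne'
  have hsq2 : ContinuousOn (fun s : ℝ => 52 * M * (√s / s ^ 2)) (Set.Ioi 0) := by
    refine continuousOn_const.mul (ContinuousOn.div (by fun_prop) (by fun_prop) fun s hs => ?_)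
    have := (Set.mem_Ioi.1 hs).ne'
    positivity
  refine (hasDerivAt_moving_average hχ hτ hτ' (fun t s hs => hasDerivAt_Wf (h.slice t) hs x)
    (fun s => h.measurable_Wf s x) (fun s => h.measurable_Wd s x) hsq hsq2
    (fun t s hs => h.abs_Wf_le hs t x) (fun t s hs => h.abs_Wd_le hs t x) hs).congr_deriv ?_
  have hT := hχ.translate hτ0
  have hv := h.vort _ hT s x hs
  have hd : ∀ t, deriv (fun t => χ (t + τ s)) t = deriv χ (t + τ s) := fun t =>
    deriv_comp_add_const χ (τ s) t
  simp only [hd] at hv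
  have hcd : Continuous (deriv fun t => χ (t + τ s)) :=
    (hT.1.of_le (by exact_mod_cast le_top : (1 : WithTop ℕ∞) ≤ _)).continuous_deriv le_rfl
  have hdi : Integrable fun t => deriv χ (t + τ s) :=
    (hcd.integrable_of_hasCompactSupport hT.2.1.deriv).congr (ae_of_all _ hd)
  have i1 : Integrable fun t => deriv χ (t + τ s) * Wf (V t) s x :=
    hdi.mul_bdd (h.measurable_Wf s x).aestronglyMeasurable
      (ae_of_all _ fun t => h.abs_Wf_le hs t x)
  have i2 : Integrable fun t => χ (t + τ s) * Wd (V t) s x :=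
    hT.integrable.mul_bdd (h.measurable_Wd s x).aestronglyMeasurable
      (ae_of_all _ fun t => h.abs_Wd_le hs t x)
  have i3 : Integrable fun t => χ (t + τ s) * Ff (V t) s x :=
    hT.integrable.mul_bdd (h.measurable_Ff s x).aestronglyMeasurable
      (ae_of_all _ fun t => abs_Ff_le (h.slice t) hs x)
  have e1 : ∀ t, deriv χ (t + τ s) * τ' s * Wf (V t) s x + χ (t + τ s) * Wd (V t) s x =
    τ' s * (deriv χ (t + τ s) * Wf (V t) s x) + χ (t + τ s) * Wd (V t) s x := fun t => by ring
  have e2 : ∀ t, χ (t + τ s) * ((1 - τ' s) * Wd (V t) s x + τ' s * Ff (V t) s x) =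
    (1 - τ' s) * (χ (t + τ s) * Wd (V t) s x) + τ' s * (χ (t + τ s) * Ff (V t) s x) :=
    fun t => by ring
  have e3 : ∀ t, χ (t + τ s) * (Wd (V t) s x - Ff (V t) s x) =
    χ (t + τ s) * Wd (V t) s x - χ (t + τ s) * Ff (V t) s x := fun t => by ring
  simp only [e3] at hv
  rw [integral_sub i2 i3] at hv
  simp only [e1, e2]
  rw [integral_add (i1.const_mul _) i2, integral_add (i2.const_mul _) (i3.const_mul _)]
  simp only [integral_const_mul]
  rw [hv]
  ring

lemma abs_integral_test_le {χ f : ℝ → ℝ} {C : ℝ} (hχ : Tst χ) (hχ0 : ∀ t, 0 ≤ χ t)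
    (hf : ∀ᵐ t, |f t| ≤ C) : |∫ t, χ t * f t| ≤ C * ∫ t, χ t := by
  rw [← integral_const_mul, ← Real.norm_eq_abs]
  refine norm_integral_le_of_norm_le (hχ.integrable.const_mul C) ?_
  filter_upwards [hf] with t ht
  rw [norm_mul, Real.norm_eq_abs, Real.norm_eq_abs, abs_of_nonneg (hχ0 t), mul_comm]
  exact mul_le_mul_of_nonneg_right ht (hχ0 t)

lemma IsSol.abs_average_Wf_le (h : IsSol M V) {χ g g' : ℝ → ℝ} {s₀ : ℝ} (hχ : Tst χ)
    (hχ0 : ∀ t, 0 ≤ χ t) (hs₀ : 0 < s₀) (hs₁ : s₀ ≤ 1)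
    (hg : ∀ s, 0 < s → HasDerivAt g (g' s) s)
    (hF : ∀ᵐ t, ∀ s x, 0 < s → s ≤ 1 → |Ff (V t) s x| ≤ g' s) (x : Euc 2) :
    |∫ t, χ t * Wf (V t) s₀ x| ≤ (10 * M + (g 1 - g s₀)) * ∫ t, χ t := by
  have hd : ∀ s ∈ Set.Icc s₀ 1, HasDerivAt (fun s => ∫ t, χ (t + (s - s₀)) * Wf (V t) s x)
      (∫ t, χ (t + (s - s₀)) * Ff (V t) s x) s := fun s hs => by
    have := h.hasDerivAt_average (τ := fun s => s - s₀) (τ' := fun _ => 1) hχ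
      (fun s _ => (hasDerivAt_id s).sub_const s₀) continuousOn_const x (hs₀.trans_le hs.1)
      (by linarith [hs.1])
    simpa using this
  have hI : ∀ s, ∫ t, χ (t + (s - s₀)) = ∫ t, χ t := fun s => integral_add_right_eq_self χ _
  have h1 := abs_sub_le_of_abs_deriv_le hs₁ hd
    (fun s hs => (hg s (hs₀.trans_le hs.1)).mul_const (∫ t, χ t)) fun s hs => by
      have := abs_integral_test_le (hχ.translate (sub_nonneg.2 hs.1)) (fun t => hχ0 _)
        (f := fun t => Ff (V t) s x) (C := g' s)
        (hF.mono fun t ht => ht s x (hs₀.trans_le hs.1) hs.2)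
      rwa [hI] at this
  have h2 := abs_integral_test_le (hχ.translate (sub_nonneg.2 hs₁)) (fun t => hχ0 _)
    (ae_of_all _ fun t => h.abs_Wf_le one_pos t x)
  rw [hI] at h2
  simp only [sub_self, add_zero, Real.sqrt_one, div_one] at h1 h2
  have h3 := abs_sub_abs_le_abs_sub (∫ t, χ t * Wf (V t) s₀ x)
    (∫ t, χ (t + (1 - s₀)) * Wf (V t) 1 x)
  rw [abs_sub_comm (∫ t, χ t * Wf (V t) s₀ x)] at h3
  linarith

lemma IsSol.ae_abs_Wf_le_of_Ff (h : IsSol M V) {b g g' : ℝ → ℝ}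
    (hb : ContinuousOn b (Set.Ioi 0)) (hb1 : ∀ s, 0 < s → s ≤ 1 → 10 * M + (g 1 - g s) ≤ b s)
    (hb2 : ∀ s, 1 ≤ s → 10 * M / √s ≤ b s) (hb0 : ∀ s, 0 < s → 0 ≤ b s)
    (hg : ∀ s, 0 < s → HasDerivAt g (g' s) s)
    (hF : ∀ᵐ t, ∀ s x, 0 < s → s ≤ 1 → |Ff (V t) s x| ≤ g' s) :
    ∀ᵐ t, ∀ s x, 0 < s → |Wf (V t) s x| ≤ b s := by
  refine h.ae_abs_Wf_le hb hb0 fun χ hχ hχ0 s x hs => ?_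
  have hI : 0 ≤ ∫ t, χ t := integral_nonneg hχ0
  rcases le_total s 1 with h1 | h1
  · exact (h.abs_average_Wf_le hχ hχ0 hs h1 hg hF x).trans
      (mul_le_mul_of_nonneg_right (hb1 s hs h1) hI)
  · exact (abs_integral_test_le hχ hχ0 (ae_of_all _ fun t => h.abs_Wf_le hs t x)).trans
      (mul_le_mul_of_nonneg_right (hb2 s h1) hI)

lemma IsSol.ae_abs_Wf_le_rpow (h : IsSol M V) : ∀ᵐ t, ∀ s x, 0 < s →
    |Wf (V t) s x| ≤ (10 * M + 80 * M ^ 2) * s ^ (-(1 / 4) : ℝ) := by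
  have hM := h.nonneg
  refine h.ae_abs_Wf_le_of_Ff (g := fun s => -80 * M ^ 2 * s ^ (-(1 / 4) : ℝ))
    (g' := fun s => 20 * M ^ 2 * s ^ (-(5 / 4) : ℝ)) ?_ ?_ ?_ ?_ ?_ ?_
  · exact continuousOn_const.mul (continuousOn_id.rpow_const fun s hs => Or.inl (ne_of_gt hs))
  · intro s hs hs1
    have : 1 ≤ s ^ (-(1 / 4) : ℝ) := Real.one_le_rpow_of_pos_of_le_one_of_nonpos hs hs1 (by norm_num)
    simp only [Real.one_rpow]
    nlinarith [sq_nonneg M]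
  · intro s hs
    have h0 : 0 < s := by linarith
    have e : 10 * M / √s = 10 * M * s ^ (-(1 / 2) : ℝ) := by
      rw [Real.rpow_neg h0.le, ← Real.sqrt_eq_rpow]; rfl
    rw [e]
    have : s ^ (-(1 / 2) : ℝ) ≤ s ^ (-(1 / 4) : ℝ) :=
      Real.rpow_le_rpow_of_exponent_le hs (by norm_num)
    have h2 : 0 ≤ s ^ (-(1 / 4) : ℝ) := by positivity
    nlinarith [sq_nonneg M, mul_nonneg (sq_nonneg M) h2, mul_le_mul_of_nonneg_left this hM]
  · intro s hs; positivity
  · intro s hs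
    refine ((Real.hasDerivAt_rpow_const (Or.inl hs.ne')).const_mul _).congr_deriv ?_
    norm_num
    ring
  · refine ae_of_all _ fun t s x hs hs1 => (abs_Ff_le (h.slice t) hs x).trans ?_
    have : s ^ (-1 : ℝ) ≤ s ^ (-(5 / 4) : ℝ) :=
      Real.rpow_le_rpow_of_exponent_ge hs hs1 (by norm_num)
    rw [Real.rpow_neg_one] at this
    calc 20 / s * M ^ 2 = 20 * M ^ 2 * s⁻¹ := by ring
      _ ≤ _ := by gcongr

lemma IsSol.exists_ae_abs_Wf_le (h : IsSol M V) :
    ∃ C, 0 ≤ C ∧ ∀ᵐ t, ∀ s x, 0 < s → |Wf (V t) s x| ≤ C := by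
  have hM := h.nonneg
  set A := 10 * M + 80 * M ^ 2 with hA
  have hA0 : 0 ≤ A := by positivity
  refine ⟨10 * M + 6440 * M * A, by positivity, ?_⟩
  refine h.ae_abs_Wf_le_of_Ff (b := fun _ => 10 * M + 6440 * M * A)
    (g := fun s => 6440 * M * A * s ^ ((1 / 4) : ℝ))
    (g' := fun s => 1610 * M * A * s ^ (-(3 / 4) : ℝ)) continuousOn_const ?_ ?_ ?_ ?_ ?_
  · intro s hs hs1
    have : 0 ≤ s ^ ((1 / 4) : ℝ) := by positivity
    simp only [Real.one_rpow]
    nlinarith [mul_nonneg (mul_nonneg hM hA0) this]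
  · intro s hs
    have : 10 * M / √s ≤ 10 * M := div_le_self (by positivity) (Real.one_le_sqrt.2 hs)
    nlinarith [mul_nonneg hM hA0]
  · intro s hs; positivity
  · intro s hs
    refine ((Real.hasDerivAt_rpow_const (Or.inl hs.ne')).const_mul _).congr_deriv ?_
    norm_num
    ring
  · filter_upwards [h.ae_divFree, h.ae_abs_Wf_le_rpow] with t hD hW s x hs hs1
    exact abs_Ff_le_rpow (h.slice t) hD (fun s hs _ x => hW s x hs) hs hs1 x

lemma IsSol.integrable_test_Wf (h : IsSol M V) {χ : ℝ → ℝ} (hχ : Tst χ) {s : ℝ} (hs : 0 < s)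
    (x : Euc 2) : Integrable fun t => χ t * Wf (V t) s x :=
  hχ.integrable.mul_bdd (h.measurable_Wf s x).aestronglyMeasurable
    (ae_of_all _ fun t => h.abs_Wf_le hs t x)

lemma IsSol.average_Wf_le (h : IsSol M V) {χ : ℝ → ℝ} (hχ : Tst χ) (hχ0 : ∀ t, 0 ≤ χ t) {σ b : ℝ}
    {s : ℝ} (hs : 0 < s) (x : Euc 2) (hb : ∀ᵐ t, σ * Wf (V t) s x ≤ b) :
    σ * ∫ t, χ t * Wf (V t) s x ≤ b * ∫ t, χ t := by
  rw [← integral_const_mul, ← integral_const_mul]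
  refine integral_mono_ae ((h.integrable_test_Wf hχ hs x).const_mul σ)
    (hχ.integrable.const_mul b) ?_
  filter_upwards [hb] with t ht
  have := mul_le_mul_of_nonneg_left ht (hχ0 t)
  linarith

lemma mul_le_of_abs_le {σ w b : ℝ} (hσ : |σ| = 1) (hw : |w| ≤ b) : σ * w ≤ b :=
  (le_abs_self _).trans (by rwa [abs_mul, hσ, one_mul])

/-- Growth estimate for the distance of a moving average to the supremum. -/
lemma IsSol.average_growth (h : IsSol M V) {σ m S s₀ : ℝ} (hσ : |σ| = 1) (hs₀ : 0 < s₀)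
    (hS : s₀ ≤ S) (hm : ∀ᵐ t, ∀ s x, 0 < s → σ * Wf (V t) s x ≤ m) {χ : ℝ → ℝ} (hχ : Tst χ)
    (hχ0 : ∀ t, 0 ≤ χ t) (hχ1 : ∫ t, χ t = 1) (x : Euc 2) :
    m - 10 * M / √S ≤
      (m - σ * ∫ t, χ t * Wf (V t) s₀ x) * Real.exp (2 + 8 * M ^ 2 * S) := by
  have hS0 : 0 < S := hs₀.trans_le hS
  have hqS : 0 < √S := Real.sqrt_pos.2 hS0
  have hqS2 : √S * √S = S := Real.mul_self_sqrt hS0.le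
  set τ : ℝ → ℝ := fun s => (s - s₀) + 2 / 3 * (s * √s - s₀ * √s₀) / √S with hτ
  set c : ℝ := 1 / √S + 4 * M ^ 2 * √S with hc
  have hτd : ∀ s, 0 < s → HasDerivAt τ (1 + √s / √S) s := fun s hs => by
    have hq : 0 < √s := Real.sqrt_pos.2 hs
    have := ((hasDerivAt_id s).sub_const s₀).add
      (((((hasDerivAt_id s).mul (Real.hasDerivAt_sqrt hs.ne')).sub_const (s₀ * √s₀)).const_mul
        (2 / 3)).div_const √S)
    refine this.congr_deriv ?_
    have e : s = √s * √s := (Real.mul_self_sqrt hs.le).symm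
    simp only [id]
    generalize √s = q at *
    subst e
    field_simp
    ring
  have hτ0 : ∀ s, s₀ ≤ s → 0 ≤ τ s := fun s hs => by
    have h1 : s₀ * √s₀ ≤ s * √s := by
      have : 0 ≤ s := hs₀.le.trans hs
      gcongr
    have : 0 ≤ 2 / 3 * (s * √s - s₀ * √s₀) / √S :=
      div_nonneg (mul_nonneg (by norm_num) (sub_nonneg.2 h1)) hqS.le
    simp only [hτ]
    linarith
  set Y : ℝ → ℝ := fun s => ∫ t, χ (t + τ s) * Wf (V t) s x with hY
  have hI : ∀ a, ∫ t, χ (t + a) = 1 := fun a => (integral_add_right_eq_self χ a).trans hχ1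
  have hYd := fun s (hs : s ∈ Set.Icc s₀ S) => h.hasDerivAt_average (τ' := fun s => 1 + √s / √S) hχ
    hτd (by fun_prop) x (hs₀.trans_le hs.1) (hτ0 s hs.1)
  have hYm : ∀ s ∈ Set.Icc s₀ S, σ * Y s ≤ m := fun s hs => by
    have := h.average_Wf_le (hχ.translate (hτ0 s hs.1)) (fun t => hχ0 _) (hs₀.trans_le hs.1) x
      (hm.mono fun t ht => ht s x (hs₀.trans_le hs.1))
    rwa [hI, mul_one] at this
  have hgrow : ∀ s ∈ Set.Icc s₀ S, -(σ * ∫ t, χ (t + τ s) * ((1 - (1 + √s / √S)) * Wd (V t) s x +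
      (1 + √s / √S) * Ff (V t) s x)) ≤ c / √s * (m - σ * Y s) := fun s hs => by
    have hs0 : 0 < s := hs₀.trans_le hs.1
    have hq : 0 < √s := Real.sqrt_pos.2 hs0
    have hT := hχ.translate (hτ0 s hs.1)
    set l : ℝ := √s / √S with hl
    have hl0 : 0 < l := by positivity
    have hl1 : l ≤ 1 := (div_le_one hqS).2 (Real.sqrt_le_sqrt hs.2)
    set k : ℝ := l / s + (1 + l) ^ 2 * M ^ 2 / l with hk
    have hkc : k ≤ c / √s := by
      have e1 : l / s = 1 / √S / √s := by
        rw [hl]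
        nth_rw 2 [← Real.mul_self_sqrt hs0.le]
        field_simp
      have e2 : (1 + l) ^ 2 * M ^ 2 / l ≤ 4 * M ^ 2 / l := by
        gcongr
        nlinarith
      have e3 : 4 * M ^ 2 / l = 4 * M ^ 2 * √S / √s := by rw [hl]; field_simp
      rw [hk, hc, add_div, e1, ← e3]
      linarith
    have i2 : Integrable fun t => χ (t + τ s) * Wd (V t) s x :=
      hT.integrable.mul_bdd (h.measurable_Wd s x).aestronglyMeasurable
        (ae_of_all _ fun t => h.abs_Wd_le hs0 t x)
    have i3 : Integrable fun t => χ (t + τ s) * Ff (V t) s x :=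
      hT.integrable.mul_bdd (h.measurable_Ff s x).aestronglyMeasurable
        (ae_of_all _ fun t => abs_Ff_le (h.slice t) hs0 x)
    have i1 := h.integrable_test_Wf hT hs0 x
    have i4 : Integrable fun t => χ (t + τ s) * ((1 - (1 + l)) * Wd (V t) s x +
        (1 + l) * Ff (V t) s x) := by
      refine ((i2.const_mul (1 - (1 + l))).add (i3.const_mul (1 + l))).congr (ae_of_all _ fun t => ?_)
      simp only [Pi.add_apply]
      ring
    have hle : -(σ * ∫ t, χ (t + τ s) * ((1 - (1 + l)) * Wd (V t) s x +
        (1 + l) * Ff (V t) s x)) ≤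
        ∫ t, (k * m * χ (t + τ s) - k * σ * (χ (t + τ s) * Wf (V t) s x)) := by
      rw [← integral_const_mul, ← integral_neg]
      refine integral_mono_ae (i4.const_mul σ).neg
        ((hT.integrable.const_mul _).sub (i1.const_mul _)) ?_
      filter_upwards [hm, h.ae_divFree, h.ae_abs_Wf_le_rpow] with t h1 h2 h3
      have hb := barrier_slice (h.slice t) h2 (fun s hs _ x => h3 s x hs) (fun s hs x => h1 s x hs)
        hs0 hl0 x
      have := mul_le_mul_of_nonneg_left hb (hχ0 (t + τ s))
      linarith
    rw [integral_sub (hT.integrable.const_mul _) (i1.const_mul _), integral_const_mul,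
      integral_const_mul, hI] at hle
    refine hle.trans ?_
    have h0 : 0 ≤ m - σ * Y s := sub_nonneg.2 (hYm s hs)
    calc k * m * 1 - k * σ * ∫ t, χ (t + τ s) * Wf (V t) s x = k * (m - σ * Y s) := by
          simp only [hY]; ring
      _ ≤ _ := mul_le_mul_of_nonneg_right hkc h0
  have hzd : ∀ s ∈ Set.Icc s₀ S, HasDerivAt (fun s => (m - σ * Y s) * Real.exp (-(2 * c * √s)))
      (-(σ * ∫ t, χ (t + τ s) * ((1 - (1 + √s / √S)) * Wd (V t) s x +
      (1 + √s / √S) * Ff (V t) s x)) * Real.exp (-(2 * c * √s)) + (m - σ * Y s) *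
        (Real.exp (-(2 * c * √s)) * -(2 * c * (1 / (2 * √s))))) s := fun s hs => by
    have hs0 : 0 < s := hs₀.trans_le hs.1
    exact (((hYd s hs).const_mul σ).const_sub m).mul
      (((Real.hasDerivAt_sqrt hs0.ne').const_mul (2 * c)).neg.exp)
  have hanti : AntitoneOn (fun s => (m - σ * Y s) * Real.exp (-(2 * c * √s))) (Set.Icc s₀ S) := by
    refine antitoneOn_of_deriv_nonpos (convex_Icc _ _)
      (fun s hs => (hzd s hs).continuousAt.continuousWithinAt)
      (fun s hs => (hzd s (interior_subset hs)).differentiableAt.differentiableWithinAt)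
      fun s hs => ?_
    have hs := interior_subset hs
    rw [(hzd s hs).deriv]
    have h1 := mul_le_mul_of_nonneg_right (hgrow s hs) (Real.exp_pos (-(2 * c * √s))).le
    have hq : 0 < √s := Real.sqrt_pos.2 (hs₀.trans_le hs.1)
    have e : 2 * c * (1 / (2 * √s)) = c / √s := by field_simp
    rw [e]
    linarith
  have hfin := hanti (Set.left_mem_Icc.2 hS) (Set.right_mem_Icc.2 hS) hS
  simp only at hfin
  have hYS : σ * Y S ≤ 10 * M / √S := by
    have := h.average_Wf_le (hχ.translate (hτ0 S hS)) (fun t => hχ0 _) hS0 x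
      (ae_of_all _ fun t => mul_le_of_abs_le hσ (h.abs_Wf_le hS0 t x))
    rwa [hI, mul_one] at this
  have hY0 : Y s₀ = ∫ t, χ t * Wf (V t) s₀ x := by simp [hY, hτ]
  have hcS : 2 * c * √S = 2 + 8 * M ^ 2 * S := by
    rw [hc]
    have : 1 / √S * √S = 1 := by field_simp
    linear_combination 2 * this + 8 * M ^ 2 * hqS2
  rw [hY0, hcS] at hfin
  have hnn : 0 ≤ m - σ * ∫ t, χ t * Wf (V t) s₀ x := by
    rw [← hY0]; exact sub_nonneg.2 (hYm s₀ (Set.left_mem_Icc.2 hS))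
  have hcn : 0 ≤ c := by positivity
  have h1 : Real.exp (-(2 * c * √s₀)) ≤ 1 := Real.exp_le_one_iff.2 (by
    have : 0 ≤ 2 * c * √s₀ := by positivity
    linarith)
  have h2 := hfin.trans (mul_le_of_le_one_right hnn h1)
  have h3 := mul_le_mul_of_nonneg_right h2 (Real.exp_pos (2 + 8 * M ^ 2 * S)).le
  rw [mul_assoc, ← Real.exp_add, neg_add_cancel, Real.exp_zero, mul_one] at h3
  linarith

lemma IsSol.ae_Wf_nonpos (h : IsSol M V) {σ : ℝ} (hσ : |σ| = 1) :
    ∀ᵐ t, ∀ s x, 0 < s → σ * Wf (V t) s x ≤ 0 := by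
  have hM := h.nonneg
  obtain ⟨C, hC0, hC⟩ := h.exists_ae_abs_Wf_le
  let E : Set ℝ := {r | ∃ χ s x, Tst χ ∧ (∀ t, 0 ≤ χ t) ∧ ∫ t, χ t = 1 ∧ 0 < s ∧
    r = σ * ∫ t, χ t * Wf (V t) s x}
  have hbound : ∀ b, 0 ≤ b → (∀ r ∈ E, r ≤ b) → ∀ᵐ t, ∀ s x, 0 < s → σ * Wf (V t) s x ≤ b := by
    intro b hb0 hb
    refine h.ae_Wf_le hσ (b := fun _ => b) continuousOn_const (fun _ _ => hb0)
      fun χ hχ hχ0 s x hs => ?_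
    have e : ∀ t, χ t * (σ * Wf (V t) s x) = σ * (χ t * Wf (V t) s x) := fun t => by ring
    simp only [e]
    rw [integral_const_mul]
    rcases (integral_nonneg hχ0 : 0 ≤ ∫ t, χ t).eq_or_lt with h0 | h0
    · have := abs_integral_test_le hχ hχ0 (hC.mono fun t ht => ht s x hs)
      rw [← h0] at this ⊢
      rw [mul_zero] at this ⊢
      rw [abs_nonpos_iff.1 this, mul_zero]
    · have hmem := hb _ ⟨fun t => (∫ t, χ t)⁻¹ * χ t, s, x,
        ⟨contDiff_const.mul hχ.1, hχ.2.1.mul_left, (tsupport_mul_subset_right).trans hχ.2.2⟩,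
        fun t => mul_nonneg (inv_nonneg.2 h0.le) (hχ0 t),
        by rw [integral_const_mul, inv_mul_cancel₀ h0.ne'], hs, rfl⟩
      simp only [mul_assoc] at hmem
      rw [integral_const_mul] at hmem
      have := mul_le_mul_of_nonneg_right hmem h0.le
      have e2 : σ * ((∫ t, χ t)⁻¹ * ∫ t, χ t * Wf (V t) s x) * ∫ t, χ t =
        σ * ∫ t, χ t * Wf (V t) s x := by field_simp
      rwa [e2] at this
  refine hbound 0 le_rfl ?_
  by_contra! hcon
  obtain ⟨r₀, hr₀, hr₀pos⟩ := hcon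
  have hbdd : BddAbove E := ⟨C, by
    rintro r ⟨χ, s, x, hχ, hχ0, hχ1, hs, rfl⟩
    have := h.average_Wf_le (σ := σ) hχ hχ0 hs x
      (hC.mono fun t ht => mul_le_of_abs_le hσ (ht s x hs))
    rwa [hχ1, mul_one] at this⟩
  set m := sSup E with hm
  have hm0 : 0 < m := hr₀pos.trans_le (le_csSup hbdd hr₀)
  have hmae := hbound m hm0.le fun r hr => le_csSup hbdd hr
  set S : ℝ := (20 * M / m) ^ 2 + 1 with hS
  have hS0 : 0 < S := by positivity
  have hdec : ∀ s, S ≤ s → 10 * M / √s ≤ m / 2 := fun s hs => by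
    have h1 : 20 * M / m ≤ √s := Real.le_sqrt_of_sq_le (by linarith)
    have hsp : 0 < √s := Real.sqrt_pos.2 (hS0.trans_le hs)
    rw [div_le_iff₀ hm0] at h1
    rw [div_le_iff₀ hsp]
    linarith
  set K := Real.exp (2 + 8 * M ^ 2 * S) with hK
  have hK1 : 1 ≤ K := Real.one_le_exp (by positivity)
  have hK0 : 0 < K := by linarith
  obtain ⟨r, ⟨χ, s, x, hχ, hχ0, hχ1, hs, rfl⟩, hr⟩ :=
    exists_lt_of_lt_csSup ⟨r₀, hr₀⟩ (show m - m / (4 * K) < sSup E by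
      have : 0 < m / (4 * K) := by positivity
      linarith)
  have hmK : m / (4 * K) * K = m / 4 := by field_simp
  rcases le_total s S with h1 | h1
  · have h2 := h.average_growth hσ hs h1 hmae hχ hχ0 hχ1 x
    have h3 := hdec S le_rfl
    have h4 := mul_lt_mul_of_pos_right (show m - σ * ∫ t, χ t * Wf (V t) s x < m / (4 * K) by
      linarith) hK0
    linarith
  · have h2 := h.average_Wf_le (σ := σ) hχ hχ0 hs x
      (ae_of_all _ fun t => mul_le_of_abs_le hσ (h.abs_Wf_le hs t x))
    rw [hχ1, mul_one] at h2
    have h3 := hdec s h1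
    have h4 : m / (4 * K) ≤ m / 4 := by gcongr; linarith
    linarith

/-- Almost every slice of a solution is almost everywhere constant in space. -/
lemma IsSol.ae_ae_eq (h : IsSol M V) : ∀ᵐ t, ∀ᵐ y, ∀ i, V t i y = Ug (V t) 1 i 0 := by
  filter_upwards [h.ae_divFree, h.ae_Wf_nonpos (σ := 1) (by simp),
    h.ae_Wf_nonpos (σ := -1) (by simp)] with t h1 h2 h3
  exact ae_eq_const_of_Wf_eq_zero (h.slice t) h1 fun s hs x => by
    linarith [h2 s x hs, h3 s x hs]

end IsSol

/-- Smooth profiles vanishing on the negative half line and eventually equal to a multiple of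
`exp (v / (4 s))`. -/
structure Cut (s κ : ℝ) (F : ℝ → ℝ) : Prop where
  smooth : ContDiff ℝ (⊤ : ℕ∞) F
  zero : ∀ v < 0, F v = 0
  exp : ∀ v, 1 < v → F v = κ * Real.exp (v / (4 * s))

lemma cut_smoothTransition (s : ℝ) :
    Cut s 1 (fun v => Real.exp (v / (4 * s)) * Real.smoothTransition v) where
  smooth := (Real.contDiff_exp.comp (contDiff_id.div_const _)).mul Real.smoothTransition.contDiff
  zero v hv := by simp [Real.smoothTransition.zero_of_nonpos hv.le]
  exp v hv := by simp [Real.smoothTransition.one_of_one_le hv.le]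

lemma Cut.hasDerivAt {s κ : ℝ} {F : ℝ → ℝ} (h : Cut s κ F) (v : ℝ) :
    HasDerivAt F (deriv F v) v :=
  (h.smooth.differentiable (by simp)).differentiableAt.hasDerivAt

lemma Cut.deriv {s κ : ℝ} {F : ℝ → ℝ} (h : Cut s κ F) : Cut s (κ / (4 * s)) (deriv F) where
  smooth := (contDiff_infty_iff_deriv.1 h.smooth).2
  zero v hv := by
    have : F =ᶠ[𝓝 v] fun _ => 0 := by
      filter_upwards [gt_mem_nhds hv] with w hw using h.zero w hw
    rw [this.deriv_eq]; simp
  exp v hv := by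
    have : F =ᶠ[𝓝 v] fun w => κ * Real.exp (w / (4 * s)) := by
      filter_upwards [lt_mem_nhds hv] with w hw using h.exp w hw
    rw [this.deriv_eq]
    have h1 : HasDerivAt (fun w => κ * Real.exp (w / (4 * s)))
        (κ * (Real.exp (v / (4 * s)) * (1 / (4 * s)))) v :=
      (((hasDerivAt_id v).div_const (4 * s)).exp).const_mul κ
    rw [h1.deriv]; ring

lemma Cut.bound {s κ : ℝ} {F : ℝ → ℝ} (h : Cut s κ F) :
    ∃ C, 0 ≤ C ∧ ∀ v, |F v| ≤ C * Real.exp (v / (4 * s)) := by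
  have hc : Continuous fun v => F v * Real.exp (-(v / (4 * s))) :=
    h.smooth.continuous.mul (by fun_prop)
  obtain ⟨C, hC⟩ := (isCompact_Icc (a := (0 : ℝ)) (b := 1)).exists_bound_of_continuousOn
    hc.continuousOn
  refine ⟨max |κ| C, le_max_of_le_left (abs_nonneg _), fun v => ?_⟩
  rcases lt_or_ge v 0 with h0 | h0
  · rw [h.zero v h0, abs_zero]
    exact mul_nonneg (le_max_of_le_left (abs_nonneg _)) (Real.exp_pos _).le
  rcases lt_or_ge 1 v with h1 | h1
  · rw [h.exp v h1, abs_mul, abs_of_pos (Real.exp_pos _)]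
    exact mul_le_mul_of_nonneg_right (le_max_left _ _) (Real.exp_pos _).le
  · have h2 := hC v ⟨h0, h1⟩
    rw [Real.norm_eq_abs, abs_mul, abs_of_pos (Real.exp_pos _)] at h2
    have h3 := mul_le_mul_of_nonneg_right (h2.trans (le_max_right |κ| C))
      (Real.exp_pos (v / (4 * s))).le
    rwa [mul_assoc, ← Real.exp_add, neg_add_cancel, Real.exp_zero, mul_one] at h3

/-- Compactly supported radial approximations of Gaussians. -/
def rad (s : ℝ) (F : ℝ → ℝ) (n : ℕ) (z : Euc 2) : ℝ :=
  (4 * π * s)⁻¹ * Real.exp (-(n / (4 * s))) * F (n - ‖z‖ ^ 2)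

section

variable {s κ : ℝ} {F : ℝ → ℝ}

lemma Cut.contDiff_rad (h : Cut s κ F) (n : ℕ) : ContDiff ℝ (⊤ : ℕ∞) (rad s F n) :=
  contDiff_const.mul (h.smooth.comp (contDiff_const.sub (contDiff_norm_sq ℝ)))

lemma Cut.rad_eq_zero (h : Cut s κ F) {n : ℕ} {z : Euc 2} (hz : (n : ℝ) < ‖z‖ ^ 2) :
    rad s F n z = 0 := by
  rw [rad, h.zero _ (by linarith), mul_zero]

lemma Cut.abs_rad_le (h : Cut s κ F) (hs : 0 < s) :
    ∃ C, 0 ≤ C ∧ ∀ n z, |rad s F n z| ≤ C * gk s z := by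
  obtain ⟨C, hC0, hC⟩ := h.bound
  refine ⟨C, hC0, fun n z => ?_⟩
  have hp : 0 < (4 * π * s)⁻¹ * Real.exp (-(n / (4 * s))) := by positivity
  rw [rad, abs_mul, abs_of_pos hp, gk]
  calc _ ≤ (4 * π * s)⁻¹ * Real.exp (-(n / (4 * s))) *
        (C * Real.exp ((n - ‖z‖ ^ 2) / (4 * s))) := by gcongr; exact hC _
    _ = C * ((4 * π * s)⁻¹ * (Real.exp (-(n / (4 * s))) * Real.exp ((n - ‖z‖ ^ 2) / (4 * s)))) := by
        ring
    _ = _ := by rw [← Real.exp_add]; congr 4; ring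

lemma Cut.tendsto_rad (h : Cut s κ F) (z : Euc 2) :
    Tendsto (fun n => rad s F n z) atTop (𝓝 (κ * gk s z)) := by
  refine tendsto_const_nhds.congr' ?_
  filter_upwards [tendsto_natCast_atTop_atTop.eventually_gt_atTop (‖z‖ ^ 2 + 1)] with n hn
  rw [rad, h.exp _ (by linarith), gk]
  have : Real.exp (-‖z‖ ^ 2 / (4 * s)) =
      Real.exp (-(n / (4 * s))) * Real.exp ((n - ‖z‖ ^ 2) / (4 * s)) := by
    rw [← Real.exp_add]; congr 1; ring
  rw [this]; ring

lemma Cut.hasLineDerivAt_rad (h : Cut s κ F) (n : ℕ) (i : Fin 2) (z : Euc 2) :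
    HasLineDerivAt ℝ (rad s F n) (-(2 * z i * rad s (_root_.deriv F) n z)) z (bv i) := by
  have h1 : HasDerivAt (fun r : ℝ => (4 * π * s)⁻¹ * Real.exp (-(n / (4 * s))) * F (n - r))
      ((4 * π * s)⁻¹ * Real.exp (-(n / (4 * s))) * (_root_.deriv F (n - ‖z‖ ^ 2) * (-1)))
      (‖z‖ ^ 2) :=
    ((h.hasDerivAt _).comp (‖z‖ ^ 2) ((hasDerivAt_id (‖z‖ ^ 2)).const_sub (n : ℝ))).const_mul _
  exact (hasLineDerivAt_radial i z h1 : HasDerivAt _ _ _).congr_deriv (by rw [rad]; ring)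

end

lemma sq_mul_gk_le {s : ℝ} (hs : 0 < s) (z : Euc 2) :
    (1 + ‖z‖ ^ 2) ^ 2 * gk s z ≤
      4 * (8 * s) ^ 2 * Real.exp (1 / (8 * s)) * gk (2 * s) z := by
  have h1 := Real.quadratic_le_exp_of_nonneg (x := (1 + ‖z‖ ^ 2) / (8 * s)) (by positivity)
  have h2 : (1 + ‖z‖ ^ 2) ^ 2 ≤ 2 * (8 * s) ^ 2 * Real.exp ((1 + ‖z‖ ^ 2) / (8 * s)) := by
    have h3 : ((1 + ‖z‖ ^ 2) / (8 * s)) ^ 2 ≤ 2 * Real.exp ((1 + ‖z‖ ^ 2) / (8 * s)) := by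
      have : 0 ≤ (1 + ‖z‖ ^ 2) / (8 * s) := by positivity
      linarith
    rw [div_pow, div_le_iff₀ (by positivity)] at h3
    linarith
  have e : Real.exp ((1 + ‖z‖ ^ 2) / (8 * s)) * gk s z =
      2 * Real.exp (1 / (8 * s)) * gk (2 * s) z := by
    have e1 : Real.exp ((1 + ‖z‖ ^ 2) / (8 * s)) * Real.exp (-‖z‖ ^ 2 / (4 * s)) =
        Real.exp (1 / (8 * s)) * Real.exp (-‖z‖ ^ 2 / (4 * (2 * s))) := by
      rw [← Real.exp_add, ← Real.exp_add]; congr 1; field_simp; ring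
    rw [gk, gk, mul_left_comm, e1]
    field_simp
  calc _ ≤ 2 * (8 * s) ^ 2 * Real.exp ((1 + ‖z‖ ^ 2) / (8 * s)) * gk s z :=
        mul_le_mul_of_nonneg_right h2 (gk_nonneg hs z)
    _ = 2 * (8 * s) ^ 2 * (Real.exp ((1 + ‖z‖ ^ 2) / (8 * s)) * gk s z) := by ring
    _ = _ := by rw [e]; ring

/-- Compactly supported smooth kernels converging dominatedly. -/
structure KSeq (k : ℕ → Euc 2 → ℝ) (K : Euc 2 → ℝ) : Prop where
  smooth : ∀ n, ContDiff ℝ (⊤ : ℕ∞) (k n)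
  zero : ∀ (n : ℕ) z, (n : ℝ) < ‖z‖ ^ 2 → k n z = 0
  bound : ∃ g : Euc 2 → ℝ, Integrable g ∧ ∀ n z, |k n z| ≤ g z
  lim : ∀ z, Tendsto (fun n => k n z) atTop (𝓝 (K z))

lemma KSeq.add {k k' : ℕ → Euc 2 → ℝ} {K K' : Euc 2 → ℝ} (h : KSeq k K) (h' : KSeq k' K') :
    KSeq (fun n z => k n z + k' n z) (fun z => K z + K' z) where
  smooth n := (h.smooth n).add (h'.smooth n)
  zero n z hz := by rw [h.zero n z hz, h'.zero n z hz, add_zero]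
  bound := by
    obtain ⟨g, hg, hb⟩ := h.bound
    obtain ⟨g', hg', hb'⟩ := h'.bound
    exact ⟨_, hg.add hg', fun n z => (abs_add_le _ _).trans (add_le_add (hb n z) (hb' n z))⟩
  lim z := (h.lim z).add (h'.lim z)

lemma Cut.kseq {s κ : ℝ} {F : ℝ → ℝ} (h : Cut s κ F) (hs : 0 < s) {p : Euc 2 → ℝ} {D : ℝ}
    (hp : ContDiff ℝ (⊤ : ℕ∞) p) (hpD : ∀ z, |p z| ≤ D * (1 + ‖z‖ ^ 2) ^ 2) :
    KSeq (fun n z => p z * rad s F n z) (fun z => p z * (κ * gk s z)) where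
  smooth n := hp.mul (h.contDiff_rad n)
  zero n z hz := by rw [h.rad_eq_zero hz, mul_zero]
  bound := by
    obtain ⟨C, hC0, hC⟩ := h.abs_rad_le hs
    have hD : 0 ≤ D := by
      have := (abs_nonneg _).trans (hpD 0)
      simpa using this
    refine ⟨_, (integrable_gk (by positivity : 0 < 2 * s)).const_mul
      (D * C * (4 * (8 * s) ^ 2 * Real.exp (1 / (8 * s)))), fun n z => ?_⟩
    rw [abs_mul]
    calc _ ≤ (D * (1 + ‖z‖ ^ 2) ^ 2) * (C * gk s z) :=
          mul_le_mul (hpD z) (hC n z) (abs_nonneg _) (by positivity)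
      _ = D * C * ((1 + ‖z‖ ^ 2) ^ 2 * gk s z) := by ring
      _ ≤ D * C * (4 * (8 * s) ^ 2 * Real.exp (1 / (8 * s)) * gk (2 * s) z) := by
          exact mul_le_mul_of_nonneg_left (sq_mul_gk_le hs z) (mul_nonneg hD hC0)
      _ = _ := by ring
  lim z := (h.tendsto_rad z).const_mul _

lemma hasLineDerivAt_const_mul {f : Euc 2 → ℝ} {f' : ℝ} {x v : Euc 2} (c : ℝ)
    (hf : HasLineDerivAt ℝ f f' x v) : HasLineDerivAt ℝ (fun y => c * f y) (c * f') x v :=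
  (hf : HasDerivAt _ _ _).const_mul c

/-- Radial profiles of the derivatives of the truncated heat kernel. -/
def prof (s : ℝ) : ℕ → ℝ → ℝ
  | 0 => fun v => Real.exp (v / (4 * s)) * Real.smoothTransition v
  | k + 1 => deriv (prof s k)

lemma cut_prof (s : ℝ) : ∀ k, Cut s ((1 / (4 * s)) ^ k) (prof s k)
  | 0 => by simpa [prof] using cut_smoothTransition s
  | k + 1 => by
    have := (cut_prof s k).deriv
    rw [pow_succ, mul_one_div]
    exact this

/-- First derivatives of the truncated heat kernel. -/
def kD (s : ℝ) (j : Fin 2) (n : ℕ) (z : Euc 2) : ℝ := -2 * z j * rad s (prof s 1) n z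

/-- Second derivatives of the truncated heat kernel. -/
def kDD (s : ℝ) (i j : Fin 2) (n : ℕ) (z : Euc 2) : ℝ :=
  4 * (z i * z j) * rad s (prof s 2) n z + (if i = j then -2 else 0) * rad s (prof s 1) n z

/-- Third derivatives of the truncated heat kernel. -/
def kDDD (s : ℝ) (i j : Fin 2) (n : ℕ) (z : Euc 2) : ℝ :=
  (4 * z j + if i = j then 8 * z i else 0) * rad s (prof s 2) n z
    - 8 * (z i * z i * z j) * rad s (prof s 3) n z

/-- Derivatives of the Laplacian of the truncated heat kernel. -/
def kLD (s : ℝ) (j : Fin 2) (n : ℕ) (z : Euc 2) : ℝ :=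
  16 * z j * rad s (prof s 2) n z + -8 * (‖z‖ ^ 2 * z j) * rad s (prof s 3) n z

lemma hasLineDerivAt_rad_prof (s : ℝ) (k n : ℕ) (i : Fin 2) (z : Euc 2) :
    HasLineDerivAt ℝ (rad s (prof s k) n) (-(2 * z i * rad s (prof s (k + 1)) n z)) z (bv i) :=
  (cut_prof s k).hasLineDerivAt_rad n i z

lemma hasLineDerivAt_rad_zero (s : ℝ) (n : ℕ) (i : Fin 2) (z : Euc 2) :
    HasLineDerivAt ℝ (rad s (prof s 0) n) (kD s i n z) z (bv i) :=
  (hasLineDerivAt_rad_prof s 0 n i z : HasDerivAt _ _ _).congr_deriv (by rw [kD]; ring)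

lemma hasLineDerivAt_kD (s : ℝ) (i j : Fin 2) (n : ℕ) (z : Euc 2) :
    HasLineDerivAt ℝ (kD s j n) (kDD s i j n z) z (bv i) := by
  have h := hasLineDerivAt_mul
    (hasLineDerivAt_const_mul (-2) (hasLineDerivAt_coord i j z))
    (hasLineDerivAt_rad_prof s 1 n i z)
  refine (h : HasDerivAt _ _ _).congr_deriv ?_
  rw [kDD]
  split_ifs <;> ring

lemma hasLineDerivAt_kDD (s : ℝ) (i j : Fin 2) (n : ℕ) (z : Euc 2) :
    HasLineDerivAt ℝ (kDD s i j n) (kDDD s i j n z) z (bv i) := by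
  have h1 := hasLineDerivAt_mul
    (hasLineDerivAt_const_mul 4
      (hasLineDerivAt_mul (hasLineDerivAt_coord i i z) (hasLineDerivAt_coord i j z)))
    (hasLineDerivAt_rad_prof s 2 n i z)
  have h2 := hasLineDerivAt_const_mul (if i = j then -2 else 0) (hasLineDerivAt_rad_prof s 1 n i z)
  refine (HasDerivAt.add h1 h2).congr_deriv ?_
  rw [kDDD, if_pos (rfl : i = i)]
  split_ifs <;> ring

lemma kDDD_sum (s : ℝ) (j : Fin 2) (n : ℕ) (z : Euc 2) :
    kDDD s 0 j n z + kDDD s 1 j n z = kLD s j n z := by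
  rw [kLD, norm_sq_eq_coords]
  fin_cases j <;> simp [kDDD] <;> ring

lemma norm_le_one_add_sq (z : Euc 2) : ‖z‖ ≤ 1 + ‖z‖ ^ 2 := by
  nlinarith [sq_nonneg (‖z‖ - 1), norm_nonneg z]

lemma one_le_one_add_sq_sq (z : Euc 2) : 1 + ‖z‖ ^ 2 ≤ (1 + ‖z‖ ^ 2) ^ 2 := by
  nlinarith [sq_nonneg ‖z‖]

lemma contDiff_coord (i : Fin 2) : ContDiff ℝ (⊤ : ℕ∞) fun z : Euc 2 => z i := by
  fun_prop

lemma kseq_kD {s : ℝ} (hs : 0 < s) (j : Fin 2) : KSeq (kD s j) (gkD j s) := by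
  have h := (cut_prof s 1).kseq hs (p := fun z => -2 * z j) (D := 2)
    (contDiff_const.mul (contDiff_coord j)) fun z => by
      rw [abs_mul]
      have := sq_coord_le z j
      have := norm_le_one_add_sq z
      have := one_le_one_add_sq_sq z
      norm_num
      linarith
  have e : gkD j s = fun z => -2 * z j * ((1 / (4 * s)) ^ 1 * gk s z) := by
    ext z
    rw [gkD]
    field_simp
    ring
  rw [e]
  exact h

lemma kseq_kDD {s : ℝ} (hs : 0 < s) (i j : Fin 2) : KSeq (kDD s i j) (gkDD i j s) := by
  have h1 := (cut_prof s 2).kseq hs (p := fun z => 4 * (z i * z j)) (D := 4)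
    (contDiff_const.mul ((contDiff_coord i).mul (contDiff_coord j))) fun z => by
      rw [abs_mul, abs_mul]
      have h1 := mul_le_mul (sq_coord_le z i) (sq_coord_le z j) (abs_nonneg _) (norm_nonneg z)
      have := one_le_one_add_sq_sq z
      norm_num
      linarith
  have h2 := (cut_prof s 1).kseq hs (p := fun z => if i = j then -2 else 0) (D := 2)
    contDiff_const fun z => by
      have := one_le_one_add_sq_sq z
      split_ifs
      · rw [abs_neg, abs_two]
        linarith [sq_nonneg ‖z‖]
      · simp; positivity
  have e : gkDD i j s = fun z => 4 * (z i * z j) * ((1 / (4 * s)) ^ 2 * gk s z) +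
      (if i = j then -2 else 0) * ((1 / (4 * s)) ^ 1 * gk s z) := by
    ext z
    rw [gkDD]
    split_ifs <;> field_simp <;> ring
  rw [e]
  exact h1.add h2

lemma kseq_kLD {s : ℝ} (hs : 0 < s) (j : Fin 2) : KSeq (kLD s j) (gkLD j s) := by
  have h1 := (cut_prof s 2).kseq hs (p := fun z => 16 * z j) (D := 16)
    (contDiff_const.mul (contDiff_coord j)) fun z => by
      rw [abs_mul]
      have := sq_coord_le z j
      have := norm_le_one_add_sq z
      have := one_le_one_add_sq_sq z
      norm_num
      linarith
  have h2 := (cut_prof s 3).kseq hs (p := fun z => -8 * (‖z‖ ^ 2 * z j)) (D := 8)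
    (contDiff_const.mul ((contDiff_norm_sq ℝ).mul (contDiff_coord j))) fun z => by
      rw [abs_mul, abs_mul, abs_of_nonneg (sq_nonneg ‖z‖)]
      have h1 : |z j| ≤ 1 + ‖z‖ ^ 2 := (sq_coord_le z j).trans (norm_le_one_add_sq z)
      have h2 := mul_le_mul (by linarith : ‖z‖ ^ 2 ≤ 1 + ‖z‖ ^ 2) h1 (abs_nonneg _) (by positivity)
      norm_num
      linarith
  have e : gkLD j s = fun z => 16 * z j * ((1 / (4 * s)) ^ 2 * gk s z) +
      -8 * (‖z‖ ^ 2 * z j) * ((1 / (4 * s)) ^ 3 * gk s z) := by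
    ext z
    rw [gkLD]
    field_simp
    ring
  rw [e]
  exact h1.add h2

lemma Tst.deriv {χ : ℝ → ℝ} (h : Tst χ) : Tst (deriv χ) :=
  ⟨(contDiff_infty_iff_deriv.1 h.1).2, h.2.1.deriv, (tsupport_deriv_subset).trans h.2.2⟩

/-- Tensor products of a test function in time and a reflected translated kernel in space. -/
def tens (χ : ℝ → ℝ) (k : Euc 2 → ℝ) (x : Euc 2) (p : Euc 2 × ℝ) : ℝ := χ p.2 * k (x - p.1)

section

variable {χ : ℝ → ℝ} {k : Euc 2 → ℝ} {x : Euc 2}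

lemma contDiff_tens (hχ : Tst χ) (hk : ContDiff ℝ (⊤ : ℕ∞) k) :
    ContDiff ℝ (⊤ : ℕ∞) (tens χ k x) :=
  (hχ.1.comp contDiff_snd).mul (hk.comp (contDiff_const.sub contDiff_fst))

lemma pdx_tens (hχ : Tst χ) (hk : ContDiff ℝ (⊤ : ℕ∞) k) {i : Fin 2} {k' : Euc 2 → ℝ}
    (hk' : ∀ z, HasLineDerivAt ℝ k (k' z) z (bv i)) :
    pdx 2 i (tens χ k x) = fun p => -tens χ k' x p := by
  ext p
  have hd : DifferentiableAt ℝ (tens χ k x) p :=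
    ((contDiff_tens hχ hk).differentiable (by simp)).differentiableAt
  have h1 : HasDerivAt (fun t : ℝ => k (x - p.1 + -t • bv i)) (k' (x - p.1) * -1) 0 := by
    have h2 : HasDerivAt (fun t : ℝ => k (x - p.1 + t • bv i)) (k' (x - p.1)) (-0) := by
      rw [neg_zero]; exact hk' (x - p.1)
    exact h2.comp (0 : ℝ) (hasDerivAt_neg (0 : ℝ))
  have h3 : HasLineDerivAt ℝ (tens χ k x) (χ p.2 * (k' (x - p.1) * -1)) p (bv i, 0) := by
    refine ((h1.const_mul (χ p.2)).congr_of_eventuallyEq (Eventually.of_forall fun t => ?_) :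
      HasDerivAt _ _ _)
    simp [tens, sub_eq_add_neg, add_assoc, add_comm]
  rw [pdx, ← hd.lineDeriv_eq_fderiv, h3.lineDeriv, tens]
  ring

lemma pdt_tens (hχ : Tst χ) (hk : ContDiff ℝ (⊤ : ℕ∞) k) :
    pdt 2 (tens χ k x) = tens (deriv χ) k x := by
  ext p
  have hd : DifferentiableAt ℝ (tens χ k x) p :=
    ((contDiff_tens hχ hk).differentiable (by simp)).differentiableAt
  have h1 : HasDerivAt (fun t : ℝ => χ (p.2 + t)) (deriv χ p.2) 0 := by
    have h2 : HasDerivAt χ (deriv χ p.2) (p.2 + 0) := by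
      rw [add_zero]
      exact (hχ.1.differentiable (by simp)).differentiableAt.hasDerivAt
    simpa using h2.comp_const_add p.2 0
  have h3 : HasLineDerivAt ℝ (tens χ k x) (deriv χ p.2 * k (x - p.1)) p (0, 1) := by
    refine ((h1.mul_const (k (x - p.1))).congr_of_eventuallyEq (Eventually.of_forall fun t => ?_) :
      HasDerivAt _ _ _)
    simp [tens]
  rw [pdt, ← hd.lineDeriv_eq_fderiv, h3.lineDeriv, tens]

lemma pdx_neg (i : Fin 2) (g : Euc 2 × ℝ → ℝ) :
    pdx 2 i (fun p => -g p) = fun p => -pdx 2 i g p := by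
  ext p
  rw [pdx, fderiv_fun_neg]
  rfl

lemma pdt_neg (g : Euc 2 × ℝ → ℝ) : pdt 2 (fun p => -g p) = fun p => -pdt 2 g p := by
  ext p
  rw [pdt, fderiv_fun_neg]
  rfl

lemma tens_zero {n : ℕ} (hk0 : ∀ z, (n : ℝ) < ‖z‖ ^ 2 → k z = 0) {p : Euc 2 × ℝ}
    (hp : p ∉ Metric.closedBall x (n + 1) ×ˢ tsupport χ) : tens χ k x p = 0 := by
  rw [tens]
  by_contra hne
  obtain ⟨h1, h2⟩ := mul_ne_zero_iff.1 hne
  refine hp ⟨?_, subset_tsupport _ h1⟩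
  rw [Metric.mem_closedBall, dist_comm, dist_eq_norm]
  by_contra! hlt
  refine h2 (hk0 _ ?_)
  have : (0 : ℝ) ≤ n := n.cast_nonneg
  nlinarith

lemma isCompact_box (hχ : Tst χ) (x : Euc 2) (r : ℝ) :
    IsCompact (Metric.closedBall x r ×ˢ tsupport χ) :=
  (isCompact_closedBall x r).prod hχ.2.1

lemma tsupport_subset_of_box {E : Type*} [Zero E] {f : Euc 2 × ℝ → E} (hχ : Tst χ) {r : ℝ}
    (hf : ∀ p, p ∉ Metric.closedBall x r ×ˢ tsupport χ → f p = 0) :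
    tsupport f ⊆ Set.univ ×ˢ Set.Iio 0 := by
  have h1 : tsupport f ⊆ Metric.closedBall x r ×ˢ tsupport χ :=
    closure_minimal (fun p hp => by_contra fun h => hp (hf p h)) (isCompact_box hχ x r).isClosed
  exact h1.trans (Set.prod_mono (Set.subset_univ _) hχ.2.2)

end

/-- Limits of space-time integrals against truncated kernels. -/
lemma KSeq.tendsto_integral {k : ℕ → Euc 2 → ℝ} {K : Euc 2 → ℝ} (hk : KSeq k K) {χ : ℝ → ℝ}
    (hχ : Tst χ) {b : Euc 2 × ℝ → ℝ} {B : ℝ} (hb : Measurable b) (hB : ∀ p, |b p| ≤ B)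
    (x : Euc 2) :
    Tendsto (fun n => ∫ p, b p * tens χ (k n) x p) atTop
      (𝓝 (∫ t, χ t * cv K (fun y => b (y, t)) x)) := by
  obtain ⟨g, hg, hgb⟩ := hk.bound
  have hG : Integrable fun p : Euc 2 × ℝ => B * (g (x - p.1) * |χ p.2|) :=
    ((hg.comp_sub_left x).mul_prod hχ.integrable.abs).const_mul B
  have hB0 : 0 ≤ B := (abs_nonneg _).trans (hB 0)
  have hmt : ∀ n, Measurable (tens χ (k n) x) := fun n =>
    (contDiff_tens hχ (hk.smooth n)).continuous.measurable
  have hlim : ∀ p, Tendsto (fun n => b p * tens χ (k n) x p) atTop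
      (𝓝 (b p * (χ p.2 * K (x - p.1)))) := fun p =>
    ((hk.lim (x - p.1)).const_mul _).const_mul _
  have hbd : ∀ n p, ‖b p * tens χ (k n) x p‖ ≤ B * (g (x - p.1) * |χ p.2|) := fun n p => by
    rw [norm_mul, Real.norm_eq_abs, Real.norm_eq_abs, tens, abs_mul, mul_comm |χ p.2|]
    gcongr
    · exact hB p
    · exact hgb n _
  have hmL : Measurable fun p : Euc 2 × ℝ => b p * (χ p.2 * K (x - p.1)) :=
    measurable_of_tendsto_metrizable (fun n => hb.mul (hmt n)) (tendsto_pi_nhds.2 hlim)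
  have hiL : Integrable fun p : Euc 2 × ℝ => b p * (χ p.2 * K (x - p.1)) :=
    hG.mono' hmL.aestronglyMeasurable (ae_of_all _ fun p =>
      le_of_tendsto (hlim p).norm (Eventually.of_forall fun n => hbd n p))
  have e : ∫ t, χ t * cv K (fun y => b (y, t)) x = ∫ p : Euc 2 × ℝ, b p * (χ p.2 * K (x - p.1)) := by
    rw [Measure.volume_eq_prod, integral_prod_symm _ (by rwa [← Measure.volume_eq_prod])]
    refine integral_congr_ae (ae_of_all _ fun t => ?_)
    simp only [cv]
    rw [← integral_const_mul]
    refine integral_congr_ae (ae_of_all _ fun y => ?_)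
    simp only
    ring
  rw [e]
  exact tendsto_integral_of_dominated_convergence _
    (fun n => (hb.mul (hmt n)).aestronglyMeasurable) hG (fun n => ae_of_all _ (hbd n))
    (ae_of_all _ hlim)

lemma KSeq.integrable {k : ℕ → Euc 2 → ℝ} {K : Euc 2 → ℝ} (hk : KSeq k K) {χ : ℝ → ℝ}
    (hχ : Tst χ) {b : Euc 2 × ℝ → ℝ} {B : ℝ} (hb : Measurable b) (hB : ∀ p, |b p| ≤ B)
    (x : Euc 2) (n : ℕ) : Integrable fun p => b p * tens χ (k n) x p := by
  have hc := (contDiff_tens (x := x) hχ (hk.smooth n)).continuous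
  have h1 : Integrable (tens χ (k n) x) := hc.integrable_of_hasCompactSupport
    (HasCompactSupport.intro (isCompact_box hχ x (n + 1)) fun p hp => tens_zero (hk.zero n) hp)
  exact h1.bdd_mul hb.aestronglyMeasurable (ae_of_all _ hB)

lemma Tst.eq_zero {χ : ℝ → ℝ} (h : Tst χ) {t : ℝ} (ht : 0 ≤ t) : χ t = 0 := by
  by_contra hne
  exact absurd (h.neg_of_ne hne) (not_lt.2 ht)

lemma setIntegral_neg_time_eq {f g : Euc 2 × ℝ → ℝ} (h1 : ∀ p, p.2 < 0 → f p = g p)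
    (h2 : ∀ p, 0 ≤ p.2 → g p = 0) :
    ∫ p in (Set.univ ×ˢ Set.Iio 0 : Set (Euc 2 × ℝ)), f p = ∫ p, g p := by
  rw [setIntegral_congr_fun (MeasurableSet.univ.prod measurableSet_Iio) (fun p hp => h1 p hp.2)]
  refine setIntegral_eq_integral_of_forall_compl_eq_zero fun p hp => h2 p ?_
  by_contra! hlt
  exact hp ⟨trivial, hlt⟩

/-- The field at negative times, extended by zero. -/
def past (u : Euc 2 → ℝ → Euc 2) (t : ℝ) (i : Fin 2) (x : Euc 2) : ℝ :=
  if t < 0 then u x t i else 0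

section

variable {u : Euc 2 → ℝ → Euc 2} {M : ℝ}

lemma measurable_past (hmeas : Measurable fun q : Euc 2 × ℝ => u q.1 q.2) (i : Fin 2) :
    Measurable fun p : Euc 2 × ℝ => past u p.2 i p.1 := by
  have h1 : Measurable fun p : Euc 2 × ℝ => u p.1 p.2 i :=
    ((EuclideanSpace.proj i : Euc 2 →L[ℝ] ℝ).continuous.measurable).comp hmeas
  exact Measurable.ite (measurableSet_lt measurable_snd measurable_const) h1 measurable_const

lemma abs_past_le (hbd : ∀ x : Euc 2, ∀ t < (0 : ℝ), ‖u x t‖ ≤ M) (t : ℝ) (i : Fin 2)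
    (x : Euc 2) : |past u t i x| ≤ M := by
  rw [past]
  split_ifs with ht
  · exact (sq_coord_le _ i).trans (hbd x t ht)
  · rw [abs_zero]
    exact (norm_nonneg _).trans (hbd 0 (-1) (by norm_num))

lemma truncated_div (hweak : IsWeakNS 2 (Set.Iio 0) u)
    (hmeas : Measurable fun q : Euc 2 × ℝ => u q.1 q.2)
    (hbd : ∀ x : Euc 2, ∀ t < (0 : ℝ), ‖u x t‖ ≤ M) {χ : ℝ → ℝ} (hχ : Tst χ) {s : ℝ} (hs : 0 < s)
    (x : Euc 2) (n : ℕ) :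
    (∫ p : Euc 2 × ℝ, past u p.2 0 p.1 * tens χ (kD s 0 n) x p) +
      ∫ p : Euc 2 × ℝ, past u p.2 1 p.1 * tens χ (kD s 1 n) x p = 0 := by
  have hc := (cut_prof s 0).contDiff_rad n
  have h0 : ∀ p, p ∉ Metric.closedBall x (n + 1) ×ˢ tsupport χ →
      tens χ (rad s (prof s 0) n) x p = 0 := fun p hp =>
    tens_zero (fun z hz => (cut_prof s 0).rad_eq_zero hz) hp
  have h := hweak.1 (tens χ (rad s (prof s 0) n) x) (contDiff_tens hχ hc)
    (HasCompactSupport.intro (isCompact_box hχ x _) h0) (tsupport_subset_of_box hχ h0)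
  simp only [pdx_tens hχ hc (hasLineDerivAt_rad_zero s n _)] at h
  rw [setIntegral_neg_time_eq (g := fun p => -(past u p.2 0 p.1 * tens χ (kD s 0 n) x p +
    past u p.2 1 p.1 * tens χ (kD s 1 n) x p)) (fun p hp => ?_) fun p hp => ?_, integral_neg,
    neg_eq_zero, integral_add] at h
  · exact h
  · exact (kseq_kD hs 0).integrable hχ (measurable_past hmeas 0) (fun p => abs_past_le hbd _ _ _) x n
  · exact (kseq_kD hs 1).integrable hχ (measurable_past hmeas 1) (fun p => abs_past_le hbd _ _ _) x n
  · rw [Fin.sum_univ_two, past, past, if_pos hp, if_pos hp]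
    ring
  · simp [tens, hχ.eq_zero hp]

lemma truncated_vort (hweak : IsWeakNS 2 (Set.Iio 0) u)
    (hmeas : Measurable fun q : Euc 2 × ℝ => u q.1 q.2)
    (hbd : ∀ x : Euc 2, ∀ t < (0 : ℝ), ‖u x t‖ ≤ M) {χ : ℝ → ℝ} (hχ : Tst χ) {s : ℝ} (hs : 0 < s)
    (x : Euc 2) (n : ℕ) :
    (∫ p : Euc 2 × ℝ, past u p.2 0 p.1 * tens (deriv χ) (kD s 1 n) x p) +
      (∫ p : Euc 2 × ℝ, past u p.2 0 p.1 * tens χ (kLD s 1 n) x p) -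
      (∫ p : Euc 2 × ℝ, past u p.2 1 p.1 * tens (deriv χ) (kD s 0 n) x p) -
      (∫ p : Euc 2 × ℝ, past u p.2 1 p.1 * tens χ (kLD s 0 n) x p) =
    ∑ k : Fin 2,
      ((∫ p : Euc 2 × ℝ, past u p.2 k p.1 * past u p.2 0 p.1 * tens χ (kDD s k 1 n) x p) -
        ∫ p : Euc 2 × ℝ, past u p.2 k p.1 * past u p.2 1 p.1 * tens χ (kDD s k 0 n) x p) := by
  have hc : ∀ j, ContDiff ℝ (⊤ : ℕ∞) (kD s j n) := fun j => (kseq_kD hs j).smooth n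
  have hcc : ∀ i j, ContDiff ℝ (⊤ : ℕ∞) (kDD s i j n) := fun i j => (kseq_kDD hs i j).smooth n
  let φ : Euc 2 × ℝ → Euc 2 := fun p => !₂[tens χ (kD s 1 n) x p, -tens χ (kD s 0 n) x p]
  have hφ0 : (fun p => φ p 0) = tens χ (kD s 1 n) x := rfl
  have hφ1 : (fun p => φ p 1) = fun p => -tens χ (kD s 0 n) x p := rfl
  have hφc : ContDiff ℝ (⊤ : ℕ∞) φ := by
    rw [contDiff_euclidean]
    intro i
    fin_cases i
    · exact contDiff_tens hχ (hc 1)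
    · exact (contDiff_tens hχ (hc 0)).neg
  have h0 : ∀ p, p ∉ Metric.closedBall x (n + 1) ×ˢ tsupport χ → φ p = 0 := fun p hp => by
    ext i
    fin_cases i
    · exact tens_zero ((kseq_kD hs 1).zero n) hp
    · exact neg_eq_zero.2 (tens_zero ((kseq_kD hs 0).zero n) hp)
  have hd : ∀ i j, pdx 2 i (tens χ (kD s j n) x) = fun p => -tens χ (kDD s i j n) x p :=
    fun i j => pdx_tens hχ (hc j) (hasLineDerivAt_kD s i j n)
  have hdd : ∀ i j, pdx 2 i (tens χ (kDD s i j n) x) = fun p => -tens χ (kDDD s i j n) x p :=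
    fun i j => pdx_tens hχ (hcc i j) (hasLineDerivAt_kDD s i j n)
  have hlap : ∀ j p, lapx 2 (tens χ (kD s j n) x) p = tens χ (kLD s j n) x p := fun j p => by
    simp only [lapx, Fin.sum_univ_two, hd, pdx_neg, hdd, neg_neg]
    simp only [tens, ← kDDD_sum]
    ring
  have hlapn : ∀ j p, lapx 2 (fun p => -tens χ (kD s j n) x p) p = -tens χ (kLD s j n) x p :=
    fun j p => by
      have h := hlap j p
      simp only [lapx, Fin.sum_univ_two, hd, pdx_neg, hdd, neg_neg] at h ⊢
      rw [← h]
      ring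
  have hdiv : ∀ p, ∑ i : Fin 2, pdx 2 i (fun q => φ q i) p = 0 := fun p => by
    have hsym : kDD s 0 1 n = kDD s 1 0 n := by
      ext z; simp [kDD, mul_comm (z 0)]
    rw [Fin.sum_univ_two, hφ0, hφ1, pdx_neg, hd, hd, hsym]
    ring
  have h := hweak.2 φ hφc (HasCompactSupport.intro (isCompact_box hχ x _) h0)
    (tsupport_subset_of_box hχ h0) hdiv
  have hB := abs_past_le hbd
  have hBB : ∀ t k j y, |past u t k y * past u t j y| ≤ M * M := fun t k j y => by
    rw [abs_mul]
    exact mul_le_mul (hB t k y) (hB t j y) (abs_nonneg _) ((abs_nonneg _).trans (hB t k y))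
  have hm := measurable_past hmeas
  have iD : ∀ j i, Integrable fun p : Euc 2 × ℝ => past u p.2 j p.1 * tens (deriv χ) (kD s i n) x p :=
    fun j i => (kseq_kD hs i).integrable hχ.deriv (hm j) (fun p => hB _ _ _) x n
  have iL : ∀ j i, Integrable fun p : Euc 2 × ℝ => past u p.2 j p.1 * tens χ (kLD s i n) x p :=
    fun j i => (kseq_kLD hs i).integrable hχ (hm j) (fun p => hB _ _ _) x n
  have iQ : ∀ k j i, Integrable fun p : Euc 2 × ℝ =>
      past u p.2 k p.1 * past u p.2 j p.1 * tens χ (kDD s k i n) x p :=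
    fun k j i => (kseq_kDD hs k i).integrable hχ ((hm k).mul (hm j)) (fun p => hBB _ _ _ _) x n
  have iS : ∀ k, Integrable fun p : Euc 2 × ℝ =>
      past u p.2 k p.1 * past u p.2 0 p.1 * tens χ (kDD s k 1 n) x p -
        past u p.2 k p.1 * past u p.2 1 p.1 * tens χ (kDD s k 0 n) x p :=
    fun k => (iQ k 0 1).sub (iQ k 1 0)
  rw [setIntegral_neg_time_eq (g := fun p =>
      past u p.2 0 p.1 * tens (deriv χ) (kD s 1 n) x p + past u p.2 0 p.1 * tens χ (kLD s 1 n) x p -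
      past u p.2 1 p.1 * tens (deriv χ) (kD s 0 n) x p - past u p.2 1 p.1 * tens χ (kLD s 0 n) x p)
      (fun p hp => ?_) fun p hp => ?_,
    setIntegral_neg_time_eq (g := fun p => -∑ k : Fin 2,
      (past u p.2 k p.1 * past u p.2 0 p.1 * tens χ (kDD s k 1 n) x p -
        past u p.2 k p.1 * past u p.2 1 p.1 * tens χ (kDD s k 0 n) x p))
      (fun p hp => ?_) fun p hp => ?_, integral_neg, neg_neg,
    integral_finsetSum _ fun k _ => iS k,
    integral_sub (((iD 0 1).fun_add (iL 0 1)).sub' (iD 1 0)) (iL 1 0),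
    integral_sub ((iD 0 1).fun_add (iL 0 1)) (iD 1 0), integral_add (iD 0 1) (iL 0 1)] at h
  · simp only [integral_sub (iQ _ 0 1) (iQ _ 1 0)] at h
    exact h
  · simp only [Fin.sum_univ_two, hφ0, hφ1, hd, pdx_neg, past, if_pos hp]
    ring
  · simp [tens, hχ.eq_zero hp]
  · simp only [Fin.sum_univ_two, hφ0, hφ1, pdt_neg, pdt_tens hχ (hc _), hlap, hlapn, past,
      if_pos hp]
    ring
  · simp [tens, hχ.eq_zero hp, hχ.deriv.eq_zero hp]

lemma isSol_past (hweak : IsWeakNS 2 (Set.Iio 0) u)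
    (hmeas : Measurable fun q : Euc 2 × ℝ => u q.1 q.2)
    (hbd : ∀ x : Euc 2, ∀ t < (0 : ℝ), ‖u x t‖ ≤ M) : IsSol M (past u) := by
  have hB := abs_past_le hbd
  have hm := measurable_past hmeas
  have hU : ∀ t, SlB M (past u t) := fun t i => ⟨(hm i).comp measurable_prodMk_right, hB t i⟩
  have hM : 0 ≤ M := (abs_nonneg _).trans (hB 0 0 0)
  have hBB : ∀ t k j y, |past u t k y * past u t j y| ≤ M * M := fun t k j y => by
    rw [abs_mul]
    exact mul_le_mul (hB t k y) (hB t j y) (abs_nonneg _) hM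
  have hcv : ∀ {χ : ℝ → ℝ} {K : Euc 2 → ℝ} {b : Euc 2 × ℝ → ℝ} {B D : ℝ} (x : Euc 2), Tst χ →
      Continuous K → Measurable b → (∀ t, |cv K (fun y => b (y, t)) x| ≤ D) →
      Integrable fun t => χ t * cv K (fun y => b (y, t)) x := fun {χ K b B D} x hχ hK hb hD =>
    hχ.integrable.mul_bdd (measurable_cv_time (b := fun t y => b (y, t)) hK hb x).aestronglyMeasurable
      (ae_of_all _ hD)
  refine ⟨hm, hB, fun t ht i x => if_neg (not_lt.2 ht), fun χ hχ s x hs => ?_,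
    fun χ hχ s x hs => ?_⟩
  · have hl : ∀ i, Tendsto (fun n => ∫ p : Euc 2 × ℝ, past u p.2 i p.1 * tens χ (kD s i n) x p) atTop
        (𝓝 (∫ t, χ t * cv (gkD i s) (past u t i) x)) := fun i =>
      (kseq_kD hs i).tendsto_integral hχ (hm i) (fun p => hB _ _ _) x
    have h := tendsto_nhds_unique ((hl 0).add (hl 1))
      (by simp only [truncated_div hweak hmeas hbd hχ hs x]; exact tendsto_const_nhds)
    have hi : ∀ i, Integrable fun t => χ t * cv (gkD i s) (past u t i) x := fun i =>
      hcv (B := M) x hχ (continuous_gkD i s) (hm i)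
        (fun t => (bddMeas_cv_gkD hs i (hU t i)).2 x)
    rw [← integral_add (hi 0) (hi 1)] at h
    simpa only [Dv, mul_add] using h
  · have hD : ∀ j i, Tendsto (fun n => ∫ p : Euc 2 × ℝ, past u p.2 j p.1 *
        tens (deriv χ) (kD s i n) x p) atTop
        (𝓝 (∫ t, deriv χ t * cv (gkD i s) (past u t j) x)) := fun j i =>
      (kseq_kD hs i).tendsto_integral hχ.deriv (hm j) (fun p => hB _ _ _) x
    have hL : ∀ j i, Tendsto (fun n => ∫ p : Euc 2 × ℝ, past u p.2 j p.1 *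
        tens χ (kLD s i n) x p) atTop
        (𝓝 (∫ t, χ t * cv (gkLD i s) (past u t j) x)) := fun j i =>
      (kseq_kLD hs i).tendsto_integral hχ (hm j) (fun p => hB _ _ _) x
    have hQ : ∀ k j i, Tendsto (fun n => ∫ p : Euc 2 × ℝ, past u p.2 k p.1 * past u p.2 j p.1 *
        tens χ (kDD s k i n) x p) atTop
        (𝓝 (∫ t, χ t * cv (gkDD k i s) (fun y => past u t k y * past u t j y) x)) := fun k j i =>
      (kseq_kDD hs k i).tendsto_integral hχ ((hm k).mul (hm j)) (fun p => hBB _ _ _ _) x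
    have h := tendsto_nhds_unique ((((hD 0 1).add (hL 0 1)).sub (hD 1 0)).sub (hL 1 0))
      ((tendsto_finsetSum Finset.univ fun k _ => (hQ k 0 1).sub (hQ k 1 0)).congr fun n =>
        (truncated_vort hweak hmeas hbd hχ hs x n).symm)
    have iD : ∀ j i, Integrable fun t => deriv χ t * cv (gkD i s) (past u t j) x := fun j i =>
      hcv (B := M) x hχ.deriv (continuous_gkD i s) (hm j)
        (fun t => (bddMeas_cv_gkD hs i (hU t j)).2 x)
    have iL : ∀ j i, Integrable fun t => χ t * cv (gkLD i s) (past u t j) x := fun j i =>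
      hcv (B := M) x hχ (continuous_gkLD i s) (hm j)
        (fun t => (cv_bddMeas (by positivity) (continuous_gkLD i s) (abs_gkLD_le hs i)
          (hU t j)).2 x)
    have iQ : ∀ k j i, Integrable fun t =>
        χ t * cv (gkDD k i s) (fun y => past u t k y * past u t j y) x := fun k j i =>
      hcv (B := M) x hχ (continuous_gkDD k i s) ((hm k).mul (hm j))
        (fun t => (bddMeas_cv_gkDD hs k i ((hU t k).mul (hU t j))).2 x)
    have e1 : ∫ t, deriv χ t * Wf (past u t) s x =
        (∫ t, deriv χ t * cv (gkD 0 s) (past u t 1) x) -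
          ∫ t, deriv χ t * cv (gkD 1 s) (past u t 0) x := by
      rw [← integral_sub (iD 1 0) (iD 0 1)]
      simp only [Wf, mul_sub]
    have e2 : ∫ t, χ t * (Wd (past u t) s x - Ff (past u t) s x) =
        ((∫ t, χ t * cv (gkLD 0 s) (past u t 1) x) - ∫ t, χ t * cv (gkLD 1 s) (past u t 0) x) -
        ∑ k : Fin 2, ((∫ t, χ t * cv (gkDD k 0 s) (fun y => past u t k y * past u t 1 y) x) -
          ∫ t, χ t * cv (gkDD k 1 s) (fun y => past u t k y * past u t 0 y) x) := by
      have e3 : ∀ k, (∫ t, χ t * cv (gkDD k 0 s) (fun y => past u t k y * past u t 1 y) x) -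
          ∫ t, χ t * cv (gkDD k 1 s) (fun y => past u t k y * past u t 0 y) x = _ := fun k =>
        (integral_sub (iQ k 1 0) (iQ k 0 1)).symm
      have iS : ∀ k, Integrable fun t =>
          χ t * cv (gkDD k 0 s) (fun y => past u t k y * past u t 1 y) x -
            χ t * cv (gkDD k 1 s) (fun y => past u t k y * past u t 0 y) x :=
        fun k => (iQ k 1 0).sub (iQ k 0 1)
      simp only [e3]
      rw [← integral_finsetSum _ fun k _ => iS k,
        ← integral_sub (iL 1 0) (iL 0 1), ← integral_sub ((iL 1 0).sub' (iL 0 1))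
          (integrable_finsetSum _ fun k _ => iS k)]
      refine integral_congr_ae (ae_of_all _ fun t => ?_)
      simp only [Wd, Ff, mul_sub, Fin.sum_univ_two]
      ring
    rw [e1, e2]
    simp only [Fin.sum_univ_two] at h ⊢
    linarith

end

/-- Theorem 5.1 (Liouville theorem in two dimensions): every bounded weak solution of
the Navier–Stokes equations in ℝ² × (-∞,0) is of the form u(x,t) = b(t). -/
theorem liouville_2d (u : Euc 2 → ℝ → Euc 2) (M : ℝ)
    (hmeas : Measurable (fun q : Euc 2 × ℝ => u q.1 q.2))
    (hbd : ∀ x : Euc 2, ∀ t < (0:ℝ), ‖u x t‖ ≤ M)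
    (hweak : IsWeakNS 2 (Set.Iio 0) u) :
    ∃ b : ℝ → Euc 2, Measurable b ∧ (∃ B : ℝ, ∀ t < (0:ℝ), ‖b t‖ ≤ B) ∧
      ∀ᵐ q ∂(volume.restrict (Set.univ ×ˢ Set.Iio 0 : Set (Euc 2 × ℝ))),
        u q.1 q.2 = b q.2 := by
  have hsol := isSol_past hweak hmeas hbd
  have hM := hsol.nonneg
  let b : ℝ → Euc 2 := fun t => WithLp.toLp 2 fun i => Ug (past u t) 1 i 0
  have hb : Measurable b := (WithLp.measurable_toLp 2 _).comp (measurable_pi_lambda _ fun i =>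
    measurable_cv_time (continuous_gk 1) (hsol.meas i) 0)
  refine ⟨b, hb, ⟨√(M ^ 2 + M ^ 2), fun t _ => ?_⟩, ?_⟩
  · refine Real.le_sqrt_of_sq_le ?_
    rw [norm_sq_eq_coords]
    have h : ∀ i, b t i ^ 2 ≤ M ^ 2 := fun i =>
      sq_le_sq' (abs_le.1 ((Ug_slB (hsol.slice t) one_pos i).2 0)).1
        (abs_le.1 ((Ug_slB (hsol.slice t) one_pos i).2 0)).2
    exact add_le_add (h 0) (h 1)
  · rw [ae_restrict_iff' (MeasurableSet.univ.prod measurableSet_Iio), Measure.volume_eq_prod]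
    have hset : MeasurableSet {p : ℝ × Euc 2 | p.swap ∈ (Set.univ ×ˢ Set.Iio 0 : Set (Euc 2 × ℝ)) →
        u p.2 p.1 = b p.1} := by
      have h1 : MeasurableSet {p : Euc 2 × ℝ | p ∈ (Set.univ ×ˢ Set.Iio 0 : Set (Euc 2 × ℝ)) →
          u p.1 p.2 = b p.2} := by
        have h2 := measurableSet_eq_fun hmeas (hb.comp measurable_snd)
        have h3 : MeasurableSet (Set.univ ×ˢ Set.Iio 0 : Set (Euc 2 × ℝ)) :=
          MeasurableSet.univ.prod measurableSet_Iio
        exact (h3.compl.union h2).congr (by ext p; simp [imp_iff_not_or])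
      exact measurable_swap h1
    have key : ∀ᵐ p ∂((volume : Measure ℝ).prod (volume : Measure (Euc 2))),
        p.swap ∈ (Set.univ ×ˢ Set.Iio 0 : Set (Euc 2 × ℝ)) → u p.2 p.1 = b p.1 := by
      rw [Measure.ae_prod_iff_ae_ae hset]
      filter_upwards [hsol.ae_ae_eq] with t ht
      filter_upwards [ht] with y hy hty
      ext i
      have hlt : t < 0 := hty.2
      simpa only [past, if_pos hlt] using hy i
    have := Measure.measurePreserving_swap (μ := (volume : Measure (Euc 2)))
      (ν := (volume : Measure ℝ)) |>.quasiMeasurePreserving.ae key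
    simpa using this

end
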